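/- (Bombieri–Vinogradov theorem.) For every A > 0 there exist B = B(A) > 0 and C = C(A) > 0 such that for all x ≥ 2, ∑_{q ≤ x^{1/2} (log x)^{−B}} max_{a : gcd(a,q)=1} |π(x; q, a) − π(x)/φ(q)| ≤ C · x · (log x)^{−A}. -/

import Mathlib

open scoped Classical

/-- `primesBelowInAP x q a` is `π(x; q, a)`, the number of primes `p ≤ x` with
`p ≡ a (mod q)`. -/
noncomputable def primesBelowInAP (x : ℝ) (q : ℕ) (a : ZMod q) : ℕ :=
  ((Finset.range (⌊x⌋₊ + 1)).filter (fun p : ℕ => p.Prime ∧ (p : ZMod q) = a)).card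

namespace BombieriVinogradov

open Complex MeasureTheory Set Filter Topology

/-- The kernel `1 / (s (s + 1))` on the vertical line with real part `σ`. -/
noncomputable def lineKernel (σ t : ℝ) : ℂ :=
  1 / (((σ : ℂ) + t * I) * ((σ : ℂ) + t * I + 1))

lemma norm_lineKernel_le {σ : ℝ} (hσ : 1 / 2 ≤ σ) (t : ℝ) :
    ‖lineKernel σ t‖ ≤ 4 * (1 + t ^ 2)⁻¹ := by
  have hsq : ∀ u : ℝ, 1 / 2 ≤ u → (1 / 2) * Real.sqrt (1 + t ^ 2) ≤ ‖(u : ℂ) + t * I‖ := by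
    intro u hu
    rw [Complex.norm_add_mul_I]
    rw [show (1 / 2 : ℝ) * √(1 + t ^ 2) = √((1 + t ^ 2) / 4) by
      rw [Real.sqrt_div' _ (by norm_num), show √(4 : ℝ) = 2 by
        rw [show (4 : ℝ) = 2 ^ 2 by norm_num]; exact Real.sqrt_sq (by norm_num)]
      ring]
    apply Real.sqrt_le_sqrt
    nlinarith [sq_nonneg t]
  have h1 := hsq σ hσ
  have h2 := hsq (σ + 1) (by linarith)
  have h2' : (1 / 2) * Real.sqrt (1 + t ^ 2) ≤ ‖(σ : ℂ) + t * I + 1‖ := by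
    convert h2 using 2
    push_cast; ring
  unfold lineKernel
  rw [norm_div, norm_mul, norm_one, one_div]
  have hpos : 0 < 1 + t ^ 2 := by positivity
  have h3 : (1 + t ^ 2) / 4 ≤ ‖(σ : ℂ) + t * I‖ * ‖(σ : ℂ) + t * I + 1‖ := by
    calc (1 + t ^ 2) / 4 = ((1 / 2) * Real.sqrt (1 + t ^ 2)) * ((1 / 2) * Real.sqrt (1 + t ^ 2)) := by
          have := Real.mul_self_sqrt hpos.le
          nlinarith
      _ ≤ _ := by gcongr
  calc (‖(σ : ℂ) + t * I‖ * ‖(σ : ℂ) + t * I + 1‖)⁻¹ ≤ ((1 + t ^ 2) / 4)⁻¹ := by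
        gcongr
    _ = 4 * (1 + t ^ 2)⁻¹ := by rw [inv_div, div_eq_mul_inv]

lemma line_ne_zero {σ : ℝ} (hσ : 0 < σ) (t : ℝ) : (σ : ℂ) + t * I ≠ 0 := by
  intro h
  have := congrArg Complex.re h
  simp at this
  linarith

lemma continuous_lineKernel {σ : ℝ} (hσ : 0 < σ) : Continuous (lineKernel σ) := by
  unfold lineKernel
  refine Continuous.div (by fun_prop) (by fun_prop) fun t => ?_
  refine mul_ne_zero (line_ne_zero hσ t) ?_
  have := line_ne_zero (σ := σ + 1) (by linarith) t
  intro h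
  apply this
  push_cast
  rw [← h]; ring

lemma integrable_lineKernel {σ : ℝ} (hσ : 1 / 2 ≤ σ) : Integrable (lineKernel σ) := by
  refine Integrable.mono' (integrable_inv_one_add_sq.const_mul 4)
    (continuous_lineKernel (by linarith)).aestronglyMeasurable ?_
  filter_upwards with t using norm_lineKernel_le hσ t

lemma max_one_sub_eq_integral {σ u : ℝ} (hσ : 1 / 2 ≤ σ) (hu : 0 < u) :
    ((max 0 (1 - u) : ℝ) : ℂ) =
      1 / (2 * Real.pi) * ∫ t : ℝ, (u : ℂ) ^ (-((σ : ℂ) + t * I)) * lineKernel σ t := by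
  have hσ0 : 0 < σ := by linarith
  set f : ℝ → ℂ := fun t => indicator (Ioc 0 1) (fun _ => (1 : ℂ)) t -
    indicator (Ioc 0 1) (fun t : ℝ => (t : ℂ) ^ (1 : ℂ)) t with hf
  have hm : ∀ s : ℂ, 0 < s.re → HasMellin f s (1 / s - 1 / (s + 1)) := fun s hs => by
    have h1 := hasMellin_one_Ioc hs
    have h2 := hasMellin_cpow_Ioc 1 (s := s) (by simp; linarith)
    have := hasMellin_sub h1.1 h2.1
    rw [h1.2, h2.2] at this
    exact this
  have hre : ∀ t : ℝ, ((σ : ℂ) + t * I).re = σ := fun t => by simp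
  have hker : ∀ t : ℝ, mellin f ((σ : ℂ) + t * I) = lineKernel σ t := fun t => by
    rw [(hm _ (by rw [hre]; exact hσ0)).2, lineKernel]
    have h1 := line_ne_zero hσ0 t
    have h2 : (σ : ℂ) + t * I + 1 ≠ 0 := by
      have := line_ne_zero (σ := σ + 1) (by linarith) t
      intro h
      apply this
      push_cast
      rw [← h]; ring
    field_simp
    ring
  have hval : ∀ t : ℝ, 0 < t → f t = ((max 0 (1 - t) : ℝ) : ℂ) := fun t ht => by
    by_cases h : t ≤ 1
    · have : t ∈ Ioc (0 : ℝ) 1 := ⟨ht, h⟩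
      simp only [hf, indicator_of_mem this]
      rw [max_eq_right (by linarith)]
      simp
    · have : t ∉ Ioc (0 : ℝ) 1 := fun h' => h h'.2
      simp only [hf, indicator_of_notMem this]
      rw [max_eq_left (by linarith)]
      simp
  have hcont : ContinuousAt f u := by
    have : ContinuousAt (fun t : ℝ => ((max 0 (1 - t) : ℝ) : ℂ)) u := by fun_prop
    refine this.congr ?_
    filter_upwards [lt_mem_nhds hu] with t ht using (hval t ht).symm
  have hvi : VerticalIntegrable (mellin f) σ := by
    unfold VerticalIntegrable
    simp_rw [hker]
    exact integrable_lineKernel hσ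
  have := mellinInv_mellin_eq σ f hu (hm σ (by simpa using hσ0)).1 hvi hcont
  rw [hval u hu] at this
  rw [← this, mellinInv]
  simp_rw [hker]
  simp [Complex.real_smul]

/-- The Cesàro-weighted sum `∑_{n ≤ x} a(n) (1 - n / x)`. -/
noncomputable def smoothSum (a : ℕ → ℂ) (x : ℝ) : ℂ :=
  ∑ n ∈ Finset.Icc 1 ⌊x⌋₊, a n * ((1 - n / x : ℝ) : ℂ)

lemma div_cpow_neg {x : ℝ} (hx : 0 < x) (n : ℕ) (s : ℂ) :
    (((n / x : ℝ)) : ℂ) ^ (-s) = (x : ℂ) ^ s / (n : ℂ) ^ s := by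
  rw [Complex.ofReal_div, Complex.ofReal_natCast]
  have h := Complex.div_cpow_ofReal_nonneg (a := n) (b := x) (by positivity) hx.le (-s)
  rw [Complex.ofReal_natCast] at h
  rw [h, Complex.cpow_neg, Complex.cpow_neg, div_eq_mul_inv, inv_inv, mul_comm, div_eq_mul_inv]

lemma norm_ofReal_cpow_line {x : ℝ} (hx : 0 < x) (σ t : ℝ) :
    ‖(x : ℂ) ^ ((σ : ℂ) + t * I)‖ = x ^ σ := by
  rw [Complex.norm_cpow_eq_rpow_re_of_pos hx]
  simp

lemma norm_term_line (a : ℕ → ℂ) (σ t : ℝ) (n : ℕ) :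
    ‖LSeries.term a ((σ : ℂ) + t * I) n‖ = ‖LSeries.term a σ n‖ := by
  simp [LSeries.norm_term_eq]

lemma smoothSum_eq_tsum (a : ℕ → ℂ) {x : ℝ} (hx : 0 < x) :
    smoothSum a x = ∑' n : ℕ, if n = 0 then 0 else a n * ((max 0 (1 - n / x) : ℝ) : ℂ) := by
  rw [tsum_eq_sum (s := Finset.Icc 1 ⌊x⌋₊), smoothSum]
  · refine Finset.sum_congr rfl fun n hn => ?_
    rw [Finset.mem_Icc] at hn
    have hn0 : n ≠ 0 := by omega
    have : (n : ℝ) ≤ x := (Nat.le_floor_iff hx.le).1 hn.2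
    rw [if_neg hn0, max_eq_right]
    rw [sub_nonneg, div_le_one hx]
    exact this
  · intro n hn
    split_ifs with h
    · rfl
    · rw [Finset.mem_Icc, not_and_or] at hn
      have h1 : ⌊x⌋₊ < n := by omega
      have h2 : x < n := (Nat.floor_lt hx.le).1 h1
      rw [max_eq_left]
      · simp
      · rw [sub_nonpos, one_le_div hx]
        exact h2.le

lemma smoothSum_eq_integral {a : ℕ → ℂ} {σ x : ℝ} (hσ : 1 / 2 ≤ σ) (hx : 0 < x)
    (ha : LSeriesSummable a σ) :
    smoothSum a x = 1 / (2 * Real.pi) *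
      ∫ t : ℝ, LSeries a ((σ : ℂ) + t * I) * (x : ℂ) ^ ((σ : ℂ) + t * I) * lineKernel σ t := by
  set F : ℕ → ℝ → ℂ := fun n t =>
    LSeries.term a ((σ : ℂ) + t * I) n * (x : ℂ) ^ ((σ : ℂ) + t * I) * lineKernel σ t with hF
  have hx0 : (x : ℂ) ≠ 0 := by exact_mod_cast hx.ne'
  have hnorm : ∀ n t, ‖F n t‖ = ‖LSeries.term a σ n‖ * x ^ σ * ‖lineKernel σ t‖ := fun n t => by
    simp only [hF, norm_mul, norm_term_line, norm_ofReal_cpow_line hx]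
  have hcont : ∀ n, Continuous (F n) := fun n => by
    refine Continuous.mul (Continuous.mul ?_ ?_) (continuous_lineKernel (by linarith))
    · by_cases hn : n = 0
      · simpa [hn, LSeries.term_zero] using continuous_const
      · simp only [LSeries.term_of_ne_zero hn]
        refine Continuous.div continuous_const ?_ ?_
        · exact Continuous.const_cpow (by fun_prop) (Or.inl (by exact_mod_cast hn))
        · intro t
          simp [Complex.cpow_eq_zero_iff, hn]
    · exact Continuous.const_cpow (by fun_prop) (Or.inl hx0)
  have hInt : ∀ n, Integrable (F n) := fun n => by
    refine Integrable.mono' ((integrable_lineKernel hσ).norm.const_mul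
      (‖LSeries.term a σ n‖ * x ^ σ)) (hcont n).aestronglyMeasurable ?_
    filter_upwards with t using (hnorm n t).le
  have hsum : Summable fun n => ∫ t, ‖F n t‖ := by
    simp_rw [hnorm, integral_const_mul]
    exact (ha.norm.mul_right _).mul_right _
  have key := integral_tsum_of_summable_integral_norm hInt hsum
  have h1 : ∀ t, ∑' n, F n t =
      LSeries a ((σ : ℂ) + t * I) * (x : ℂ) ^ ((σ : ℂ) + t * I) * lineKernel σ t := fun t => by
    simp only [hF, LSeries, tsum_mul_right]
  simp_rw [h1] at key
  rw [← key, smoothSum_eq_tsum a hx, ← tsum_mul_left]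
  refine tsum_congr fun n => ?_
  by_cases hn : n = 0
  · simp [hn, hF, LSeries.term_zero]
  · rw [if_neg hn, max_one_sub_eq_integral hσ (div_pos (by positivity) hx)]
    rw [mul_left_comm, ← integral_const_mul]
    congr 2
    ext t
    rw [div_cpow_neg hx, hF]
    simp only [LSeries.term_of_ne_zero hn]
    ring

lemma integrable_one_add_sq_rpow :
    Integrable fun t : ℝ => (1 + t ^ 2) ^ (-(3 / 4) : ℝ) := by
  have := integrable_rpow_neg_one_add_norm_sq (E := ℝ) (μ := volume) (r := 3 / 2) (by norm_num)
  convert this using 3 with t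
  · simp
  · norm_num

/-- An absolute constant in the estimates for Cesàro-weighted sums by vertical integrals. -/
noncomputable def perronConst : ℝ := ∫ t : ℝ, (1 + t ^ 2) ^ (-(3 / 4) : ℝ)

lemma perronConst_nonneg : 0 ≤ perronConst :=
  integral_nonneg fun t => Real.rpow_nonneg (by positivity) _

lemma norm_smoothSum_le {a : ℕ → ℂ} {σ x D : ℝ} (hσ : 1 / 2 ≤ σ) (hx : 0 < x)
    (ha : LSeriesSummable a σ)
    (hD : ∀ t : ℝ, ‖LSeries a ((σ : ℂ) + t * I)‖ ≤ D * (1 + t ^ 2) ^ (1 / 4 : ℝ)) :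
    ‖smoothSum a x‖ ≤ perronConst * D * x ^ σ := by
  have hpi := Real.pi_gt_three
  rw [smoothSum_eq_integral hσ hx ha, norm_mul]
  have hbound : ∀ t : ℝ, ‖LSeries a ((σ : ℂ) + t * I) * (x : ℂ) ^ ((σ : ℂ) + t * I) *
      lineKernel σ t‖ ≤ 4 * D * x ^ σ * (1 + t ^ 2) ^ (-(3 / 4) : ℝ) := fun t => by
    rw [norm_mul, norm_mul, norm_ofReal_cpow_line hx]
    have hp : (0 : ℝ) < 1 + t ^ 2 := by positivity
    calc _ ≤ (D * (1 + t ^ 2) ^ (1 / 4 : ℝ)) * x ^ σ * (4 * (1 + t ^ 2)⁻¹) := by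
          have := norm_lineKernel_le hσ t
          have h0 := (norm_nonneg _).trans (hD t)
          gcongr
          exact hD t
      _ = 4 * D * x ^ σ * ((1 + t ^ 2) ^ (1 / 4 : ℝ) * (1 + t ^ 2) ^ (-1 : ℝ)) := by
          rw [Real.rpow_neg_one]; ring
      _ = _ := by
          rw [← Real.rpow_add hp]; norm_num
  have h2 := norm_integral_le_of_norm_le (integrable_one_add_sq_rpow.const_mul (4 * D * x ^ σ))
    (ae_of_all _ hbound)
  rw [integral_const_mul] at h2
  have hD0 : 0 ≤ D := by simpa using (norm_nonneg _).trans (hD 0)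
  have h3 : ‖(1 / (2 * Real.pi) : ℂ)‖ ≤ 1 / 4 := by
    rw [norm_div, norm_one, norm_mul, Complex.norm_real, Real.norm_eq_abs,
      abs_of_pos Real.pi_pos, Complex.norm_ofNat]
    gcongr
    linarith
  calc _ ≤ 1 / 4 * (4 * D * x ^ σ * ∫ t : ℝ, (1 + t ^ 2) ^ (-(3 / 4) : ℝ)) := by gcongr
    _ = _ := by rw [perronConst]; ring

lemma sum_Ico_sub_succ (g : ℕ → ℝ) {M N : ℕ} (h : M ≤ N) :
    ∑ n ∈ Finset.Ico M N, (g n - g (n + 1)) = g M - g N := by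
  have := Finset.sum_Ico_sub g h
  rw [← neg_inj, ← Finset.sum_neg_distrib]
  simpa using this

lemma sum_Ico_mul_eq_abel {R : Type*} [CommRing R] (f g : ℕ → R) {M N : ℕ} (h : M ≤ N) :
    ∑ n ∈ Finset.Ico M N, f n * g n = (∑ n ∈ Finset.Ico M N, f n) * g N +
      ∑ n ∈ Finset.Ico M N, (∑ k ∈ Finset.Ico M (n + 1), f k) * (g n - g (n + 1)) := by
  induction N, h using Nat.le_induction with
  | base => simp
  | succ n hn ih =>
    simp only [Finset.sum_Ico_succ_top hn, ih]
    ring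

lemma norm_sum_Ico_mul_le {f g : ℕ → ℂ} {B : ℝ}
    (hf : ∀ M N, ‖∑ n ∈ Finset.Ico M N, f n‖ ≤ B) {M N : ℕ} (h : M ≤ N) :
    ‖∑ n ∈ Finset.Ico M N, f n * g n‖ ≤
      B * (‖g N‖ + ∑ n ∈ Finset.Ico M N, ‖g n - g (n + 1)‖) := by
  rw [sum_Ico_mul_eq_abel f g h, mul_add, Finset.mul_sum]
  refine (norm_add_le _ _).trans (add_le_add ?_ ((norm_sum_le _ _).trans ?_))
  · rw [norm_mul]
    exact mul_le_mul_of_nonneg_right (hf _ _) (norm_nonneg _)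
  · refine Finset.sum_le_sum fun n _ => ?_
    rw [norm_mul]
    exact mul_le_mul_of_nonneg_right (hf _ _) (norm_nonneg _)

lemma norm_sum_Ico_mul_antitone_le {f : ℕ → ℂ} {g : ℕ → ℝ} {B : ℝ}
    (hf : ∀ M N, ‖∑ n ∈ Finset.Ico M N, f n‖ ≤ B) {M N : ℕ} (h : M ≤ N)
    (hg0 : 0 ≤ g N) (hg : ∀ n ∈ Finset.Ico M N, g (n + 1) ≤ g n) :
    ‖∑ n ∈ Finset.Ico M N, f n * (g n : ℂ)‖ ≤ B * g M := by
  refine (norm_sum_Ico_mul_le hf h).trans (le_of_eq ?_)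
  congr 1
  rw [Complex.norm_real, Real.norm_of_nonneg hg0]
  have : ∀ n ∈ Finset.Ico M N, ‖((g n : ℂ) - g (n + 1))‖ = g n - g (n + 1) := fun n hn => by
    rw [← Complex.ofReal_sub, Complex.norm_real, Real.norm_of_nonneg (sub_nonneg.2 (hg n hn))]
  rw [Finset.sum_congr rfl this, sum_Ico_sub_succ g h]
  ring

lemma norm_sum_Ico_mul_monotone_le {f : ℕ → ℂ} {g : ℕ → ℝ} {B : ℝ}
    (hf : ∀ M N, ‖∑ n ∈ Finset.Ico M N, f n‖ ≤ B) {M N : ℕ} (h : M ≤ N)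
    (hg0 : 0 ≤ g M) (hg : ∀ n ∈ Finset.Ico M N, g n ≤ g (n + 1)) :
    ‖∑ n ∈ Finset.Ico M N, f n * (g n : ℂ)‖ ≤ 2 * B * g N := by
  have hB : 0 ≤ B := (norm_nonneg _).trans (hf 0 0)
  refine (norm_sum_Ico_mul_le hf h).trans ?_
  have : ∀ n ∈ Finset.Ico M N, ‖((g n : ℂ) - g (n + 1))‖ = g (n + 1) - g n := fun n hn => by
    rw [norm_sub_rev, ← Complex.ofReal_sub, Complex.norm_real,
      Real.norm_of_nonneg (sub_nonneg.2 (hg n hn))]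
  rw [Finset.sum_congr rfl this, Finset.sum_Ico_sub g h]
  have hmn : g M ≤ g N := by
    have := Finset.sum_nonneg fun n hn => sub_nonneg.2 (hg n hn)
    rw [Finset.sum_Ico_sub g h] at this
    linarith
  rw [Complex.norm_real, Real.norm_of_nonneg (hg0.trans hmn)]
  nlinarith

lemma sum_Ico_zmod_eq (q : ℕ) [NeZero q] (Φ : ZMod q → ℂ) (M : ℕ) :
    ∑ n ∈ Finset.Ico M (M + q), Φ (n : ZMod q) = ∑ a, Φ a := by
  refine Finset.sum_bij (fun n _ => (n : ZMod q)) (fun _ _ => Finset.mem_univ _) ?_ ?_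
    (fun _ _ => rfl)
  · intro a ha b hb hab
    rw [ZMod.natCast_eq_natCast_iff] at hab
    rw [Finset.mem_Ico] at ha hb
    rcases le_total a b with h | h
    · have := (Nat.modEq_iff_dvd' h).1 hab
      have h2 := Nat.eq_zero_of_dvd_of_lt this (by omega)
      omega
    · have := (Nat.modEq_iff_dvd' h).1 hab.symm
      have h2 := Nat.eq_zero_of_dvd_of_lt this (by omega)
      omega
  · intro b _
    refine ⟨M + (b - (M : ZMod q)).val, ?_, ?_⟩
    · rw [Finset.mem_Ico]
      have := ZMod.val_lt (b - (M : ZMod q))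
      omega
    · push_cast
      rw [ZMod.natCast_zmod_val]
      ring

lemma norm_sum_Ico_zmod_le (q : ℕ) [NeZero q] {Φ : ZMod q → ℂ} (hΦ : ∑ a, Φ a = 0)
    (hb : ∀ a, ‖Φ a‖ ≤ 1) (M N : ℕ) : ‖∑ n ∈ Finset.Ico M N, Φ (n : ZMod q)‖ ≤ q := by
  have hq : 0 < q := Nat.pos_of_ne_zero (NeZero.ne q)
  induction hk : N - M using Nat.strong_induction_on generalizing M with
  | _ k ih =>
    by_cases hkq : k < q
    · calc _ ≤ ∑ n ∈ Finset.Ico M N, ‖Φ (n : ZMod q)‖ := norm_sum_le _ _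
        _ ≤ ∑ n ∈ Finset.Ico M N, 1 := Finset.sum_le_sum fun n _ => hb _
        _ = ((N - M : ℕ) : ℝ) := by simp
        _ ≤ q := by rw [hk]; exact_mod_cast hkq.le
    · have h1 := Finset.sum_Ico_consecutive (fun n : ℕ => Φ (n : ZMod q))
        (show M ≤ M + q by omega) (show M + q ≤ N by omega)
      rw [← h1, sum_Ico_zmod_eq, hΦ, zero_add]
      exact ih (k - q) (by omega) (M + q) (by omega)

lemma norm_sum_Ico_char_le {q : ℕ} [NeZero q] {χ : DirichletCharacter ℂ q} (hχ : χ ≠ 1)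
    (M N : ℕ) : ‖∑ n ∈ Finset.Ico M N, χ (n : ZMod q)‖ ≤ q :=
  norm_sum_Ico_zmod_le q (MulChar.sum_eq_zero_of_ne_one hχ) (fun a => χ.norm_le_one a) M N

lemma norm_cpow_neg_sub_le {s : ℂ} (hs : 0 < s.re) {a b : ℝ} (ha : 0 < a) (hab : a ≤ b) :
    ‖(b : ℂ) ^ (-s) - (a : ℂ) ^ (-s)‖ ≤ ‖s‖ / s.re * (a ^ (-s.re) - b ^ (-s.re)) := by
  have hpos : ∀ x ∈ Icc a b, 0 < x := fun x hx => ha.trans_le hx.1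
  have hs0 : s ≠ 0 := fun h => by simp [h] at hs
  have hd : ∀ x : ℝ, 0 < x → HasDerivAt (fun y : ℝ => (y : ℂ) ^ (-s)) (-s * (x : ℂ) ^ (-s - 1)) x :=
    fun x hx => hasDerivAt_ofReal_cpow_const hx.ne' (neg_ne_zero.2 hs0)
  have hd2 : ∀ x : ℝ, 0 < x → HasDerivAt (fun y : ℝ => ‖s‖ / s.re * (a ^ (-s.re) - y ^ (-s.re)))
      (‖s‖ * x ^ (-s.re - 1)) x := fun x hx => by
    have h := ((Real.hasDerivAt_rpow_const (x := x) (p := -s.re) (Or.inl hx.ne')).const_sub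
      (a ^ (-s.re))).const_mul (‖s‖ / s.re)
    refine h.congr_deriv ?_
    have := hs.ne'
    rw [neg_mul, neg_neg, ← mul_assoc, div_mul_cancel₀ _ this]
  have := image_norm_le_of_norm_deriv_right_le_deriv_boundary'
    (f := fun y : ℝ => (y : ℂ) ^ (-s) - (a : ℂ) ^ (-s))
    (f' := fun x => -s * (x : ℂ) ^ (-s - 1))
    (B := fun y : ℝ => ‖s‖ / s.re * (a ^ (-s.re) - y ^ (-s.re)))
    (B' := fun x => ‖s‖ * x ^ (-s.re - 1)) (a := a) (b := b) ?_ ?_ (by simp) ?_ ?_ ?_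
    (right_mem_Icc.2 hab)
  · exact this
  · exact fun x hx => ((hd x (hpos x hx)).sub_const _).continuousAt.continuousWithinAt
  · exact fun x hx => ((hd x (hpos x (Ico_subset_Icc_self hx))).sub_const _).hasDerivWithinAt
  · exact fun x hx => (hd2 x (hpos x hx)).continuousAt.continuousWithinAt
  · exact fun x hx => (hd2 x (hpos x (Ico_subset_Icc_self hx))).hasDerivWithinAt
  · intro x hx
    rw [norm_mul, norm_neg, Complex.norm_cpow_eq_rpow_re_of_pos (hpos x (Ico_subset_Icc_self hx))]
    simp

lemma norm_cpow_neg_nat (s : ℂ) {n : ℕ} (hn : 0 < n) : ‖(n : ℂ) ^ (-s)‖ = (n : ℝ) ^ (-s.re) := by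
  rw [Complex.norm_natCast_cpow_of_pos hn, Complex.neg_re]

/-- Tails of Dirichlet series with bounded coefficient sums. -/
lemma norm_sum_Ico_mul_cpow_le {f : ℕ → ℂ} {B : ℝ}
    (hf : ∀ M N, ‖∑ n ∈ Finset.Ico M N, f n‖ ≤ B) {s : ℂ} (hs : 0 < s.re) {M N : ℕ}
    (hM : 0 < M) (h : M ≤ N) :
    ‖∑ n ∈ Finset.Ico M N, f n * (n : ℂ) ^ (-s)‖ ≤ B * (‖s‖ / s.re) * (M : ℝ) ^ (-s.re) := by
  have hB : 0 ≤ B := (norm_nonneg _).trans (hf 0 0)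
  refine (norm_sum_Ico_mul_le hf h).trans ?_
  rw [mul_assoc]
  refine mul_le_mul_of_nonneg_left ?_ hB
  rw [norm_cpow_neg_nat s (hM.trans_le h)]
  have h1 : ∑ n ∈ Finset.Ico M N, ‖(n : ℂ) ^ (-s) - ((n + 1 : ℕ) : ℂ) ^ (-s)‖ ≤
      ‖s‖ / s.re * ((M : ℝ) ^ (-s.re) - (N : ℝ) ^ (-s.re)) := by
    rw [← sum_Ico_sub_succ (fun n : ℕ => (n : ℝ) ^ (-s.re)) h, Finset.mul_sum]
    refine Finset.sum_le_sum fun n hn => ?_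
    have hn0 : (0 : ℝ) < n := by
      exact_mod_cast hM.trans_le (Finset.mem_Ico.1 hn).1
    have := norm_cpow_neg_sub_le hs hn0 (b := ((n + 1 : ℕ) : ℝ)) (by push_cast; linarith)
    rw [norm_sub_rev]
    simpa using this
  have h2 : 1 ≤ ‖s‖ / s.re := by
    rw [one_le_div hs]
    exact (le_abs_self _).trans (Complex.abs_re_le_norm s)
  have h3 : 0 ≤ (N : ℝ) ^ (-s.re) := by positivity
  nlinarith

/-- The value of a conditionally convergent Dirichlet series. -/
noncomputable def condSeries (f : ℕ → ℂ) (s : ℂ) : ℂ :=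
  limUnder atTop fun N : ℕ => ∑ n ∈ Finset.Ico 1 N, f n * (n : ℂ) ^ (-s)

section CondSeries

variable {f : ℕ → ℂ} {B : ℝ}

lemma tendsto_condSeries (hf : ∀ M N, ‖∑ n ∈ Finset.Ico M N, f n‖ ≤ B) {s : ℂ} (hs : 0 < s.re) :
    Tendsto (fun N : ℕ => ∑ n ∈ Finset.Ico 1 N, f n * (n : ℂ) ^ (-s)) atTop
      (𝓝 (condSeries f s)) := by
  refine CauchySeq.tendsto_limUnder (cauchySeq_of_le_tendsto_0' (fun M : ℕ =>
    B * (‖s‖ / s.re) * (M : ℝ) ^ (-s.re) + if M = 0 then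
      B * (‖s‖ / s.re) * (1 : ℕ) ^ (-s.re) else 0) ?_ ?_)
  · intro M N hMN
    have hB : 0 ≤ B := (norm_nonneg _).trans (hf 0 0)
    rcases Nat.eq_zero_or_pos M with rfl | hM
    · rcases Nat.eq_zero_or_pos N with rfl | hN
      · simp; positivity
      · rw [dist_comm, dist_eq_norm]
        have := norm_sum_Ico_mul_cpow_le hf hs one_pos hN
        simp only [Finset.Ico_eq_empty_of_le zero_le_one, Finset.sum_empty, sub_zero, if_true]
        refine this.trans (le_add_of_nonneg_left ?_)
        positivity
    · rw [dist_comm, dist_eq_norm, ← Finset.sum_Ico_consecutive _ hM hMN, add_sub_cancel_left]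
      rw [if_neg hM.ne', add_zero]
      exact norm_sum_Ico_mul_cpow_le hf hs hM hMN
  · have h1 := ((tendsto_rpow_neg_atTop hs).comp tendsto_natCast_atTop_atTop).const_mul
      (B * (‖s‖ / s.re))
    have h2 : Tendsto (fun M : ℕ => if M = 0 then B * (‖s‖ / s.re) * ((1 : ℕ) : ℝ) ^ (-s.re) else 0)
        atTop (𝓝 0) := by
      refine tendsto_const_nhds.congr' ?_
      filter_upwards [eventually_gt_atTop 0] with M hM
      rw [if_neg hM.ne']
    have h3 := h1.add h2
    rw [mul_zero, add_zero] at h3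
    exact h3

lemma norm_condSeries_sub_le (hf : ∀ M N, ‖∑ n ∈ Finset.Ico M N, f n‖ ≤ B) {s : ℂ}
    (hs : 0 < s.re) {M : ℕ} (hM : 0 < M) :
    ‖condSeries f s - ∑ n ∈ Finset.Ico 1 M, f n * (n : ℂ) ^ (-s)‖ ≤
      B * (‖s‖ / s.re) * (M : ℝ) ^ (-s.re) := by
  refine le_of_tendsto ((tendsto_condSeries hf hs).sub_const _).norm ?_
  filter_upwards [eventually_ge_atTop M] with N hN
  rw [← Finset.sum_Ico_consecutive _ hM hN, add_sub_cancel_left]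
  exact norm_sum_Ico_mul_cpow_le hf hs hM hN

lemma differentiableOn_condSeries (hf : ∀ M N, ‖∑ n ∈ Finset.Ico M N, f n‖ ≤ B) :
    DifferentiableOn ℂ (condSeries f) {s | 0 < s.re} := by
  have hopen : IsOpen {s : ℂ | 0 < s.re} := isOpen_lt continuous_const Complex.continuous_re
  have hB : 0 ≤ B := (norm_nonneg _).trans (hf 0 0)
  refine TendstoLocallyUniformlyOn.differentiableOn (φ := atTop)
    (F := fun (N : ℕ) s => ∑ n ∈ Finset.Ico 1 N, f n * (n : ℂ) ^ (-s)) ?_ ?_ hopen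
  · rw [tendstoLocallyUniformlyOn_iff_forall_isCompact hopen]
    intro K hK hKc
    rcases K.eq_empty_or_nonempty with rfl | hne
    · exact tendstoUniformlyOn_empty
    obtain ⟨z, hz, hzmin⟩ := hKc.exists_isMinOn hne Complex.continuous_re.continuousOn
    obtain ⟨w, hw, hwmax⟩ := hKc.exists_isMaxOn hne continuous_norm.continuousOn
    have hz0 : 0 < z.re := hK hz
    have hlim : Tendsto (fun M : ℕ => B * (‖w‖ / z.re) * (M : ℝ) ^ (-z.re)) atTop (𝓝 0) := by
      rw [show (0 : ℝ) = B * (‖w‖ / z.re) * 0 by simp]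
      exact ((tendsto_rpow_neg_atTop hz0).comp tendsto_natCast_atTop_atTop).const_mul _
    rw [Metric.tendstoUniformlyOn_iff]
    intro ε hε
    filter_upwards [hlim.eventually_lt_const hε, eventually_gt_atTop 0] with M hM hM0 s hs
    rw [dist_eq_norm]
    refine ((norm_condSeries_sub_le hf (hK hs) hM0).trans ?_).trans_lt hM
    have h1 : z.re ≤ s.re := hzmin hs
    have h2 : ‖s‖ ≤ ‖w‖ := hwmax hs
    have h3 : (1 : ℝ) ≤ M := by exact_mod_cast hM0
    gcongr
  · filter_upwards with N s _
    refine DifferentiableAt.differentiableWithinAt ?_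
    refine DifferentiableAt.fun_sum fun n hn => ?_
    have : (n : ℂ) ≠ 0 := by
      have := (Finset.mem_Ico.1 hn).1
      exact_mod_cast (by omega : n ≠ 0)
    exact (DifferentiableAt.const_cpow differentiableAt_id.neg (Or.inl this)).const_mul _

lemma tendsto_LSeries {s : ℂ} (h : LSeriesSummable f s) :
    Tendsto (fun N : ℕ => ∑ n ∈ Finset.Ico 1 N, f n * (n : ℂ) ^ (-s)) atTop (𝓝 (LSeries f s)) := by
  refine h.hasSum.tendsto_sum_nat.congr' ?_
  filter_upwards [eventually_gt_atTop 0] with N hN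
  rw [Finset.range_eq_Ico, Finset.sum_eq_sum_Ico_succ_bot hN, LSeries.term_zero, zero_add, zero_add]
  refine Finset.sum_congr rfl fun n hn => ?_
  rw [LSeries.term_of_ne_zero (by have := (Finset.mem_Ico.1 hn).1; omega), Complex.cpow_neg,
    div_eq_mul_inv]

lemma LSeries_eq_condSeries (hf : ∀ M N, ‖∑ n ∈ Finset.Ico M N, f n‖ ≤ B) {s : ℂ}
    (hs : 0 < s.re) (h : LSeriesSummable f s) : LSeries f s = condSeries f s :=
  tendsto_nhds_unique (tendsto_LSeries h) (tendsto_condSeries hf hs)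

end CondSeries

lemma LFunction_eq_condSeries {q : ℕ} [NeZero q] {χ : DirichletCharacter ℂ q} (hχ : χ ≠ 1)
    {s : ℂ} (hs : 0 < s.re) :
    DirichletCharacter.LFunction χ s = condSeries (fun n => χ (n : ZMod q)) s := by
  have hopen : IsOpen {s : ℂ | 0 < s.re} := isOpen_lt continuous_const Complex.continuous_re
  have hconv : Convex ℝ {s : ℂ | 0 < s.re} := convex_halfSpace_re_gt 0
  have h1 : AnalyticOnNhd ℂ (DirichletCharacter.LFunction χ) {s | 0 < s.re} :=
    (DirichletCharacter.differentiable_LFunction hχ).differentiableOn.analyticOnNhd hopen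
  have h2 := (differentiableOn_condSeries (norm_sum_Ico_char_le hχ)).analyticOnNhd hopen
  refine h1.eqOn_of_preconnected_of_eventuallyEq h2 hconv.isPreconnected
    (z₀ := 2) (by simp) ?_ hs
  have : {s : ℂ | 1 < s.re} ∈ 𝓝 (2 : ℂ) :=
    (isOpen_lt continuous_const Complex.continuous_re).mem_nhds (by simp)
  filter_upwards [this] with s hs
  rw [DirichletCharacter.LFunction_eq_LSeries χ hs]
  exact LSeries_eq_condSeries (norm_sum_Ico_char_le hχ) (zero_lt_one.trans hs)
    (DirichletCharacter.LSeriesSummable_of_one_lt_re χ hs)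

lemma norm_LFunction_sub_le {q : ℕ} [NeZero q] {χ : DirichletCharacter ℂ q} (hχ : χ ≠ 1)
    {s : ℂ} (hs : 0 < s.re) {M : ℕ} (hM : 0 < M) :
    ‖DirichletCharacter.LFunction χ s - ∑ n ∈ Finset.Ico 1 M, χ (n : ZMod q) * (n : ℂ) ^ (-s)‖ ≤
      q * (‖s‖ / s.re) * (M : ℝ) ^ (-s.re) := by
  rw [LFunction_eq_condSeries hχ hs]
  exact norm_condSeries_sub_le (norm_sum_Ico_char_le hχ) hs hM

lemma exists_sum_rpow_neg_le {ε : ℝ} (hε : 0 < ε) : ∃ C : ℝ, 0 < C ∧ ∀ σ : ℝ, 1 - ε ≤ σ →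
    ∀ M : ℕ, ∑ n ∈ Finset.Ico 1 M, (n : ℝ) ^ (-σ) ≤ C * (M : ℝ) ^ (2 * ε) := by
  have hs : Summable fun n : ℕ => (n : ℝ) ^ (-(1 + ε)) :=
    Real.summable_nat_rpow.2 (by linarith)
  have h0 : 0 ≤ ∑' n : ℕ, (n : ℝ) ^ (-(1 + ε)) := tsum_nonneg fun n => by positivity
  refine ⟨∑' n : ℕ, (n : ℝ) ^ (-(1 + ε)) + 1, by positivity, fun σ hσ M => ?_⟩
  calc ∑ n ∈ Finset.Ico 1 M, (n : ℝ) ^ (-σ)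
      ≤ ∑ n ∈ Finset.Ico 1 M, (n : ℝ) ^ (-(1 + ε)) * (M : ℝ) ^ (2 * ε) := by
        refine Finset.sum_le_sum fun n hn => ?_
        rw [Finset.mem_Ico] at hn
        have h1 : (1 : ℝ) ≤ n := by exact_mod_cast hn.1
        have h2 : (n : ℝ) ≤ M := by exact_mod_cast hn.2.le
        calc (n : ℝ) ^ (-σ) ≤ (n : ℝ) ^ (-(1 + ε) + 2 * ε) :=
              Real.rpow_le_rpow_of_exponent_le h1 (by linarith)
          _ = (n : ℝ) ^ (-(1 + ε)) * (n : ℝ) ^ (2 * ε) := Real.rpow_add (by linarith) _ _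
          _ ≤ _ := by gcongr
    _ = (∑ n ∈ Finset.Ico 1 M, (n : ℝ) ^ (-(1 + ε))) * (M : ℝ) ^ (2 * ε) := by
        rw [Finset.sum_mul]
    _ ≤ _ := by
        gcongr
        have := hs.sum_le_tsum (Finset.Ico 1 M) fun n _ => by positivity
        linarith

lemma norm_sum_le_sum_rpow {f : ℕ → ℂ} (hf1 : ∀ n, ‖f n‖ ≤ 1) (s : ℂ) (M : ℕ) :
    ‖∑ n ∈ Finset.Ico 1 M, f n * (n : ℂ) ^ (-s)‖ ≤ ∑ n ∈ Finset.Ico 1 M, (n : ℝ) ^ (-s.re) := by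
  refine (norm_sum_le _ _).trans (Finset.sum_le_sum fun n hn => ?_)
  rw [norm_mul, norm_cpow_neg_nat s (Finset.mem_Ico.1 hn).1]
  exact mul_le_of_le_one_left (by positivity) (hf1 n)

lemma norm_le_re_add_im (s : ℂ) : ‖s‖ ≤ |s.re| + |s.im| := Complex.norm_le_abs_re_add_abs_im s

lemma exists_norm_condSeries_le {ε : ℝ} (hε : 0 < ε) (hε2 : ε ≤ 1 / 2) : ∃ C : ℝ, 0 < C ∧
    ∀ (q : ℕ) (f : ℕ → ℂ), 0 < q → (∀ n, ‖f n‖ ≤ 1) →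
      (∀ M N, ‖∑ n ∈ Finset.Ico M N, f n‖ ≤ q) → ∀ s : ℂ, 1 - ε ≤ s.re → s.re ≤ 3 →
      ‖condSeries f s‖ ≤ C * (q * (|s.im| + 2)) ^ (2 * ε) := by
  obtain ⟨S, hS, hSb⟩ := exists_sum_rpow_neg_le hε
  refine ⟨2 * S + 3, by positivity, fun q f hq hf1 hf s hs hs3 => ?_⟩
  have hq1 : (1 : ℝ) ≤ q := by exact_mod_cast hq
  set Y : ℝ := q * (|s.im| + 2) with hY
  have hY2 : 2 ≤ Y := by
    have := abs_nonneg s.im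
    nlinarith
  have hσ : 1 / 2 ≤ s.re := by linarith
  have hM : Y ≤ ⌈Y⌉₊ := Nat.le_ceil Y
  have hM0 : 0 < ⌈Y⌉₊ := Nat.ceil_pos.2 (by linarith)
  have hM2 : (⌈Y⌉₊ : ℝ) ≤ 2 * Y := by
    have := Nat.ceil_lt_add_one (show 0 ≤ Y by linarith)
    linarith
  have h1 := norm_condSeries_sub_le hf (by linarith : 0 < s.re) hM0
  have h2 := (norm_sum_le_sum_rpow hf1 s ⌈Y⌉₊).trans (hSb s.re hs _)
  have h3 : S * (⌈Y⌉₊ : ℝ) ^ (2 * ε) ≤ 2 * S * Y ^ (2 * ε) := by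
    have : (⌈Y⌉₊ : ℝ) ^ (2 * ε) ≤ 2 * Y ^ (2 * ε) := by
      calc (⌈Y⌉₊ : ℝ) ^ (2 * ε) ≤ (2 * Y) ^ (2 * ε) := by gcongr
        _ = 2 ^ (2 * ε) * Y ^ (2 * ε) := Real.mul_rpow (by norm_num) (by linarith)
        _ ≤ 2 ^ (1 : ℝ) * Y ^ (2 * ε) := by
          gcongr
          · norm_num
          · linarith
        _ = _ := by rw [Real.rpow_one]
    nlinarith
  have h4 : q * (‖s‖ / s.re) * (⌈Y⌉₊ : ℝ) ^ (-s.re) ≤ 3 * Y ^ (2 * ε) := by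
    have h5 : ‖s‖ ≤ |s.im| + 3 := by
      have := norm_le_re_add_im s
      rw [abs_of_nonneg (by linarith : 0 ≤ s.re)] at this
      linarith
    have h6 : q * (‖s‖ / s.re) ≤ 3 * Y := by
      have : ‖s‖ / s.re ≤ 3 * (|s.im| + 2) := by
        rw [div_le_iff₀ (by linarith)]
        have := abs_nonneg s.im
        nlinarith
      calc q * (‖s‖ / s.re) ≤ q * (3 * (|s.im| + 2)) := by gcongr
        _ = _ := by rw [hY]; ring
    have h7 : (⌈Y⌉₊ : ℝ) ^ (-s.re) ≤ Y ^ (2 * ε - 1) := by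
      calc (⌈Y⌉₊ : ℝ) ^ (-s.re) ≤ Y ^ (-s.re) :=
            Real.rpow_le_rpow_of_nonpos (by linarith) hM (by linarith)
        _ ≤ _ := Real.rpow_le_rpow_of_exponent_le (by linarith) (by linarith)
    calc q * (‖s‖ / s.re) * (⌈Y⌉₊ : ℝ) ^ (-s.re) ≤ (3 * Y) * Y ^ (2 * ε - 1) := by
          gcongr
      _ = 3 * (Y ^ (1 : ℝ) * Y ^ (2 * ε - 1)) := by rw [Real.rpow_one]; ring
      _ = _ := by rw [← Real.rpow_add (by linarith)]; ring_nf
  have h8 := norm_le_norm_add_norm_sub' (condSeries f s)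
    (∑ n ∈ Finset.Ico 1 ⌈Y⌉₊, f n * (n : ℂ) ^ (-s))
  linarith

lemma exists_norm_LFunction_le {ε : ℝ} (hε : 0 < ε) (hε2 : ε ≤ 1 / 2) : ∃ C : ℝ, 0 < C ∧
    ∀ (q : ℕ) [NeZero q] (χ : DirichletCharacter ℂ q), χ ≠ 1 → ∀ s : ℂ, 1 - ε ≤ s.re → s.re ≤ 3 →
      ‖DirichletCharacter.LFunction χ s‖ ≤ C * (q * (|s.im| + 2)) ^ (2 * ε) := by
  obtain ⟨C, hC, h⟩ := exists_norm_condSeries_le hε hε2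
  refine ⟨C, hC, fun q _ χ hχ s hs hs3 => ?_⟩
  rw [LFunction_eq_condSeries hχ (by linarith)]
  exact h q _ (Nat.pos_of_ne_zero (NeZero.ne q)) (fun n => χ.norm_le_one _)
    (norm_sum_Ico_char_le hχ) s hs hs3

/-- Derivatives of Dirichlet `L`-functions near the line `Re s = 1`. -/
lemma exists_norm_iteratedDeriv_LFunction_le {ε : ℝ} (hε : 0 < ε) (k : ℕ) : ∃ C : ℝ, 0 < C ∧
    ∀ (q : ℕ) [NeZero q] (χ : DirichletCharacter ℂ q), χ ≠ 1 → ∀ s : ℂ, 1 ≤ s.re → s.re ≤ 2 →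
      ‖iteratedDeriv k (DirichletCharacter.LFunction χ) s‖ ≤ C * (q * (|s.im| + 2)) ^ ε := by
  set δ : ℝ := min (ε / 2) (1 / 2) with hδ
  have hδ0 : 0 < δ := by positivity
  have hδ1 : δ ≤ 1 / 2 := min_le_right _ _
  have hδ2 : 2 * δ ≤ ε := by have := min_le_left (ε / 2) (1 / 2); linarith
  obtain ⟨C, hC, h⟩ := exists_norm_LFunction_le hδ0 hδ1
  refine ⟨k.factorial * (C * 2) / δ ^ k, by positivity, fun q _ χ hχ s hs hs2 => ?_⟩
  have hq1 : (1 : ℝ) ≤ q := by exact_mod_cast Nat.pos_of_ne_zero (NeZero.ne q)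
  set Y : ℝ := q * (|s.im| + 2) with hY
  have hY2 : 2 ≤ Y := by
    have := abs_nonneg s.im
    nlinarith
  have := Complex.norm_iteratedDeriv_le_of_forall_mem_sphere_norm_le k (c := s) (R := δ)
    (f := DirichletCharacter.LFunction χ) (C := C * 2 * Y ^ ε) hδ0
    (DirichletCharacter.differentiable_LFunction hχ).diffContOnCl ?_
  · calc _ ≤ _ := this
      _ = _ := by ring
  · intro z hz
    have hzd : ‖z - s‖ = δ := by simpa [dist_eq_norm] using hz
    have hre : |z.re - s.re| ≤ δ := by
      rw [← hzd, ← Complex.sub_re]; exact Complex.abs_re_le_norm _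
    have him : |z.im - s.im| ≤ δ := by
      rw [← hzd, ← Complex.sub_im]; exact Complex.abs_im_le_norm _
    rw [abs_le] at hre
    have him2 : |z.im| ≤ |s.im| + 1 := by
      have := abs_sub_abs_le_abs_sub z.im s.im
      linarith
    refine (h q χ hχ z (by linarith) (by linarith)).trans ?_
    rw [mul_assoc]
    gcongr
    have h1 : q * (|z.im| + 2) ≤ 2 * Y := by
      rw [hY]
      have := abs_nonneg s.im
      nlinarith
    calc (q * (|z.im| + 2)) ^ (2 * δ) ≤ (2 * Y) ^ (2 * δ) := by gcongr
      _ = 2 ^ (2 * δ) * Y ^ (2 * δ) := Real.mul_rpow (by norm_num) (by linarith)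
      _ ≤ 2 ^ (1 : ℝ) * Y ^ ε := by
        gcongr
        · norm_num
        · linarith
        · linarith
      _ = _ := by rw [Real.rpow_one]

lemma norm_cpow_sub_integral_le {s : ℂ} (hs : 1 < s.re) {n : ℕ} (hn : 0 < n) :
    ‖(n : ℂ) ^ (-s) - (((n + 1 : ℕ) : ℂ) ^ (1 - s) - (n : ℂ) ^ (1 - s)) / (1 - s)‖ ≤
      ‖s‖ / s.re * ((n : ℝ) ^ (-s.re) - ((n + 1 : ℕ) : ℝ) ^ (-s.re)) := by
  have hs1 : 1 - s ≠ 0 := fun h => by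
    have := congrArg Complex.re h
    simp at this; linarith
  have hn0 : (0 : ℝ) < n := by exact_mod_cast hn
  have hd : ∀ x ∈ Icc (n : ℝ) ((n + 1 : ℕ) : ℝ), HasDerivWithinAt
      (fun y : ℝ => (y : ℂ) ^ (1 - s) / (1 - s) - (y : ℂ) * (n : ℂ) ^ (-s))
      ((x : ℂ) ^ (-s) - (n : ℂ) ^ (-s)) (Icc (n : ℝ) ((n + 1 : ℕ) : ℝ)) x := by
    intro x hx
    have h1 := (hasDerivAt_ofReal_cpow_const (x := x) (hn0.trans_le hx.1).ne' hs1).div_const (1 - s)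
    have h2 := (Complex.ofRealCLM.hasDerivAt (x := x)).mul_const ((n : ℂ) ^ (-s))
    refine ((h1.sub h2).congr_deriv ?_).hasDerivWithinAt
    rw [mul_div_cancel_left₀ _ hs1]
    simp
  have := (convex_Icc (n : ℝ) ((n + 1 : ℕ) : ℝ)).norm_image_sub_le_of_norm_hasDerivWithin_le
    (C := ‖s‖ / s.re * ((n : ℝ) ^ (-s.re) - ((n + 1 : ℕ) : ℝ) ^ (-s.re))) hd ?_
    (left_mem_Icc.2 (by simp)) (right_mem_Icc.2 (by simp))
  · rw [norm_sub_rev]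
    have e1 : ‖((n + 1 : ℕ) : ℝ) - n‖ = 1 := by simp
    rw [e1, mul_one] at this
    refine le_trans (le_of_eq ?_) this
    congr 1
    simp only [Complex.ofReal_natCast]
    generalize ((n + 1 : ℕ) : ℂ) ^ (1 - s) = u
    generalize (n : ℂ) ^ (1 - s) = v
    generalize (n : ℂ) ^ (-s) = w
    rw [sub_div]
    push_cast
    ring
  · intro x hx
    have h3 := norm_cpow_neg_sub_le (by linarith : 0 < s.re) hn0 hx.1
    refine h3.trans ?_
    have : ((n + 1 : ℕ) : ℝ) ^ (-s.re) ≤ x ^ (-s.re) :=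
      Real.rpow_le_rpow_of_nonpos (hn0.trans_le hx.1) hx.2 (by linarith)
    have h4 : 0 ≤ ‖s‖ / s.re := div_nonneg (norm_nonneg _) (by linarith)
    gcongr

lemma norm_riemannZeta_sub_le {s : ℂ} (hs : 1 < s.re) {M : ℕ} (hM : 0 < M) :
    ‖riemannZeta s‖ ≤ ∑ n ∈ Finset.Ico 1 M, (n : ℝ) ^ (-s.re) + 1 / ‖s - 1‖ +
      ‖s‖ / s.re * (M : ℝ) ^ (-s.re) := by
  have hs1 : 1 - s ≠ 0 := fun h => by
    have := congrArg Complex.re h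
    simp at this; linarith
  have ht := tendsto_LSeries (f := 1) (s := s) (LSeriesSummable_one_iff.2 hs)
  rw [LSeries_one_eq_riemannZeta hs] at ht
  have hlim : Tendsto (fun N : ℕ => (∑ n ∈ Finset.Ico 1 M, (n : ℝ) ^ (-s.re) + 1 / ‖s - 1‖ +
      ‖s‖ / s.re * (M : ℝ) ^ (-s.re)) + 1 / ‖s - 1‖ * (N : ℝ) ^ (-(s.re - 1))) atTop
      (𝓝 ((∑ n ∈ Finset.Ico 1 M, (n : ℝ) ^ (-s.re) + 1 / ‖s - 1‖ +
      ‖s‖ / s.re * (M : ℝ) ^ (-s.re)) + 1 / ‖s - 1‖ * 0)) :=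
    (((tendsto_rpow_neg_atTop (by linarith)).comp tendsto_natCast_atTop_atTop).const_mul _).const_add _
  rw [mul_zero, add_zero] at hlim
  refine le_of_tendsto_of_tendsto ht.norm hlim ?_
  filter_upwards [eventually_ge_atTop M] with N hN
  rw [← Finset.sum_Ico_consecutive _ hM hN]
  have hN0 : 0 < N := hM.trans_le hN
  have e1 : ∑ n ∈ Finset.Ico M N, (1 : ℕ → ℂ) n * (n : ℂ) ^ (-s) =
      ∑ n ∈ Finset.Ico M N, ((n : ℂ) ^ (-s) -
        (((n + 1 : ℕ) : ℂ) ^ (1 - s) - (n : ℂ) ^ (1 - s)) / (1 - s)) +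
      ((N : ℂ) ^ (1 - s) - (M : ℂ) ^ (1 - s)) / (1 - s) := by
    rw [Finset.sum_sub_distrib, ← Finset.sum_div,
      Finset.sum_Ico_sub (fun n : ℕ => (n : ℂ) ^ (1 - s)) hN]
    simp
  have h1 := norm_sum_le_sum_rpow (f := 1) (fun n => by simp) s M
  have h2 : ‖∑ n ∈ Finset.Ico M N, ((n : ℂ) ^ (-s) -
        (((n + 1 : ℕ) : ℂ) ^ (1 - s) - (n : ℂ) ^ (1 - s)) / (1 - s))‖ ≤
      ‖s‖ / s.re * (M : ℝ) ^ (-s.re) := by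
    refine (norm_sum_le _ _).trans ((Finset.sum_le_sum fun n hn =>
      norm_cpow_sub_integral_le hs (hM.trans_le (Finset.mem_Ico.1 hn).1)).trans ?_)
    rw [← Finset.mul_sum, sum_Ico_sub_succ (fun n : ℕ => (n : ℝ) ^ (-s.re)) hN]
    have h4 : 0 ≤ ‖s‖ / s.re := div_nonneg (norm_nonneg _) (by linarith)
    have h5 : 0 ≤ (N : ℝ) ^ (-s.re) := by positivity
    gcongr
    linarith
  have h3 : ‖((N : ℂ) ^ (1 - s) - (M : ℂ) ^ (1 - s)) / (1 - s)‖ ≤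
      1 / ‖s - 1‖ + 1 / ‖s - 1‖ * (N : ℝ) ^ (-(s.re - 1)) := by
    rw [norm_div, norm_sub_rev 1 s]
    have h6 : ‖(N : ℂ) ^ (1 - s)‖ = (N : ℝ) ^ (-(s.re - 1)) := by
      rw [Complex.norm_natCast_cpow_of_pos hN0]; simp
    have h7 : ‖(M : ℂ) ^ (1 - s)‖ ≤ 1 := by
      rw [Complex.norm_natCast_cpow_of_pos hM]
      refine Real.rpow_le_one_of_one_le_of_nonpos (by exact_mod_cast hM) ?_
      simp; linarith
    have h8 := norm_sub_le ((N : ℂ) ^ (1 - s)) ((M : ℂ) ^ (1 - s))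
    calc _ ≤ ((N : ℝ) ^ (-(s.re - 1)) + 1) / ‖s - 1‖ := by
          gcongr
          linarith
      _ = _ := by ring
  rw [e1]
  have h9 := norm_add_le (∑ n ∈ Finset.Ico 1 M, (1 : ℕ → ℂ) n * (n : ℂ) ^ (-s))
    (∑ n ∈ Finset.Ico M N, ((n : ℂ) ^ (-s) -
        (((n + 1 : ℕ) : ℂ) ^ (1 - s) - (n : ℂ) ^ (1 - s)) / (1 - s)) +
      ((N : ℂ) ^ (1 - s) - (M : ℂ) ^ (1 - s)) / (1 - s))
  have h10 := norm_add_le (∑ n ∈ Finset.Ico M N, ((n : ℂ) ^ (-s) -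
        (((n + 1 : ℕ) : ℂ) ^ (1 - s) - (n : ℂ) ^ (1 - s)) / (1 - s)))
      (((N : ℂ) ^ (1 - s) - (M : ℂ) ^ (1 - s)) / (1 - s))
  linarith

lemma ceil_bounds {Y : ℝ} (hY : 1 ≤ Y) : Y ≤ ⌈Y⌉₊ ∧ 0 < ⌈Y⌉₊ ∧ (⌈Y⌉₊ : ℝ) ≤ 2 * Y := by
  refine ⟨Nat.le_ceil Y, Nat.ceil_pos.2 (by linarith), ?_⟩
  have := Nat.ceil_lt_add_one (show 0 ≤ Y by linarith)
  linarith

lemma exists_norm_riemannZeta_le {ε : ℝ} (hε : 0 < ε) : ∃ C : ℝ, 0 < C ∧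
    ∀ s : ℂ, 1 < s.re → s.re ≤ 3 → ‖riemannZeta s‖ ≤ 1 / ‖s - 1‖ + C * (|s.im| + 2) ^ ε := by
  obtain ⟨S, hS, hSb⟩ := exists_sum_rpow_neg_le (half_pos hε)
  refine ⟨S * 2 ^ ε + 2, by positivity, fun s hs hs3 => ?_⟩
  set Y : ℝ := |s.im| + 2 with hY
  have hY2 : 2 ≤ Y := by
    have := abs_nonneg s.im
    linarith
  obtain ⟨hM, hM0, hM2⟩ := ceil_bounds (Y := Y) (by linarith)
  have h1 := norm_riemannZeta_sub_le hs hM0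
  have h2 := hSb s.re (by linarith) ⌈Y⌉₊
  rw [mul_div_cancel₀ ε (two_ne_zero)] at h2
  have h3 : (⌈Y⌉₊ : ℝ) ^ ε ≤ 2 ^ ε * Y ^ ε := by
    rw [← Real.mul_rpow (by norm_num) (by linarith)]
    gcongr
  have h4 : ‖s‖ / s.re * (⌈Y⌉₊ : ℝ) ^ (-s.re) ≤ 2 * Y ^ ε := by
    have h5 : ‖s‖ / s.re ≤ 2 * Y := by
      rw [div_le_iff₀ (by linarith)]
      have := norm_le_re_add_im s
      rw [abs_of_nonneg (by linarith : 0 ≤ s.re)] at this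
      nlinarith
    have h6 : (⌈Y⌉₊ : ℝ) ^ (-s.re) ≤ Y ^ (-1 : ℝ) :=
      (Real.rpow_le_rpow_of_nonpos (by linarith) hM (by linarith)).trans
        (Real.rpow_le_rpow_of_exponent_le (by linarith) (by linarith))
    have h7 : 1 ≤ Y ^ ε := Real.one_le_rpow (by linarith) hε.le
    calc ‖s‖ / s.re * (⌈Y⌉₊ : ℝ) ^ (-s.re) ≤ (2 * Y) * Y ^ (-1 : ℝ) := by gcongr
      _ = 2 := by
        rw [Real.rpow_neg_one]
        field_simp
      _ ≤ _ := by linarith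
  have : S * (⌈Y⌉₊ : ℝ) ^ ε ≤ S * (2 ^ ε * Y ^ ε) := by gcongr
  linarith

/-- The trivial character modulo `q`, compared with the Riemann zeta function. -/
lemma exists_norm_LSeries_one_le {ε : ℝ} (hε : 0 < ε) : ∃ C : ℝ, 0 < C ∧
    ∀ (q : ℕ) [NeZero q] (s : ℂ), 1 < s.re → s.re ≤ 3 →
      ‖LSeries (fun n => (1 : DirichletCharacter ℂ q) (n : ZMod q)) s‖ ≤
        1 / ‖s - 1‖ + C * (q * (|s.im| + 2)) ^ ε := by
  obtain ⟨C₁, hC₁, h₁⟩ := exists_norm_riemannZeta_le hε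
  set δ : ℝ := min (ε / 2) (1 / 2) with hδ
  have hδ0 : 0 < δ := by positivity
  have hδ2 : 2 * δ ≤ ε := by have := min_le_left (ε / 2) (1 / 2); linarith
  obtain ⟨C₂, hC₂, h₂⟩ := exists_norm_condSeries_le hδ0 (min_le_right _ _)
  refine ⟨C₁ + C₂, by positivity, fun q _ s hs hs3 => ?_⟩
  have hq0 : 0 < q := Nat.pos_of_ne_zero (NeZero.ne q)
  have hq1 : (1 : ℝ) ≤ q := by exact_mod_cast hq0
  set c : ℂ := ((q.totient / q : ℝ) : ℂ) with hc
  have hc1 : (q.totient / q : ℝ) ≤ 1 := by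
    rw [div_le_one (by linarith)]
    exact_mod_cast Nat.totient_le q
  have hc0 : 0 ≤ (q.totient / q : ℝ) := by positivity
  have hcn : ‖c‖ ≤ 1 := by rw [hc, Complex.norm_real, Real.norm_of_nonneg hc0]; exact hc1
  set Φ : ZMod q → ℂ := fun a => (1 : DirichletCharacter ℂ q) a - c with hΦ
  have hsum : ∑ a, Φ a = 0 := by
    rw [hΦ, Finset.sum_sub_distrib, MulChar.sum_one_eq_card_units, ZMod.card_units_eq_totient]
    simp only [Finset.sum_const, Finset.card_univ, ZMod.card, nsmul_eq_mul, hc]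
    push_cast
    rw [mul_div_cancel₀ _ (by exact_mod_cast hq0.ne'), sub_self]
  have hb : ∀ a, ‖Φ a‖ ≤ 1 := by
    intro a
    rw [hΦ]
    by_cases ha : IsUnit a
    · simp only [MulChar.one_apply ha, hc]
      rw [← Complex.ofReal_one, ← Complex.ofReal_sub, Complex.norm_real,
        Real.norm_of_nonneg (by linarith)]
      linarith
    · simp only [MulChar.map_nonunit _ ha, zero_sub, norm_neg, hcn]
  have hblock := norm_sum_Ico_zmod_le q hsum hb
  have hs1 : LSeriesSummable (fun n : ℕ => (1 : DirichletCharacter ℂ q) (n : ZMod q)) s :=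
    DirichletCharacter.LSeriesSummable_of_one_lt_re _ hs
  have hs2 : LSeriesSummable (c • (1 : ℕ → ℂ)) s := (LSeriesSummable_one_iff.2 hs).smul c
  have heq : LSeries (fun n : ℕ => (1 : DirichletCharacter ℂ q) (n : ZMod q)) s =
      condSeries (fun n => Φ (n : ZMod q)) s + c * riemannZeta s := by
    have efun : (fun n : ℕ => Φ (n : ZMod q)) =
        (fun n : ℕ => (1 : DirichletCharacter ℂ q) (n : ZMod q)) - c • (1 : ℕ → ℂ) := by
      funext n
      simp [hΦ]
    have e2 := LSeries_sub hs1 hs2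
    rw [LSeries_smul, LSeries_one_eq_riemannZeta hs, ← efun,
      LSeries_eq_condSeries hblock (by linarith) (by rw [efun]; exact hs1.sub hs2)] at e2
    rw [e2]
    simp
  rw [heq]
  set Y : ℝ := q * (|s.im| + 2) with hY
  have hYt : |s.im| + 2 ≤ Y := by
    have := abs_nonneg s.im
    nlinarith
  have hY2 : 2 ≤ Y := by
    have := abs_nonneg s.im
    linarith
  have b1 : ‖condSeries (fun n => Φ (n : ZMod q)) s‖ ≤ C₂ * Y ^ ε := by
    refine (h₂ q _ hq0 (fun n => hb _) hblock s (by linarith) hs3).trans ?_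
    gcongr
    linarith
  have b2 : ‖c * riemannZeta s‖ ≤ 1 / ‖s - 1‖ + C₁ * Y ^ ε := by
    rw [norm_mul]
    refine (mul_le_of_le_one_left (norm_nonneg _) hcn).trans ((h₁ s hs hs3).trans ?_)
    gcongr
  refine (norm_add_le _ _).trans ?_
  linarith

open scoped ComplexOrder in
/-- Estermann's lemma: an upper bound for `H` and a nonpositive value of `ζ H` close to `1`
give a lower bound for `H 1`. -/
lemma exists_estermann : ∃ C : ℝ, 0 < C ∧ ∀ (a : ℕ → ℂ) (H : ℂ → ℂ) (X : ℝ), 1 ≤ X → 0 ≤ a →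
    1 ≤ a 1 → (∀ s : ℂ, 1 < s.re → LSeriesSummable a s) →
    (∀ s : ℂ, 1 < s.re → LSeries a s = riemannZeta s * H s) → Differentiable ℂ H →
    (∀ s : ℂ, ‖s - 2‖ ≤ 3 / 2 → ‖H s‖ ≤ X) → ∀ β : ℝ, 7 / 8 ≤ β → β < 1 →
    (riemannZeta β * H β).re ≤ 0 → ∀ M : ℕ, C * X * (3 / 4 : ℝ) ^ M ≤ 1 →
    (1 - β) / 2 * ((2 - β) ^ M)⁻¹ ≤ (H 1).re := by
  set G : ℂ → ℂ := DirichletCharacter.LFunctionTrivChar₁ 1 with hG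
  have hGd : Differentiable ℂ G := DirichletCharacter.differentiable_LFunctionTrivChar₁ 1
  have hG1 : G 1 = 1 := by simp [hG]
  have hGs : ∀ s : ℂ, s ≠ 1 → G s = (s - 1) * riemannZeta s := fun s hs => by
    simp [hG, Function.update_of_ne hs, DirichletCharacter.LFunctionTrivChar]
  obtain ⟨g, hg⟩ := (isCompact_closedBall (2 : ℂ) (3 / 2)).exists_bound_of_continuousOn
    hGd.continuous.continuousOn
  have hg1 : 1 ≤ g := by
    have := hg 1 (by simp [dist_eq_norm]; norm_num)
    rwa [hG1, norm_one] at this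
  refine ⟨16 * (g + 1), by positivity, fun a H X hX ha ha1 hsum hL hH hb β hβ hβ1 hF M hM => ?_⟩
  set P : ℂ → ℂ := fun s => G s * H s with hP
  have hPd : Differentiable ℂ P := hGd.mul hH
  have hP1 : P 1 = H 1 := by simp [hP, hG1]
  set K : ℂ → ℂ := dslope P 1 with hK
  have hKd : Differentiable ℂ K := by
    rw [← differentiableOn_univ]
    exact (Complex.differentiableOn_dslope (by simp)).2 hPd.differentiableOn
  have hKs : ∀ s : ℂ, s ≠ 1 → K s = riemannZeta s * H s - H 1 * (s - 1)⁻¹ := fun s hs => by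
    have h1 : s - 1 ≠ 0 := sub_ne_zero.2 hs
    rw [hK, dslope_of_ne _ hs, slope_def_field, hP1, hP]
    simp only [hGs s hs]
    field_simp
  have hKb : ∀ s ∈ Metric.sphere (2 : ℂ) (3 / 2), ‖K s‖ ≤ 2 * (g + 1) * X := fun s hs => by
    have hs2 : ‖s - 2‖ = 3 / 2 := by simpa [dist_eq_norm] using hs
    have h1 : 1 / 2 ≤ ‖s - 1‖ := by
      have := norm_sub_le (s - 1) 1
      rw [show s - 1 - 1 = s - 2 by ring, hs2, norm_one] at this
      linarith
    have hs1 : s ≠ 1 := fun h => by rw [h, sub_self, norm_zero] at h1; norm_num at h1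
    rw [hK, dslope_of_ne _ hs1, slope_def_field, hP1, norm_div, div_le_iff₀ (by linarith)]
    have h2 : ‖P s‖ ≤ g * X := by
      rw [hP, norm_mul]
      have := hg s (by simp [dist_eq_norm, hs2])
      have := hb s hs2.le
      gcongr
    have h3 : ‖H 1‖ ≤ X := hb 1 (by norm_num)
    have h4 := norm_sub_le (P s) (H 1)
    have h5 : 0 ≤ (g + 1) * X := by positivity
    nlinarith
  -- Taylor coefficients at `2`
  set b : ℕ → ℂ := fun m => ((m.factorial : ℂ))⁻¹ * ((-1) ^ m * iteratedDeriv m K 2) with hbdef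
  have hbb : ∀ m, ‖b m‖ ≤ 2 * (g + 1) * X * (2 / 3) ^ m := fun m => by
    have h1 := Complex.norm_iteratedDeriv_le_of_forall_mem_sphere_norm_le m (c := 2)
      (by norm_num : (0 : ℝ) < 3 / 2) hKd.diffContOnCl hKb
    rw [hbdef]
    simp only [norm_mul, norm_inv, norm_pow, norm_neg, norm_one, one_pow, one_mul,
      Complex.norm_natCast]
    have hf : (0 : ℝ) < m.factorial := by positivity
    rw [inv_mul_le_iff₀ hf]
    refine h1.trans (le_of_eq ?_)
    rw [show (2 / 3 : ℝ) = (3 / 2)⁻¹ by norm_num, inv_pow]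
    field_simp
  have hKβ : HasSum (fun m => b m * ((2 - β : ℝ) : ℂ) ^ m) (K β) := by
    have := Complex.hasSum_taylorSeries_on_ball (c := 2) (r := 3 / 2) (z := (β : ℂ))
      hKd.differentiableOn (by
        rw [Metric.mem_ball, dist_eq_norm, ← Complex.ofReal_ofNat, ← Complex.ofReal_sub,
          Complex.norm_real, Real.norm_eq_abs, abs_lt]
        constructor <;> linarith)
    refine this.congr_fun fun m => ?_
    simp only [hbdef, smul_eq_mul]
    rw [show (β : ℂ) - 2 = -1 * ((2 - β : ℝ) : ℂ) by push_cast; ring, mul_pow]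
    ring
  have habs : LSeries.abscissaOfAbsConv a < ((2 : ℝ) : EReal) := by
    refine lt_of_le_of_lt (LSeries.abscissaOfAbsConv_le_of_forall_lt_LSeriesSummable (x := 1)
      fun y hy => hsum y (by simpa using hy)) ?_
    exact_mod_cast one_lt_two
  have hbm : ∀ m, b m = ((m.factorial : ℂ))⁻¹ * ((-1) ^ m * iteratedDeriv m (LSeries a) 2) - H 1 := by
    intro m
    have hev : K =ᶠ[𝓝 2] fun s => LSeries a s - H 1 * (s - 1)⁻¹ := by
      have : {s : ℂ | 1 < s.re} ∈ 𝓝 (2 : ℂ) :=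
        (isOpen_lt continuous_const Complex.continuous_re).mem_nhds (by simp)
      filter_upwards [this] with s hs
      rw [hL s hs, hKs s (fun h => by simp [h] at hs)]
    have hc1 : ContDiffAt ℂ m (LSeries a) 2 := by
      have := LSeries_analyticOnNhd a 2 (by simpa using habs)
      exact this.contDiffAt
    have hc2 : ContDiffAt ℂ m (fun s : ℂ => H 1 * (s - 1)⁻¹) 2 := by
      refine contDiffAt_const.mul (ContDiffAt.inv (by fun_prop) (by norm_num))
    have hinv : iteratedDeriv m (fun s : ℂ => (s - 1)⁻¹) 2 = (-1) ^ m * m.factorial := by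
      have := congrFun (iteratedDeriv_comp_sub_const m (Inv.inv : ℂ → ℂ) 1) 2
      rw [this, iteratedDeriv_eq_iterate, iter_deriv_inv]
      norm_num
    have hf : (m.factorial : ℂ) ≠ 0 := by exact_mod_cast m.factorial_ne_zero
    rw [hbdef]
    simp only
    rw [hev.iteratedDeriv_eq, iteratedDeriv_fun_sub hc1 hc2, iteratedDeriv_const_mul_field, hinv]
    have hsq : ((-1 : ℂ) ^ m) * (-1) ^ m = 1 := by rw [← mul_pow]; norm_num
    field_simp
    linear_combination (-(H 1) * m.factorial) * hsq
  have ham : ∀ m, 0 ≤ (b m + H 1).re := fun m => by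
    rw [hbm, sub_add_cancel]
    have h1 := LSeries.iteratedDeriv_alternating ha habs m
    have h2 : (0 : ℂ) ≤ ((m.factorial : ℂ))⁻¹ := by positivity
    have := mul_nonneg h2 h1
    exact (Complex.le_def.1 this).1
  have ha0 : 1 ≤ (b 0 + H 1).re := by
    rw [hbm, sub_add_cancel]
    simp only [Nat.factorial_zero, Nat.cast_one, inv_one, pow_zero, iteratedDeriv_zero, one_mul]
    have h1 := (hsum 2 (by simp)).hasSum
    have h2 := Complex.hasSum_re h1
    have h3 := h2.summable.sum_le_tsum {1} (fun n _ => ?_)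
    · rw [h2.tsum_eq] at h3
      simp only [Finset.sum_singleton, LSeries.term_of_ne_zero one_ne_zero, Nat.cast_one,
        Complex.one_cpow, div_one] at h3
      exact (Complex.le_def.1 ha1).1.trans h3
    · have := LSeries.term_nonneg (ha n) (2 : ℝ)
      have := (Complex.le_def.1 this).1
      simpa using this
  set y : ℝ := 2 - β with hy
  have hy1 : 1 < y := by linarith
  have hy2 : y ≤ 9 / 8 := by linarith
  set l : ℝ := (H 1).re with hl
  have hre := Complex.hasSum_re hKβ
  have hre' : HasSum (fun m => (b m).re * y ^ m) (K β).re := by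
    refine hre.congr_fun fun m => ?_
    rw [← Complex.ofReal_pow, Complex.re_mul_ofReal]
  have hM0 : 0 < M := by
    rcases Nat.eq_zero_or_pos M with rfl | h
    · rw [pow_zero, mul_one] at hM
      nlinarith
    · exact h
  have hhead : 1 - l * ((y ^ M - 1) / (y - 1)) ≤ ∑ m ∈ Finset.range M, (b m).re * y ^ m := by
    rw [← geom_sum_eq hy1.ne', Finset.mul_sum, Finset.range_eq_Ico,
      Finset.sum_eq_sum_Ico_succ_bot hM0, Finset.sum_eq_sum_Ico_succ_bot hM0]
    have : ∑ m ∈ Finset.Ico (0 + 1) M, -(l * y ^ m) ≤ ∑ m ∈ Finset.Ico (0 + 1) M, (b m).re * y ^ m := by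
      refine Finset.sum_le_sum fun m _ => ?_
      have := ham m
      rw [Complex.add_re] at this
      have hym : 0 < y ^ m := by positivity
      nlinarith
    rw [Finset.sum_neg_distrib] at this
    rw [Complex.add_re] at ha0
    simp only [pow_zero, mul_one]
    linarith
  have htail : -(8 * (g + 1) * X * (3 / 4) ^ M) ≤ ∑' m, (b (m + M)).re * y ^ (m + M) := by
    have hs2 : Summable fun m => (b (m + M)).re * y ^ (m + M) :=
      (summable_nat_add_iff M).2 hre'.summable
    have hgeo := (hasSum_geometric_of_lt_one (by norm_num : (0 : ℝ) ≤ 3 / 4) (by norm_num)).mul_left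
      (-(2 * (g + 1) * X * (3 / 4) ^ M))
    refine le_trans (le_of_eq ?_) (hasSum_le (fun m => ?_) hgeo hs2.hasSum)
    · norm_num; ring
    · have h1 : |(b (m + M)).re| ≤ 2 * (g + 1) * X * (2 / 3) ^ (m + M) :=
        (Complex.abs_re_le_norm _).trans (hbb _)
      have h2 : y ^ (m + M) ≤ (9 / 8) ^ (m + M) := by gcongr
      have h3 : |(b (m + M)).re| * y ^ (m + M) ≤ 2 * (g + 1) * X * (3 / 4) ^ (m + M) := by
        calc _ ≤ (2 * (g + 1) * X * (2 / 3) ^ (m + M)) * (9 / 8) ^ (m + M) := by gcongr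
          _ = 2 * (g + 1) * X * ((2 / 3) * (9 / 8)) ^ (m + M) := by rw [mul_pow]; ring
          _ = _ := by norm_num
      have h4 := neg_abs_le ((b (m + M)).re * y ^ (m + M))
      rw [abs_mul, abs_of_pos (by positivity : 0 < y ^ (m + M))] at h4
      rw [pow_add (3 / 4 : ℝ)] at h3
      nlinarith
  have htot := hre'.summable.sum_add_tsum_nat_add M
  rw [hre'.tsum_eq] at htot
  have hKval : (K β).re ≤ l / (y - 1) := by
    rw [hKs β (by exact_mod_cast hβ1.ne), Complex.sub_re]
    have : (H 1 * ((β : ℂ) - 1)⁻¹).re = - (l / (y - 1)) := by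
      rw [show (β : ℂ) - 1 = ((β - 1 : ℝ) : ℂ) by push_cast; ring, ← Complex.ofReal_inv,
        Complex.re_mul_ofReal, ← hl, hy, show 2 - β - 1 = -(β - 1) by ring, div_neg, neg_neg,
        div_eq_mul_inv]
    rw [this]
    linarith
  have hyM : 0 < y ^ M := by positivity
  have hfin : 1 / 2 ≤ l * (y ^ M / (y - 1)) := by
    have e : l * (y ^ M / (y - 1)) = l * ((y ^ M - 1) / (y - 1)) + l / (y - 1) := by
      field_simp; ring
    rw [e]
    have : 8 * (g + 1) * X * (3 / 4) ^ M ≤ 1 / 2 := by linarith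
    linarith
  have hy0 : 0 < y - 1 := by linarith
  rw [show (1 - β) = y - 1 by rw [hy]; ring]
  rw [← div_eq_mul_inv, div_le_iff₀ hyM]
  rw [mul_div_assoc', le_div_iff₀ hy0] at hfin
  linarith

section Positivity

open scoped ComplexOrder

/-- Multiplication by `log`, as a derivation on arithmetic functions. -/
noncomputable def logMul (f : ArithmeticFunction ℂ) : ArithmeticFunction ℂ :=
  ⟨fun n => f n * (Real.log n : ℂ), by simp⟩

lemma logMul_apply (f : ArithmeticFunction ℂ) (n : ℕ) : logMul f n = f n * (Real.log n : ℂ) := rfl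

lemma logMul_mul (f g : ArithmeticFunction ℂ) :
    logMul (f * g) = logMul f * g + f * logMul g := by
  ext n
  simp only [logMul_apply, ArithmeticFunction.mul_apply, ArithmeticFunction.add_apply,
    Finset.sum_mul, ← Finset.sum_add_distrib]
  refine Finset.sum_congr rfl fun x hx => ?_
  obtain ⟨hx1, hx2⟩ := Nat.mem_divisorsAntidiagonal.1 hx
  have h1 : (x.1 : ℝ) ≠ 0 := by
    intro h; apply hx2; rw [← hx1]; simp [Nat.cast_eq_zero.1 h]
  have h2 : (x.2 : ℝ) ≠ 0 := by
    intro h; apply hx2; rw [← hx1]; simp [Nat.cast_eq_zero.1 h]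
  rw [← hx1, Nat.cast_mul, Real.log_mul h1 h2]
  push_cast
  ring

noncomputable def charFun {q : ℕ} (χ : DirichletCharacter ℂ q) : ArithmeticFunction ℂ :=
  toArithmeticFunction fun n => χ (n : ZMod q)

noncomputable def charLambda {q : ℕ} (χ : DirichletCharacter ℂ q) : ArithmeticFunction ℂ :=
  ⟨fun n => χ (n : ZMod q) * (ArithmeticFunction.vonMangoldt n : ℂ), by simp⟩

lemma charFun_apply {q : ℕ} (χ : DirichletCharacter ℂ q) {n : ℕ} (hn : n ≠ 0) :
    charFun χ n = χ (n : ZMod q) := by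
  simp [charFun, toArithmeticFunction, hn]

lemma charLambda_apply {q : ℕ} (χ : DirichletCharacter ℂ q) (n : ℕ) :
    charLambda χ n = χ (n : ZMod q) * (ArithmeticFunction.vonMangoldt n : ℂ) := rfl

lemma logMul_charFun {q : ℕ} (χ : DirichletCharacter ℂ q) :
    logMul (charFun χ) = charLambda χ * charFun χ := by
  have h := DirichletCharacter.convolution_twist_vonMangoldt χ
  ext n
  rcases eq_or_ne n 0 with rfl | hn
  · simp
  have h2 := congrFun h n
  rw [LSeries.convolution_def] at h2
  rw [logMul_apply, charFun_apply χ hn, ArithmeticFunction.mul_apply]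
  simp only [Pi.mul_apply] at h2
  rw [show ((Real.log n : ℝ) : ℂ) = Complex.log n by rw [Complex.natCast_log], ← h2]
  refine Finset.sum_congr rfl fun x hx => ?_
  obtain ⟨hx1, hx2⟩ := Nat.mem_divisorsAntidiagonal.1 hx
  rw [charFun_apply χ (by rintro h; simp [h] at hx1; exact hn hx1.symm)]
  rfl

lemma nonneg_of_logMul_eq {r w : ArithmeticFunction ℂ} (h : logMul r = w * r) (hw : ∀ n, 0 ≤ w n)
    (hw1 : w 1 = 0) (hr1 : 0 ≤ r 1) : ∀ n, 0 ≤ r n := by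
  intro n
  induction n using Nat.strong_induction_on with
  | _ n ih =>
    rcases Nat.lt_or_ge n 2 with hn | hn
    · interval_cases n
      · simp
      · exact hr1
    · have hlog : 0 < Real.log n := Real.log_pos (by exact_mod_cast hn)
      have h1 : r n * (Real.log n : ℂ) = (w * r) n := by rw [← h, logMul_apply]
      have h2 : 0 ≤ (w * r) n := by
        rw [ArithmeticFunction.mul_apply]
        refine Finset.sum_nonneg fun x hx => ?_
        obtain ⟨hx1, hx2⟩ := Nat.mem_divisorsAntidiagonal.1 hx
        rcases Nat.lt_or_ge x.1 2 with h3 | h3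
        · have : w x.1 = 0 := by
            interval_cases hx : x.1
            · simp
            · exact hw1
          rw [this, zero_mul]
        · refine mul_nonneg (hw _) (ih _ ?_)
          have : 0 < x.2 := Nat.pos_of_ne_zero (by rintro h; simp [h] at hx1; omega)
          nlinarith
      have h3 : r n = (w * r) n * ((Real.log n)⁻¹ : ℝ) := by
        rw [← h1]
        push_cast
        rw [mul_assoc, mul_inv_cancel₀ (by exact_mod_cast hlog.ne'), mul_one]
      rw [h3]
      exact mul_nonneg h2 (by exact_mod_cast (inv_pos.2 hlog).le)

end Positivity

/-- The product of two characters, to the product of the moduli. -/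
noncomputable def prodChar {q₁ q₂ : ℕ} (χ₁ : DirichletCharacter ℂ q₁) (χ₂ : DirichletCharacter ℂ q₂) :
    DirichletCharacter ℂ (q₁ * q₂) :=
  DirichletCharacter.changeLevel (Dvd.intro _ rfl) χ₁ *
    DirichletCharacter.changeLevel (Dvd.intro_left _ rfl) χ₂

lemma changeLevel_natCast {q r : ℕ} (h : r ∣ q) (χ : DirichletCharacter ℂ r) {n : ℕ}
    (hn : n.Coprime q) : DirichletCharacter.changeLevel h χ (n : ZMod q) = χ (n : ZMod r) := by
  have hu : IsUnit (n : ZMod q) := (ZMod.isUnit_iff_coprime n q).2 hn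
  have := DirichletCharacter.changeLevel_eq_cast_of_dvd χ h hu.unit
  rw [IsUnit.unit_spec, ZMod.cast_natCast h] at this
  exact this

lemma char_natCast_eq_zero {q : ℕ} (χ : DirichletCharacter ℂ q) {n : ℕ} (hn : ¬ n.Coprime q) :
    χ (n : ZMod q) = 0 :=
  MulChar.map_nonunit _ (fun h => hn ((ZMod.isUnit_iff_coprime n q).1 h))

lemma prodChar_natCast {q₁ q₂ : ℕ} (χ₁ : DirichletCharacter ℂ q₁) (χ₂ : DirichletCharacter ℂ q₂)
    (n : ℕ) : prodChar χ₁ χ₂ (n : ZMod (q₁ * q₂)) = χ₁ (n : ZMod q₁) * χ₂ (n : ZMod q₂) := by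
  by_cases hn : n.Coprime (q₁ * q₂)
  · rw [prodChar, MulChar.mul_apply, changeLevel_natCast _ _ hn, changeLevel_natCast _ _ hn]
  · rw [char_natCast_eq_zero _ hn]
    rw [Nat.coprime_mul_iff_right, not_and_or] at hn
    rcases hn with h | h
    · rw [char_natCast_eq_zero χ₁ h, zero_mul]
    · rw [char_natCast_eq_zero χ₂ h, mul_zero]

lemma prodChar_sq {q₁ q₂ : ℕ} {χ₁ : DirichletCharacter ℂ q₁} {χ₂ : DirichletCharacter ℂ q₂}
    (h₁ : χ₁ ^ 2 = 1) (h₂ : χ₂ ^ 2 = 1) : prodChar χ₁ χ₂ ^ 2 = 1 := by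
  rw [prodChar, mul_pow, ← map_pow, ← map_pow, h₁, h₂, map_one, map_one, one_mul]

lemma char_values {q : ℕ} {χ : DirichletCharacter ℂ q} (h : χ ^ 2 = 1) (a : ZMod q) :
    χ a = 0 ∨ χ a = 1 ∨ χ a = -1 :=
  MulChar.isQuadratic_iff_sq_eq_one.2 h a

lemma prodChar_ne_one {q₁ q₂ : ℕ} [NeZero q₁] [NeZero q₂] {χ₁ : DirichletCharacter ℂ q₁}
    {χ₂ : DirichletCharacter ℂ q₂} (h₂ : χ₂ ^ 2 = 1) (hp : χ₂.IsPrimitive) (hq : q₁ < q₂) :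
    prodChar χ₁ χ₂ ≠ 1 := by
  intro h
  have : NeZero (q₁ * q₂) := ⟨mul_ne_zero (NeZero.ne _) (NeZero.ne _)⟩
  set ψ₁ := DirichletCharacter.changeLevel (Dvd.intro q₂ rfl) χ₁ with hψ₁
  set ψ₂ := DirichletCharacter.changeLevel (Dvd.intro_left q₁ rfl) χ₂ with hψ₂
  have h3 : ψ₂ ^ 2 = 1 := by rw [hψ₂, ← map_pow, h₂, map_one]
  have h4 : ψ₁ = ψ₂ := by
    have : ψ₁ * ψ₂ = 1 := h
    calc ψ₁ = ψ₁ * ψ₂ * ψ₂ := by rw [mul_assoc, ← sq, h3, mul_one]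
      _ = ψ₂ := by rw [this, one_mul]
  have h5 : ψ₁.conductor = ψ₂.conductor := by rw [h4]
  rw [hψ₁, hψ₂, DirichletCharacter.conductor_changeLevel, DirichletCharacter.conductor_changeLevel,
    hp] at h5
  have h6 : χ₁.conductor ≤ q₁ := Nat.le_of_dvd (Nat.pos_of_ne_zero (NeZero.ne _))
    (DirichletCharacter.conductor_dvd_level χ₁)
  omega

/-- The coefficients of `ζ(s) L(s, χ₁) L(s, χ₂) L(s, χ₁ χ₂)`. -/
noncomputable def siegelCoeff {q₁ q₂ : ℕ} (χ₁ : DirichletCharacter ℂ q₁)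
    (χ₂ : DirichletCharacter ℂ q₂) : ArithmeticFunction ℂ :=
  charFun (1 : DirichletCharacter ℂ 1) * (charFun χ₁ * (charFun χ₂ * charFun (prodChar χ₁ χ₂)))

lemma charFun_one {q : ℕ} (χ : DirichletCharacter ℂ q) : charFun χ 1 = 1 := by
  rw [charFun_apply χ one_ne_zero]; simp

lemma siegelCoeff_one {q₁ q₂ : ℕ} (χ₁ : DirichletCharacter ℂ q₁)
    (χ₂ : DirichletCharacter ℂ q₂) : siegelCoeff χ₁ χ₂ 1 = 1 := by
  simp [siegelCoeff, charFun_one]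

open scoped ComplexOrder in
lemma siegelCoeff_nonneg {q₁ q₂ : ℕ} {χ₁ : DirichletCharacter ℂ q₁} {χ₂ : DirichletCharacter ℂ q₂}
    (h₁ : χ₁ ^ 2 = 1) (h₂ : χ₂ ^ 2 = 1) (n : ℕ) : 0 ≤ siegelCoeff χ₁ χ₂ n := by
  refine nonneg_of_logMul_eq (w := charLambda (1 : DirichletCharacter ℂ 1) + charLambda χ₁ +
    charLambda χ₂ + charLambda (prodChar χ₁ χ₂)) ?_ ?_ ?_ ?_ n
  · simp only [siegelCoeff, logMul_mul, logMul_charFun]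
    ring
  · intro n
    have hΛ : (0 : ℂ) ≤ (ArithmeticFunction.vonMangoldt n : ℂ) := by
      exact_mod_cast ArithmeticFunction.vonMangoldt_nonneg
    have h0 : (1 : DirichletCharacter ℂ 1) (n : ZMod 1) = 1 := by
      rw [Subsingleton.elim (n : ZMod 1) 1]; simp
    have : (charLambda (1 : DirichletCharacter ℂ 1) + charLambda χ₁ +
        charLambda χ₂ + charLambda (prodChar χ₁ χ₂)) n =
        (1 + χ₁ n) * (1 + χ₂ n) * (ArithmeticFunction.vonMangoldt n : ℂ) := by
      simp only [ArithmeticFunction.add_apply, charLambda_apply, h0, prodChar_natCast]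
      ring
    rw [this]
    refine mul_nonneg ?_ hΛ
    rcases char_values h₁ (n : ZMod q₁) with h | h | h <;>
    rcases char_values h₂ (n : ZMod q₂) with h' | h' | h' <;> simp [h, h'] <;> norm_num
  · simp [charLambda_apply]
  · rw [siegelCoeff_one]; exact zero_le_one

lemma LSeriesSummable_charFun {q : ℕ} (χ : DirichletCharacter ℂ q) {s : ℂ} (hs : 1 < s.re) :
    LSeriesSummable (fun n => charFun χ n) s :=
  (LSeriesSummable_congr s (fun hn => (charFun_apply χ hn).symm)).1
    (DirichletCharacter.LSeriesSummable_of_one_lt_re χ hs)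

lemma LSeries_charFun {q : ℕ} [NeZero q] (χ : DirichletCharacter ℂ q) {s : ℂ} (hs : 1 < s.re) :
    LSeries (fun n => charFun χ n) s = DirichletCharacter.LFunction χ s := by
  rw [DirichletCharacter.LFunction_eq_LSeries χ hs]
  exact LSeries_congr (fun hn => charFun_apply χ hn) s

lemma siegelCoeff_LSeries {q₁ q₂ : ℕ} [NeZero q₁] [NeZero q₂] (χ₁ : DirichletCharacter ℂ q₁)
    (χ₂ : DirichletCharacter ℂ q₂) {s : ℂ} (hs : 1 < s.re) :
    have : NeZero (q₁ * q₂) := ⟨mul_ne_zero (NeZero.ne _) (NeZero.ne _)⟩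
    LSeriesSummable (fun n => siegelCoeff χ₁ χ₂ n) s ∧ LSeries (fun n => siegelCoeff χ₁ χ₂ n) s =
      riemannZeta s * (DirichletCharacter.LFunction χ₁ s * (DirichletCharacter.LFunction χ₂ s *
        DirichletCharacter.LFunction (prodChar χ₁ χ₂) s)) := by
  have : NeZero (q₁ * q₂) := ⟨mul_ne_zero (NeZero.ne _) (NeZero.ne _)⟩
  have s0 := LSeriesSummable_charFun (1 : DirichletCharacter ℂ 1) hs
  have s1 := LSeriesSummable_charFun χ₁ hs
  have s2 := LSeriesSummable_charFun χ₂ hs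
  have s3 := LSeriesSummable_charFun (prodChar χ₁ χ₂) hs
  have s23 := ArithmeticFunction.LSeriesSummable_mul s2 s3
  have s123 := ArithmeticFunction.LSeriesSummable_mul s1 s23
  refine ⟨ArithmeticFunction.LSeriesSummable_mul s0 s123, ?_⟩
  rw [siegelCoeff, ArithmeticFunction.LSeries_mul' s0 s123, ArithmeticFunction.LSeries_mul' s1 s23,
    ArithmeticFunction.LSeries_mul' s2 s3, LSeries_charFun _ hs, LSeries_charFun _ hs,
    LSeries_charFun _ hs, LSeries_charFun _ hs, DirichletCharacter.LFunction_modOne_eq]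

lemma norm_LFunction_le_seven {q : ℕ} [NeZero q] {χ : DirichletCharacter ℂ q} (hχ : χ ≠ 1) {s : ℂ}
    (hs : ‖s - 2‖ ≤ 3 / 2) : ‖DirichletCharacter.LFunction χ s‖ ≤ 7 * q := by
  have h1 : 1 / 2 ≤ s.re := by
    have := (Complex.abs_re_le_norm (s - 2)).trans hs
    rw [abs_le] at this
    simp at this
    linarith
  have h2 : ‖s‖ ≤ 7 / 2 := by
    have := norm_add_le (s - 2) 2
    rw [sub_add_cancel] at this
    have h3 : ‖(2 : ℂ)‖ = 2 := by simp
    linarith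
  have h := norm_LFunction_sub_le hχ (by linarith : 0 < s.re) one_pos
  simp only [Finset.Ico_self, Finset.sum_empty, sub_zero, Nat.cast_one, Real.one_rpow, mul_one] at h
  refine h.trans ?_
  have : ‖s‖ / s.re ≤ 7 := by
    rw [div_le_iff₀ (by linarith)]; linarith
  nlinarith [(Nat.cast_nonneg q : (0 : ℝ) ≤ q)]

open scoped ComplexOrder in
lemma exists_siegel_step {ε : ℝ} (hε : 0 < ε) (hε1 : ε ≤ 1) {q₁ : ℕ} [NeZero q₁]
    {χ₁ : DirichletCharacter ℂ q₁} (h₁ : χ₁ ^ 2 = 1) (hχ₁ : χ₁ ≠ 1) {β : ℝ}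
    (hβ : 1 - ε / 16 ≤ β) (hβ1 : β < 1) :
    ∃ c : ℝ, 0 < c ∧ ∀ (q₂ : ℕ) [NeZero q₂] (χ₂ : DirichletCharacter ℂ q₂), χ₂ ^ 2 = 1 → χ₂ ≠ 1 →
      prodChar χ₁ χ₂ ≠ 1 →
      (∀ [NeZero (q₁ * q₂)], (riemannZeta β * (DirichletCharacter.LFunction χ₁ β *
        (DirichletCharacter.LFunction χ₂ β *
        DirichletCharacter.LFunction (prodChar χ₁ χ₂) β))).re ≤ 0) →
      c * (q₂ : ℝ) ^ (-ε) ≤ ‖DirichletCharacter.LFunction χ₂ 1‖ := by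
  obtain ⟨C, hC, hE⟩ := exists_estermann
  obtain ⟨D, hD, hL⟩ := exists_norm_LFunction_le (ε := ε / 4) (by linarith) (by linarith)
  set K := ‖DirichletCharacter.LFunction χ₁ 1‖ with hK
  set Z₀ : ℝ := (C + 1) * 343 * (q₁ : ℝ) ^ 2 with hZ₀
  have hq₁ : (1 : ℝ) ≤ q₁ := by exact_mod_cast Nat.one_le_iff_ne_zero.2 (NeZero.ne q₁)
  have hZ₀1 : 1 ≤ Z₀ := by
    have : 1 ≤ (q₁ : ℝ) ^ 2 := one_le_pow₀ hq₁
    nlinarith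
  set P : ℝ := Real.exp 1 * Z₀ ^ (ε / 4) * (K + 1) * (D * ((q₁ : ℝ) * 2) ^ (ε / 2)) with hP
  have hPpos : 0 < P := by positivity
  refine ⟨(1 - β) / 2 / P, div_pos (by linarith) hPpos, ?_⟩
  intro q₂ _ χ₂ h₂ hχ₂ h12 hre
  have hne : NeZero (q₁ * q₂) := ⟨mul_ne_zero (NeZero.ne _) (NeZero.ne _)⟩
  have hq₂ : (1 : ℝ) ≤ q₂ := by exact_mod_cast Nat.one_le_iff_ne_zero.2 (NeZero.ne q₂)
  set H : ℂ → ℂ := fun s => DirichletCharacter.LFunction χ₁ s *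
    (DirichletCharacter.LFunction χ₂ s * DirichletCharacter.LFunction (prodChar χ₁ χ₂) s) with hH
  set X : ℝ := 343 * ((q₁ : ℝ) * q₂) ^ 2 with hX
  set Z : ℝ := (C + 1) * X with hZ
  have hX1 : 1 ≤ X := by
    have : 1 ≤ ((q₁ : ℝ) * q₂) ^ 2 := one_le_pow₀ (by nlinarith)
    linarith
  have hZ1 : 1 ≤ Z := by nlinarith
  have hZeq : Z = Z₀ * (q₂ : ℝ) ^ 2 := by rw [hZ, hX, hZ₀]; ring
  set M : ℕ := ⌈4 * Real.log Z⌉₊ with hM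
  have hM1 : 4 * Real.log Z ≤ M := Nat.le_ceil _
  have hM2 : (M : ℝ) ≤ 4 * Real.log Z + 1 :=
    (Nat.ceil_lt_add_one (by have := Real.log_nonneg hZ1; linarith)).le
  have hpow : C * X * (3 / 4) ^ M ≤ 1 := by
    have h34 : (3 / 4 : ℝ) ≤ Real.exp (-(1 / 4)) := by
      have := Real.add_one_le_exp (-(1 / 4) : ℝ); linarith
    have : (3 / 4 : ℝ) ^ M ≤ Z⁻¹ := by
      calc (3 / 4 : ℝ) ^ M ≤ Real.exp (-(1 / 4)) ^ M := by gcongr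
        _ = Real.exp (-(M / 4)) := by rw [← Real.exp_nat_mul]; congr 1; ring
        _ ≤ Real.exp (-Real.log Z) := by gcongr; linarith
        _ = Z⁻¹ := by rw [Real.exp_neg, Real.exp_log (by linarith)]
    calc C * X * (3 / 4) ^ M ≤ Z * Z⁻¹ := by
          gcongr
          rw [hZ]; nlinarith
      _ = 1 := mul_inv_cancel₀ (by linarith)
  have hmain := hE (fun n => siegelCoeff χ₁ χ₂ n) H X hX1 (fun n => siegelCoeff_nonneg h₁ h₂ n)
    (by rw [siegelCoeff_one]) (fun s hs => (siegelCoeff_LSeries χ₁ χ₂ hs).1)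
    (fun s hs => (siegelCoeff_LSeries χ₁ χ₂ hs).2)
    ((DirichletCharacter.differentiable_LFunction hχ₁).mul
      ((DirichletCharacter.differentiable_LFunction hχ₂).mul
        (DirichletCharacter.differentiable_LFunction h12))) ?_ β (by linarith) hβ1 hre M hpow
  swap
  · intro s hs
    rw [hH]
    simp only [norm_mul]
    calc _ ≤ (7 * (q₁ : ℝ)) * ((7 * q₂) * (7 * (q₁ * q₂ : ℕ))) := by
          gcongr
          · exact norm_LFunction_le_seven hχ₁ hs
          · exact norm_LFunction_le_seven hχ₂ hs
          · exact norm_LFunction_le_seven h12 hs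
      _ = X := by push_cast; rw [hX]; ring
  have hL12 : ‖DirichletCharacter.LFunction (prodChar χ₁ χ₂) 1‖ ≤
      D * ((q₁ : ℝ) * 2) ^ (ε / 2) * (q₂ : ℝ) ^ (ε / 2) := by
    have := hL (q₁ * q₂) (prodChar χ₁ χ₂) h12 1 (by simp; linarith) (by simp)
    refine this.trans (le_of_eq ?_)
    rw [mul_assoc, ← Real.mul_rpow (by positivity) (by positivity)]
    simp only [one_im, abs_zero, zero_add, Nat.cast_mul]
    congr 2 <;> ring
  have hHle : (H 1).re ≤ (K + 1) * (‖DirichletCharacter.LFunction χ₂ 1‖ *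
      (D * ((q₁ : ℝ) * 2) ^ (ε / 2) * (q₂ : ℝ) ^ (ε / 2))) := by
    refine (Complex.re_le_norm _).trans ?_
    rw [hH]
    simp only [norm_mul]
    gcongr
    linarith
  have hbase : (2 - β) ^ M ≤ Real.exp 1 * Z₀ ^ (ε / 4) * (q₂ : ℝ) ^ (ε / 2) := by
    have hlogZ := Real.log_nonneg hZ1
    calc (2 - β) ^ M ≤ Real.exp (ε / 16) ^ M := by
          have h1 := Real.add_one_le_exp (ε / 16)
          exact pow_le_pow_left₀ (by linarith) (by linarith) _
      _ = Real.exp (M * (ε / 16)) := by rw [← Real.exp_nat_mul]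
      _ ≤ Real.exp (1 + Real.log Z * (ε / 4)) := by
          gcongr
          nlinarith
      _ = Real.exp 1 * Z ^ (ε / 4) := by
          rw [Real.exp_add, ← Real.rpow_def_of_pos (by linarith)]
      _ = _ := by
          rw [hZeq, Real.mul_rpow (by linarith) (by positivity), ← Real.rpow_natCast,
            ← Real.rpow_mul (by linarith), mul_assoc]
          congr 3; push_cast; ring
  have hfin : (1 - β) / 2 ≤ P * (q₂ : ℝ) ^ ε * ‖DirichletCharacter.LFunction χ₂ 1‖ := by
    have h2 : 0 < (2 - β) ^ M := pow_pos (by linarith) _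
    have h3 := hmain.trans hHle
    rw [← div_eq_mul_inv, div_le_iff₀ h2] at h3
    refine h3.trans ?_
    calc _ ≤ (K + 1) * (‖DirichletCharacter.LFunction χ₂ 1‖ *
      (D * ((q₁ : ℝ) * 2) ^ (ε / 2) * (q₂ : ℝ) ^ (ε / 2))) *
        (Real.exp 1 * Z₀ ^ (ε / 4) * (q₂ : ℝ) ^ (ε / 2)) := by gcongr
      _ = P * ((q₂ : ℝ) ^ (ε / 2) * (q₂ : ℝ) ^ (ε / 2)) *
          ‖DirichletCharacter.LFunction χ₂ 1‖ := by rw [hP]; ring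
      _ = _ := by rw [← Real.rpow_add (by linarith), add_halves]
  rw [Real.rpow_neg (by linarith), div_mul_eq_mul_div, div_le_iff₀ hPpos, ← div_eq_mul_inv,
    div_le_iff₀ (by positivity)]
  linarith

lemma LFunction_im_eq_zero {q : ℕ} [NeZero q] {χ : DirichletCharacter ℂ q} (h : χ ^ 2 = 1)
    (hχ : χ ≠ 1) {β : ℝ} (hβ : 0 < β) : (DirichletCharacter.LFunction χ β).im = 0 := by
  have hS : ∀ M : ℕ, (∑ n ∈ Finset.Ico 1 M, χ (n : ZMod q) * (n : ℂ) ^ (-(β : ℂ))).im = 0 := by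
    intro M
    rw [Complex.im_sum]
    refine Finset.sum_eq_zero fun n _ => ?_
    have : (n : ℂ) ^ (-(β : ℂ)) = (((n : ℝ) ^ (-β) : ℝ) : ℂ) := by
      rw [Complex.ofReal_cpow (Nat.cast_nonneg n)]; simp
    rw [this]
    rcases char_values h (n : ZMod q) with h | h | h <;> simp [h]
  have hb : ∀ M : ℕ, 0 < M → |(DirichletCharacter.LFunction χ β).im| ≤ q * (M : ℝ) ^ (-β) := by
    intro M hM
    have h1 := norm_LFunction_sub_le hχ (s := β) (by simpa using hβ) hM
    have h2 := (Complex.abs_im_le_norm _).trans h1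
    rw [Complex.sub_im, hS M, sub_zero] at h2
    simpa [abs_of_pos hβ, div_self hβ.ne'] using h2
  have ht : Tendsto (fun M : ℕ => (q : ℝ) * (M : ℝ) ^ (-β)) atTop (𝓝 0) := by
    have := ((tendsto_rpow_neg_atTop hβ).comp tendsto_natCast_atTop_atTop).const_mul (q : ℝ)
    simpa using this
  have := ge_of_tendsto ht ((eventually_gt_atTop 0).mono hb)
  exact abs_eq_zero.1 (le_antisymm this (abs_nonneg _))

lemma LFunction_re_pos {q : ℕ} [NeZero q] {χ : DirichletCharacter ℂ q} (h : χ ^ 2 = 1)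
    (hχ : χ ≠ 1) {β : ℝ} (hβ : 0 < β)
    (hz : ∀ x : ℝ, β ≤ x → x < 1 → DirichletCharacter.LFunction χ x ≠ 0) :
    0 < (DirichletCharacter.LFunction χ β).re := by
  have hz' : ∀ x : ℝ, β ≤ x → (DirichletCharacter.LFunction χ x).re ≠ 0 := by
    intro x hx h0
    have h1 : DirichletCharacter.LFunction χ x = 0 :=
      Complex.ext h0 (LFunction_im_eq_zero h hχ (by linarith))
    rcases lt_or_ge x 1 with h2 | h2
    · exact hz x hx h2 h1
    · exact DirichletCharacter.LFunction_ne_zero_of_one_le_re χ (Or.inl hχ) (by simpa using h2) h1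
  have hcont : Continuous fun x : ℝ => (DirichletCharacter.LFunction χ x).re :=
    Complex.continuous_re.comp
      ((DirichletCharacter.differentiable_LFunction hχ).continuous.comp Complex.continuous_ofReal)
  by_contra hneg
  push Not at hneg
  set b : ℝ := max β q with hb
  have hb0 : 0 < b := lt_of_lt_of_le hβ (le_max_left _ _)
  have hpos : 0 < (DirichletCharacter.LFunction χ b).re := by
    have h1 := norm_LFunction_sub_le hχ (s := b) (by simpa using hb0) two_pos
    rw [show Finset.Ico 1 2 = {1} from rfl] at h1
    simp only [Finset.sum_singleton, Nat.cast_one, map_one,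
      Complex.one_cpow, mul_one, Complex.norm_real, Complex.ofReal_re, Real.norm_eq_abs,
      abs_of_pos hb0, div_self hb0.ne'] at h1
    have h2 : (q : ℝ) * (2 : ℕ) ^ (-b) < 1 := by
      have h3 : (q : ℝ) < 2 ^ b := by
        calc (q : ℝ) < ((2 ^ q : ℕ) : ℝ) := by exact_mod_cast Nat.lt_two_pow_self
          _ = (2 : ℝ) ^ (q : ℝ) := by rw [Real.rpow_natCast]; push_cast; rfl
          _ ≤ 2 ^ b := Real.rpow_le_rpow_of_exponent_le one_le_two (le_max_right _ _)
      rw [Nat.cast_ofNat, Real.rpow_neg two_pos.le, ← div_eq_mul_inv, div_lt_one (by positivity)]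
      exact h3
    have h4 := (Complex.abs_re_le_norm _).trans h1
    rw [abs_le] at h4
    simp only [sub_re, one_re] at h4
    linarith [h4.1]
  obtain ⟨x, hx, hx0⟩ := intermediate_value_Icc (le_max_left β (q : ℝ)) hcont.continuousOn
    ⟨hneg, hpos.le⟩
  exact hz' x hx.1 hx0

lemma exists_riemannZeta_re_neg :
    ∃ δ : ℝ, 0 < δ ∧ ∀ β : ℝ, 1 - δ < β → β < 1 → (riemannZeta β).re < 0 := by
  set G : ℂ → ℂ := DirichletCharacter.LFunctionTrivChar₁ 1 with hG
  have hGd : Differentiable ℂ G := DirichletCharacter.differentiable_LFunctionTrivChar₁ 1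
  have hG1 : G 1 = 1 := by simp [hG]
  have hcont : Continuous fun x : ℝ => (G x).re :=
    Complex.continuous_re.comp (hGd.continuous.comp Complex.continuous_ofReal)
  have hev : ∀ᶠ x : ℝ in 𝓝 1, 0 < (G x).re :=
    hcont.continuousAt.eventually (lt_mem_nhds (by simp [hG1]))
  obtain ⟨δ, hδ, hball⟩ := Metric.eventually_nhds_iff.1 hev
  refine ⟨δ, hδ, fun β h1 h2 => ?_⟩
  have h3 := hball (y := β) (by rw [Real.dist_eq, abs_lt]; constructor <;> linarith)
  have h4 : G β = (β - 1) * riemannZeta β := by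
    have : (β : ℂ) ≠ 1 := by exact_mod_cast h2.ne
    simp [hG, Function.update_of_ne this, DirichletCharacter.LFunctionTrivChar]
  rw [h4, show ((β : ℂ) - 1) = ((β - 1 : ℝ) : ℂ) by push_cast; rfl, Complex.re_ofReal_mul] at h3
  nlinarith

lemma exists_le_norm_LFunction_one (Q : ℕ) : ∃ c : ℝ, 0 < c ∧ ∀ (q : ℕ) [NeZero q], q ≤ Q →
    ∀ χ : DirichletCharacter ℂ q, χ ≠ 1 → c ≤ ‖DirichletCharacter.LFunction χ 1‖ := by
  induction Q with
  | zero => exact ⟨1, one_pos, fun q _ hq => absurd (Nat.le_zero.1 hq) (NeZero.ne q)⟩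
  | succ Q ih =>
    obtain ⟨c, hc, h⟩ := ih
    obtain ⟨χ₀, hχ₀⟩ := Finite.exists_min fun χ : DirichletCharacter ℂ (Q + 1) =>
      if χ = 1 then (1 : ℝ) else ‖DirichletCharacter.LFunction χ 1‖
    refine ⟨min c (if χ₀ = 1 then (1 : ℝ) else ‖DirichletCharacter.LFunction χ₀ 1‖),
      lt_min hc ?_, fun q _ hq χ hχ => ?_⟩
    · split_ifs with h0
      · exact one_pos
      · exact norm_pos_iff.2 (DirichletCharacter.LFunction_apply_one_ne_zero h0)
    · rcases Nat.lt_or_ge q (Q + 1) with h1 | h1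
      · exact (min_le_left _ _).trans (h q (by omega) χ hχ)
      · obtain rfl : q = Q + 1 := le_antisymm hq h1
        refine (min_le_right _ _).trans ((hχ₀ χ).trans ?_)
        rw [if_neg hχ]

/-- Siegel's theorem. -/
theorem exists_siegel {ε : ℝ} (hε : 0 < ε) : ∃ c : ℝ, 0 < c ∧ ∀ (q : ℕ) [NeZero q]
    (χ : DirichletCharacter ℂ q), χ.IsPrimitive → χ ≠ 1 → χ ^ 2 = 1 →
    c * (q : ℝ) ^ (-ε) ≤ ‖DirichletCharacter.LFunction χ 1‖ := by
  wlog hε1 : ε ≤ 1 generalizing ε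
  · obtain ⟨c, hc, h⟩ := this one_pos le_rfl
    refine ⟨c, hc, fun q _ χ h1 h2 h3 => le_trans ?_ (h q χ h1 h2 h3)⟩
    have : (1 : ℝ) ≤ q := by exact_mod_cast Nat.one_le_iff_ne_zero.2 (NeZero.ne q)
    gcongr ?_ * ?_
    exact Real.rpow_le_rpow_of_exponent_le this (by linarith)
  suffices hs : ∃ (q₁ : ℕ) (c : ℝ), 0 < c ∧ ∀ (q : ℕ) [NeZero q]
      (χ : DirichletCharacter ℂ q), q₁ < q → χ.IsPrimitive → χ ≠ 1 → χ ^ 2 = 1 →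
      c * (q : ℝ) ^ (-ε) ≤ ‖DirichletCharacter.LFunction χ 1‖ by
    obtain ⟨q₁, c, hc, h⟩ := hs
    obtain ⟨c', hc', h'⟩ := exists_le_norm_LFunction_one q₁
    refine ⟨min c c', lt_min hc hc', fun q _ χ h1 h2 h3 => ?_⟩
    rcases Nat.lt_or_ge q₁ q with hq | hq
    · refine le_trans ?_ (h q χ hq h1 h2 h3)
      gcongr
      exact min_le_left _ _
    · refine le_trans ?_ (h' q hq χ h2)
      have : (1 : ℝ) ≤ q := by exact_mod_cast Nat.one_le_iff_ne_zero.2 (NeZero.ne q)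
      calc min c c' * (q : ℝ) ^ (-ε) ≤ c' * 1 := by
            gcongr
            · exact min_le_right _ _
            · exact Real.rpow_le_one_of_one_le_of_nonpos this (by linarith)
        _ = c' := mul_one _
  obtain ⟨δ, hδ, hζ⟩ := exists_riemannZeta_re_neg
  by_cases hzero : ∃ (q₁ : ℕ) (_ : NeZero q₁) (χ₁ : DirichletCharacter ℂ q₁) (β : ℝ),
      χ₁ ^ 2 = 1 ∧ χ₁ ≠ 1 ∧ 1 - ε / 16 ≤ β ∧ β < 1 ∧ DirichletCharacter.LFunction χ₁ β = 0
  · obtain ⟨q₁, _, χ₁, β, h1, h2, h3, h4, h5⟩ := hzero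
    obtain ⟨c, hc, h⟩ := exists_siegel_step hε hε1 h1 h2 h3 h4
    refine ⟨q₁, c, hc, fun q _ χ hq hp hne hsq => h q χ hsq hne (prodChar_ne_one hsq hp hq) ?_⟩
    intro _
    simp [h5]
  · push Not at hzero
    by_cases hex : ∃ (q₁ : ℕ) (_ : NeZero q₁) (χ₁ : DirichletCharacter ℂ q₁), χ₁ ^ 2 = 1 ∧ χ₁ ≠ 1
    · obtain ⟨q₁, _, χ₁, h1, h2⟩ := hex
      set β : ℝ := max (1 - ε / 16) (1 - δ / 2) with hβ
      have h3 : 1 - ε / 16 ≤ β := le_max_left _ _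
      have h3' : 1 - δ / 2 ≤ β := le_max_right _ _
      have h4 : β < 1 := max_lt (by linarith) (by linarith)
      have hβ0 : 0 < β := by linarith
      obtain ⟨c, hc, h⟩ := exists_siegel_step hε hε1 h1 h2 h3 h4
      refine ⟨q₁, c, hc, fun q _ χ hq hp hne hsq => h q χ hsq hne (prodChar_ne_one hsq hp hq) ?_⟩
      intro _
      have key : ∀ (r : ℕ) [NeZero r] (ψ : DirichletCharacter ℂ r), ψ ^ 2 = 1 → ψ ≠ 1 →
          ∃ x : ℝ, 0 < x ∧ DirichletCharacter.LFunction ψ β = x := by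
        intro r hr ψ hψ hψ1
        refine ⟨_, LFunction_re_pos hψ hψ1 hβ0
          (fun x hx hx1 => hzero r hr ψ x hψ hψ1 (by linarith) hx1), ?_⟩
        exact Complex.ext rfl (by simpa using LFunction_im_eq_zero hψ hψ1 hβ0)
      obtain ⟨x, hx, ex⟩ := key q₁ χ₁ h1 h2
      obtain ⟨y, hy, ey⟩ := key q χ hsq hne
      obtain ⟨z, hz, ez⟩ := key _ (prodChar χ₁ χ) (prodChar_sq h1 hsq) (prodChar_ne_one hsq hp hq)
      rw [ex, ey, ez, ← Complex.ofReal_mul, ← Complex.ofReal_mul, Complex.re_mul_ofReal]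
      exact mul_nonpos_of_nonpos_of_nonneg (hζ β (by linarith) h4).le (by positivity)
    · push Not at hex
      exact ⟨0, 1, one_pos, fun q hq χ _ _ hne hsq => absurd (hex q hq χ hsq) hne⟩

section LowerBound

variable {q : ℕ} [NeZero q] {χ : DirichletCharacter ℂ q}

lemma norm_LFunction_sub_le_of_deriv (hχ : χ ≠ 1) {Y T : ℝ}
    (hd : ∀ z : ℂ, 1 ≤ z.re → z.re ≤ 2 → |z.im| ≤ T →
      ‖deriv (DirichletCharacter.LFunction χ) z‖ ≤ Y) {z w : ℂ}
    (hz : 1 ≤ z.re) (hz' : z.re ≤ 2) (hzi : |z.im| ≤ T) (hw : 1 ≤ w.re) (hw' : w.re ≤ 2)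
    (hwi : |w.im| ≤ T) :
    ‖DirichletCharacter.LFunction χ w - DirichletCharacter.LFunction χ z‖ ≤ Y * ‖w - z‖ := by
  have hconv : Convex ℝ ({z : ℂ | 1 ≤ z.re} ∩ {z : ℂ | z.re ≤ 2} ∩
      ({z : ℂ | -T ≤ z.im} ∩ {z : ℂ | z.im ≤ T})) :=
    ((convex_halfSpace_re_ge 1).inter (convex_halfSpace_re_le 2)).inter
      ((convex_halfSpace_im_ge (-T)).inter (convex_halfSpace_im_le T))
  refine hconv.norm_image_sub_le_of_norm_deriv_le
    (fun x _ => (DirichletCharacter.differentiable_LFunction hχ) x)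
    (fun x hx => hd x hx.1.1 hx.1.2 (abs_le.2 hx.2)) ⟨⟨hz, hz'⟩, abs_le.1 hzi⟩
    ⟨⟨hw, hw'⟩, abs_le.1 hwi⟩

lemma le_norm_pow_four {x y Y R : ℝ} (hx : 0 < x) (hY : 1 ≤ Y)
    (h0 : ‖LSeries (fun n => (1 : DirichletCharacter ℂ q) (n : ZMod q)) (1 + x)‖ ≤ Y / x)
    (hR : ‖LSeries (fun n => (χ ^ 2 : DirichletCharacter ℂ q) (n : ZMod q)) (1 + x + 2 * I * y)‖
      ≤ R) :
    1 ≤ (Y / x) ^ 3 * ‖DirichletCharacter.LFunction χ (1 + x + I * y)‖ ^ 4 * R := by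
  have h := DirichletCharacter.norm_LSeries_product_ge_one χ hx y
  rw [norm_mul, norm_mul, norm_pow, norm_pow,
    ← DirichletCharacter.LFunction_eq_LSeries χ (by simpa using hx)] at h
  refine (ge_iff_le.1 h).trans ?_
  gcongr

lemma le_norm_LFunction_of_bounds (hχ : χ ≠ 1) {y Y R : ℝ} (hY : 1 ≤ Y) (hR1 : 1 ≤ R)
    (h0 : ∀ x : ℝ, 0 < x → x ≤ 1 →
      ‖LSeries (fun n => (1 : DirichletCharacter ℂ q) (n : ZMod q)) (1 + x)‖ ≤ Y / x)
    (hR : ∀ x : ℝ, 0 < x → x ≤ 1 → ‖LSeries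
      (fun n => (χ ^ 2 : DirichletCharacter ℂ q) (n : ZMod q)) (1 + x + 2 * I * y)‖ ≤ R)
    (hd : ∀ z : ℂ, 1 ≤ z.re → z.re ≤ 2 → |z.im| ≤ |y| →
      ‖deriv (DirichletCharacter.LFunction χ) z‖ ≤ Y) {x : ℝ} (hx : 0 < x) (hx1 : x ≤ 1) :
    1 / (16 * Y ^ 6 * R) ≤ ‖DirichletCharacter.LFunction χ (1 + x + I * y)‖ := by
  set x₀ : ℝ := 1 / (16 * Y ^ 7 * R) with hx₀
  have hY0 : 0 < Y := by linarith
  have hR0 : 0 < R := by linarith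
  have hx₀0 : 0 < x₀ := by positivity
  have hden : 1 ≤ 16 * Y ^ 7 * R := by
    have : 1 ≤ Y ^ 7 := one_le_pow₀ hY
    nlinarith
  have hx₀1 : x₀ ≤ 1 := by rw [hx₀, div_le_one (by positivity)]; exact hden
  have htarget : 1 / (16 * Y ^ 6 * R) = Y * x₀ := by rw [hx₀]; field_simp
  have big : ∀ u : ℝ, x₀ ≤ u → u ≤ 1 →
      2 * (Y * x₀) ≤ ‖DirichletCharacter.LFunction χ (1 + u + I * y)‖ := by
    intro u hu hu1
    have hu0 : 0 < u := by linarith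
    have h := le_norm_pow_four hu0 hY (h0 u hu0 hu1) (hR u hu0 hu1)
    set N := ‖DirichletCharacter.LFunction χ (1 + u + I * y)‖ with hN
    by_contra! hlt
    have h1 : N ^ 4 < (2 * (Y * x₀)) ^ 4 := pow_lt_pow_left₀ hlt (norm_nonneg _) (by norm_num)
    have h2 : (Y / u) ^ 3 ≤ (Y / x₀) ^ 3 := by gcongr
    have h3 : (Y / u) ^ 3 * N ^ 4 * R < (Y / x₀) ^ 3 * (2 * (Y * x₀)) ^ 4 * R := by
      have h4 : (Y / u) ^ 3 * N ^ 4 ≤ (Y / x₀) ^ 3 * N ^ 4 := by gcongr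
      have h5 : (Y / x₀) ^ 3 * N ^ 4 < (Y / x₀) ^ 3 * (2 * (Y * x₀)) ^ 4 := by gcongr
      exact mul_lt_mul_of_pos_right (h4.trans_lt h5) hR0
    have h4 : (Y / x₀) ^ 3 * (2 * (Y * x₀)) ^ 4 * R = 1 := by
      rw [hx₀]; field_simp; norm_num
    linarith
  rw [htarget]
  rcases le_or_gt x₀ x with h | h
  · have := big x h hx1
    nlinarith [mul_pos hY0 hx₀0]
  · have h1 := big x₀ le_rfl hx₀1
    have h2 := norm_LFunction_sub_le_of_deriv hχ hd (z := 1 + x + I * y) (w := 1 + x₀ + I * y)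
      (by simpa using hx.le) (by simp; linarith) (by simp) (by simpa using hx₀0.le)
      (by simp; linarith) (by simp)
    have h3 : ‖(1 + x₀ + I * y : ℂ) - (1 + x + I * y)‖ ≤ x₀ := by
      rw [show (1 + x₀ + I * y : ℂ) - (1 + x + I * y) = ((x₀ - x : ℝ) : ℂ) by push_cast; ring,
        Complex.norm_real, Real.norm_eq_abs, abs_of_pos (by linarith)]
      linarith
    have h4 := norm_sub_norm_le (DirichletCharacter.LFunction χ (1 + x₀ + I * y))
      (DirichletCharacter.LFunction χ (1 + x + I * y))
    have h5 : Y * ‖(1 + x₀ + I * y : ℂ) - (1 + x + I * y)‖ ≤ Y * x₀ := by gcongr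
    linarith

end LowerBound

set_option maxHeartbeats 600000 in
/-- A lower bound for primitive `L`-functions to the right of the line `re s = 1`. -/
theorem exists_le_norm_LFunction {ε : ℝ} (hε : 0 < ε) : ∃ c : ℝ, 0 < c ∧ ∀ (q : ℕ) [NeZero q]
    (χ : DirichletCharacter ℂ q), χ.IsPrimitive → χ ≠ 1 → ∀ s : ℂ, 1 < s.re → s.re ≤ 2 →
    c * (q * (|s.im| + 2)) ^ (-ε) ≤ ‖DirichletCharacter.LFunction χ s‖ := by
  set δ : ℝ := ε / 8 with hδ
  have hδ0 : 0 < δ := by positivity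
  obtain ⟨C₁, hC₁, h₁⟩ := exists_norm_LSeries_one_le hδ0
  obtain ⟨C₂, hC₂, h₂⟩ := exists_norm_iteratedDeriv_LFunction_le hδ0 0
  obtain ⟨C₃, hC₃, h₃⟩ := exists_norm_iteratedDeriv_LFunction_le hδ0 1
  obtain ⟨c₀, hc₀, h₀⟩ := exists_siegel hδ0
  set K : ℝ := (1 + C₁ + C₂ + C₃ + c₀⁻¹) * 2 ^ δ with hK
  have h2δ : 1 ≤ (2 : ℝ) ^ δ := Real.one_le_rpow one_le_two hδ0.le
  have hK0 : 0 < K := by positivity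
  refine ⟨1 / (48 * K ^ 8), by positivity, fun q _ χ hp hχ s hs hs2 => ?_⟩
  have hq : (1 : ℝ) ≤ q := by exact_mod_cast Nat.one_le_iff_ne_zero.2 (NeZero.ne q)
  set V : ℝ := q * (|s.im| + 2) with hV
  have hV1 : 1 ≤ V := by nlinarith [abs_nonneg s.im]
  set Y : ℝ := K * V ^ δ with hYdef
  have hVδ : 1 ≤ V ^ δ := Real.one_le_rpow hV1 hδ0.le
  have hci : 0 < c₀⁻¹ := inv_pos.2 hc₀
  have hmono : ∀ a : ℝ, 0 ≤ a → a ≤ 1 + C₁ + C₂ + C₃ + c₀⁻¹ → ∀ W : ℝ, 0 ≤ W → W ≤ 2 * V →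
      a * W ^ δ ≤ Y := by
    intro a ha ha' W hW hWV
    calc a * W ^ δ ≤ (1 + C₁ + C₂ + C₃ + c₀⁻¹) * (2 * V) ^ δ := by gcongr
      _ = Y := by rw [hYdef, hK, Real.mul_rpow two_pos.le (by linarith), mul_assoc]
  have hone : ∀ W : ℝ, 0 ≤ W → W ≤ 2 * V → 1 + C₁ * W ^ δ ≤ Y := by
    intro W hW hWV
    have h1 : 1 + C₁ * W ^ δ ≤ (1 + C₁) * (2 * V) ^ δ := by
      have h2 : 1 ≤ (2 * V) ^ δ := Real.one_le_rpow (by linarith) hδ0.le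
      have h3 : C₁ * W ^ δ ≤ C₁ * (2 * V) ^ δ := by gcongr
      linarith
    exact h1.trans (hmono _ (by positivity) (by linarith) _ (by linarith) le_rfl)
  have hY1 : 1 ≤ Y := by
    have := hone 0 le_rfl (by linarith)
    have h2 : 0 ≤ C₁ * (0 : ℝ) ^ δ := by positivity
    linarith
  have hY0 : 0 < Y := by linarith
  suffices hmain : 1 / (48 * Y ^ 8) ≤ ‖DirichletCharacter.LFunction χ s‖ by
    have h8 : Y ^ 8 = K ^ 8 * V ^ ε := by
      rw [hYdef, mul_pow _ _ 8, ← Real.rpow_mul_natCast (by linarith) δ 8]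
      congr 2
      rw [hδ]
      push_cast
      ring
    refine le_trans (le_of_eq ?_) hmain
    rw [h8, Real.rpow_neg (by linarith)]
    field_simp
  set x : ℝ := s.re - 1 with hx
  set y : ℝ := s.im with hy
  have hsxy : s = 1 + x + I * y := by
    apply Complex.ext <;> simp [hx, hy]
  have hx0 : 0 < x := by linarith
  have hx1 : x ≤ 1 := by linarith
  have hd : ∀ z : ℂ, 1 ≤ z.re → z.re ≤ 2 → |z.im| ≤ |y| →
      ‖deriv (DirichletCharacter.LFunction χ) z‖ ≤ Y := by
    intro z hz hz2 hzy
    have := h₃ q χ hχ z hz hz2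
    rw [iteratedDeriv_one] at this
    refine this.trans (hmono _ hC₃.le (by linarith) _ (by positivity) ?_)
    calc (q : ℝ) * (|z.im| + 2) ≤ q * (|y| + 2) := by gcongr
      _ ≤ 2 * V := by linarith
  have h0 : ∀ u : ℝ, 0 < u → u ≤ 1 →
      ‖LSeries (fun n => (1 : DirichletCharacter ℂ q) (n : ZMod q)) (1 + u)‖ ≤ Y / u := by
    intro u hu hu1
    have h := h₁ q (1 + u) (by simpa using hu) (by simp; linarith)
    refine h.trans ?_
    rw [add_sub_cancel_left, Complex.norm_real, Real.norm_eq_abs, abs_of_pos hu, le_div_iff₀ hu,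
      add_mul, one_div, inv_mul_cancel₀ hu.ne']
    refine le_trans ?_ (hone (q * (|(1 + (u : ℂ)).im| + 2)) (by positivity) ?_)
    · exact add_le_add_right (mul_le_of_le_one_right (by positivity) hu1) 1
    · simp only [add_im, one_im, ofReal_im, add_zero, abs_zero, zero_add]
      nlinarith [abs_nonneg y]
  clear_value Y K V δ
  have hbig : (q : ℝ) * (|2 * y| + 2) ≤ 2 * V := by
    rw [abs_mul, abs_two, hV]; nlinarith [abs_nonneg y]
  by_cases hsq : χ ^ 2 = 1
  · have hone2 : ∀ u : ℝ, 0 < u → u ≤ 1 → ‖LSeries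
        (fun n => (χ ^ 2 : DirichletCharacter ℂ q) (n : ZMod q)) (1 + u + 2 * I * y)‖ ≤
        1 / ‖(u + 2 * I * y : ℂ)‖ + (Y - 1) := by
      intro u hu hu1
      rw [hsq]
      have h := h₁ q (1 + u + 2 * I * y) (by simpa using hu) (by simp; linarith)
      refine h.trans ?_
      rw [show (1 + u + 2 * I * y - 1 : ℂ) = u + 2 * I * y by ring]
      have := hone (q * (|(1 + u + 2 * I * y : ℂ).im| + 2)) (by positivity) (by simpa using hbig)
      linarith
    have hℓ := h₀ q χ hp hχ hsq
    set ℓ := c₀ * (q : ℝ) ^ (-δ) with hℓdef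
    have hℓY : 1 ≤ Y * ℓ := by
      have h := hmono c₀⁻¹ hci.le (by linarith) q (by linarith) (by nlinarith [abs_nonneg y])
      have hq0 : 0 < (q : ℝ) ^ δ := by positivity
      calc (1 : ℝ) = (c₀⁻¹ * (q : ℝ) ^ δ) * ℓ := by
            rw [hℓdef, Real.rpow_neg (by linarith)]; field_simp
        _ ≤ Y * ℓ := by gcongr
    have hℓ0 : 0 < ℓ := by positivity
    clear_value ℓ x y
    rcases le_or_gt ‖s - 1‖ (ℓ / (2 * Y)) with hnear | hfar
    · have h := norm_LFunction_sub_le_of_deriv hχ hd (z := s) (w := 1) hs.le hs2 (by rw [hy]) (by simp)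
        (by norm_num) (by simp)
      have h2 : Y * ‖1 - s‖ ≤ ℓ / 2 := by
        rw [norm_sub_rev]
        calc Y * ‖s - 1‖ ≤ Y * (ℓ / (2 * Y)) := by gcongr
          _ = ℓ / 2 := by field_simp
      have h3 := norm_sub_norm_le (DirichletCharacter.LFunction χ 1)
        (DirichletCharacter.LFunction χ s)
      have h4 : ℓ / 2 ≤ ‖DirichletCharacter.LFunction χ s‖ := by linarith
      refine le_trans ?_ h4
      rw [div_le_div_iff₀ (by positivity) two_pos]
      have h8 : ℓ * Y ≤ ℓ * Y ^ 8 :=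
        mul_le_mul_of_nonneg_left (le_self_pow₀ hY1 (by norm_num)) hℓ0.le
      linarith
    · have hxy : ℓ / (4 * Y) ≤ x ∨ ℓ / (4 * Y) ≤ |y| := by
        by_contra! hcon
        have h1 := Complex.norm_le_abs_re_add_abs_im (s - 1)
        simp only [sub_re, one_re, sub_im, one_im, sub_zero] at h1
        rw [← hx, ← hy, abs_of_pos hx0] at h1
        have : ℓ / (2 * Y) = ℓ / (4 * Y) + ℓ / (4 * Y) := by field_simp; norm_num
        linarith [hcon.1, hcon.2]
      have hℓY' : 1 / (4 * Y ^ 2) ≤ ℓ / (4 * Y) := by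
        rw [div_le_div_iff₀ (by positivity) (by positivity)]
        nlinarith
      rcases hxy with hxl | hyl
      · have hR : ‖LSeries (fun n => (χ ^ 2 : DirichletCharacter ℂ q) (n : ZMod q))
            (1 + x + 2 * I * y)‖ ≤ Y / x := by
          refine (hone2 x hx0 hx1).trans ?_
          have h1 : x ≤ ‖(x + 2 * I * y : ℂ)‖ := by
            have := Complex.re_le_norm (x + 2 * I * y : ℂ)
            simpa using this
          have h2 : 1 / ‖(x + 2 * I * y : ℂ)‖ ≤ 1 / x := by gcongr
          have h3 : Y - 1 ≤ (Y - 1) / x := by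
            rw [le_div_iff₀ hx0]; nlinarith
          have : Y / x = 1 / x + (Y - 1) / x := by ring
          linarith
        have h := le_norm_pow_four hx0 hY1 (h0 x hx0 hx1) hR
        rw [← hsxy] at h
        have h5 : 1 ≤ Y / x * ‖DirichletCharacter.LFunction χ s‖ := by
          by_contra! hlt
          have h6 : (Y / x * ‖DirichletCharacter.LFunction χ s‖) ^ 4 < 1 :=
            pow_lt_one₀ (by positivity) hlt (by norm_num)
          rw [mul_pow] at h6
          linarith
        have h6 : x / Y ≤ ‖DirichletCharacter.LFunction χ s‖ := by
          rw [div_le_iff₀ hY0]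
          rw [div_mul_eq_mul_div, le_div_iff₀ hx0] at h5
          linarith
        refine le_trans ?_ h6
        rw [div_le_div_iff₀ (by positivity) hY0]
        have h7 := hℓY'.trans hxl
        rw [div_le_iff₀ (by positivity)] at h7
        have h8 : Y ^ 3 ≤ Y ^ 8 := pow_le_pow_right₀ hY1 (by norm_num)
        have h9 : x * Y ^ 3 ≤ x * Y ^ 8 := mul_le_mul_of_nonneg_left h8 hx0.le
        have h10 : Y * 1 ≤ Y * (x * (4 * Y ^ 2)) := mul_le_mul_of_nonneg_left h7 hY0.le
        linarith [mul_pos hx0 (pow_pos hY0 8)]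
      · have hy1 := hℓY'.trans hyl
        have hy0 : 0 < |y| := lt_of_lt_of_le (by positivity) hy1
        have hR : ∀ u : ℝ, 0 < u → u ≤ 1 → ‖LSeries
            (fun n => (χ ^ 2 : DirichletCharacter ℂ q) (n : ZMod q)) (1 + u + 2 * I * y)‖ ≤
            3 * Y ^ 2 := by
          intro u hu hu1
          refine (hone2 u hu hu1).trans ?_
          have h1 : 1 / (2 * Y ^ 2) ≤ ‖(u + 2 * I * y : ℂ)‖ := by
            have := Complex.abs_im_le_norm (u + 2 * I * y : ℂ)
            simp [abs_mul] at this
            calc 1 / (2 * Y ^ 2) = 2 * (1 / (4 * Y ^ 2)) := by field_simp; norm_num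
              _ ≤ 2 * |y| := by gcongr
              _ ≤ _ := this
          have h2 : 1 / ‖(u + 2 * I * y : ℂ)‖ ≤ 2 * Y ^ 2 := by
            rw [div_le_comm₀ (lt_of_lt_of_le (by positivity) h1) (by positivity)]
            exact h1
          nlinarith
        have h := le_norm_LFunction_of_bounds hχ hY1 (by nlinarith) h0 hR hd hx0 hx1
        rw [← hsxy] at h
        refine le_trans (le_of_eq ?_) h
        congr 1
        ring
  · have hR : ∀ u : ℝ, 0 < u → u ≤ 1 → ‖LSeries
        (fun n => (χ ^ 2 : DirichletCharacter ℂ q) (n : ZMod q)) (1 + u + 2 * I * y)‖ ≤ Y := by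
      intro u hu hu1
      have h := h₂ q (χ ^ 2) hsq (1 + u + 2 * I * y) (by simpa using hu.le) (by simp; linarith)
      rw [iteratedDeriv_zero, DirichletCharacter.LFunction_eq_LSeries _ (by simpa using hu)] at h
      exact h.trans (hmono _ hC₂.le (by linarith) _ (by positivity) (by simpa using hbig))
    have h := le_norm_LFunction_of_bounds hχ hY1 hY1 h0 hR hd hx0 hx1
    rw [← hsxy] at h
    refine le_trans ?_ h
    have h8 : Y ^ 7 ≤ Y ^ 8 := pow_le_pow_right₀ hY1 (by norm_num)
    have : 16 * Y ^ 6 * Y = 16 * Y ^ 7 := by ring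
    rw [this]
    exact one_div_le_one_div_of_le (by positivity) (by linarith [pow_pos hY0 7])

lemma abscissa_charLambda_le {q : ℕ} (χ : DirichletCharacter ℂ q) :
    LSeries.abscissaOfAbsConv (fun n => charLambda χ n) ≤ (1 : ℝ) :=
  LSeries.abscissaOfAbsConv_le_of_forall_lt_LSeriesSummable fun y hy =>
    DirichletCharacter.LSeriesSummable_twist_vonMangoldt χ (s := y) (by simpa using hy)

lemma abscissa_charLambda_lt {q : ℕ} (χ : DirichletCharacter ℂ q) {s : ℂ} (hs : 1 < s.re) :
    LSeries.abscissaOfAbsConv (fun n => charLambda χ n) < s.re :=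
  (abscissa_charLambda_le χ).trans_lt (by exact_mod_cast hs)

lemma LSeries_charLambda_mul {q : ℕ} [NeZero q] (χ : DirichletCharacter ℂ q) {s : ℂ}
    (hs : 1 < s.re) :
    LSeries (fun n => charLambda χ n) s * DirichletCharacter.LFunction χ s =
      -deriv (DirichletCharacter.LFunction χ) s := by
  have h := DirichletCharacter.LSeries_twist_vonMangoldt_eq χ hs
  rw [← DirichletCharacter.LFunction_eq_LSeries χ hs,
    ← DirichletCharacter.deriv_LFunction_eq_deriv_LSeries χ hs, eq_div_iff] at h
  · exact h
  · rw [DirichletCharacter.LFunction_eq_LSeries χ hs]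
    exact DirichletCharacter.LSeries_ne_zero_of_one_lt_re χ hs

lemma sum_iteratedDeriv_charLambda {q : ℕ} [NeZero q] {χ : DirichletCharacter ℂ q} (hχ : χ ≠ 1)
    (k : ℕ) {s : ℂ} (hs : 1 < s.re) :
    ∑ i ∈ Finset.range (k + 1), (k.choose i : ℂ) *
      iteratedDeriv i (LSeries fun n => charLambda χ n) s *
        iteratedDeriv (k - i) (DirichletCharacter.LFunction χ) s =
      -iteratedDeriv (k + 1) (DirichletCharacter.LFunction χ) s := by
  have hopen : IsOpen {z : ℂ | 1 < z.re} := isOpen_lt continuous_const Complex.continuous_re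
  have h1 : ContDiffAt ℂ k (LSeries fun n => charLambda χ n) s :=
    (LSeries_analyticOnNhd _ s (abscissa_charLambda_lt χ hs)).contDiffAt
  have h2 : ContDiffAt ℂ k (DirichletCharacter.LFunction χ) s :=
    (DirichletCharacter.differentiable_LFunction hχ).contDiff.contDiffAt
  rw [← iteratedDeriv_mul h1 h2, iteratedDeriv_succ', ← iteratedDeriv_neg]
  refine Filter.EventuallyEq.iteratedDeriv_eq k ?_
  filter_upwards [hopen.mem_nhds hs] with z hz
  exact LSeries_charLambda_mul χ hz

lemma exists_norm_iteratedDeriv_charLambda_le (k : ℕ) : ∃ C : ℝ, 1 ≤ C ∧ ∀ j ≤ k,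
    ∀ (q : ℕ) [NeZero q] (χ : DirichletCharacter ℂ q), χ ≠ 1 → ∀ s : ℂ, 1 < s.re → ∀ Y : ℝ,
      1 ≤ Y → (∀ i ≤ k + 1, ‖iteratedDeriv i (DirichletCharacter.LFunction χ) s‖ ≤ Y) →
      1 ≤ Y * ‖DirichletCharacter.LFunction χ s‖ →
      ‖iteratedDeriv j (LSeries fun n => charLambda χ n) s‖ ≤ C * Y ^ (2 * j + 2) := by
  induction k with
  | zero =>
    refine ⟨1, le_rfl, fun j hj q _ χ hχ s hs Y hY hL hinv => ?_⟩
    obtain rfl : j = 0 := by omega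
    have h := sum_iteratedDeriv_charLambda hχ 0 hs
    simp only [zero_add, Finset.range_one, Finset.sum_singleton, Nat.choose_self, Nat.cast_one,
      one_mul, Nat.sub_self, iteratedDeriv_zero] at h
    have h2 := congrArg norm h
    rw [norm_mul, norm_neg] at h2
    have h3 := hL 1 (by norm_num)
    set D := ‖LSeries (fun n => charLambda χ n) s‖ with hD
    set l := ‖DirichletCharacter.LFunction χ s‖ with hl
    have hD0 : 0 ≤ D := norm_nonneg _
    rw [iteratedDeriv_zero]
    calc D ≤ D * (Y * l) := le_mul_of_one_le_right hD0 hinv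
      _ = Y * (D * l) := by ring
      _ ≤ Y * Y := by rw [h2]; gcongr
      _ = 1 * Y ^ (2 * 0 + 2) := by ring
  | succ k ih =>
    obtain ⟨C, hC, h⟩ := ih
    refine ⟨1 + 2 ^ (k + 1) * C, ?_, fun j hj q _ χ hχ s hs Y hY hL hinv => ?_⟩
    · have : 0 ≤ 2 ^ (k + 1) * C := by positivity
      linarith
    have hL' : ∀ i ≤ k + 1, ‖iteratedDeriv i (DirichletCharacter.LFunction χ) s‖ ≤ Y :=
      fun i hi => hL i (by omega)
    rcases Nat.lt_or_ge j (k + 1) with hjk | hjk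
    · refine (h j (by omega) q χ hχ s hs Y hY hL' hinv).trans ?_
      gcongr
      have h1 : 1 ≤ (2 : ℝ) ^ (k + 1) := one_le_pow₀ one_le_two
      nlinarith
    obtain rfl : j = k + 1 := by omega
    have hsum := sum_iteratedDeriv_charLambda hχ (k + 1) hs
    rw [Finset.sum_range_succ, Nat.sub_self, Nat.choose_self, Nat.cast_one, one_mul,
      iteratedDeriv_zero] at hsum
    set D := ‖iteratedDeriv (k + 1) (LSeries fun n => charLambda χ n) s‖ with hD
    set l := ‖DirichletCharacter.LFunction χ s‖ with hl
    set S := ∑ i ∈ Finset.range (k + 1), ((k + 1).choose i : ℂ) *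
      iteratedDeriv i (LSeries fun n => charLambda χ n) s *
        iteratedDeriv (k + 1 - i) (DirichletCharacter.LFunction χ) s with hS
    have hY0 : 0 ≤ Y := by linarith
    have hSle : ‖S‖ ≤ 2 ^ (k + 1) * C * Y ^ (2 * k + 3) := by
      calc ‖S‖ ≤ ∑ i ∈ Finset.range (k + 1), ((k + 1).choose i : ℝ) * (C * Y ^ (2 * k + 3)) := by
            refine norm_sum_le_of_le _ fun i hi => ?_
            have hi' : i ≤ k := by have := Finset.mem_range.1 hi; omega
            rw [norm_mul, norm_mul, Complex.norm_natCast, mul_assoc]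
            refine mul_le_mul_of_nonneg_left ?_ (Nat.cast_nonneg _)
            calc _ ≤ C * Y ^ (2 * i + 2) * Y :=
                  mul_le_mul (h i hi' q χ hχ s hs Y hY hL' hinv) (hL _ (by omega))
                    (norm_nonneg _) (by positivity)
              _ = C * Y ^ (2 * i + 3) := by ring
              _ ≤ C * Y ^ (2 * k + 3) := by
                  gcongr
        _ = (∑ i ∈ Finset.range (k + 1), ((k + 1).choose i : ℝ)) * (C * Y ^ (2 * k + 3)) := by
            rw [Finset.sum_mul]
        _ ≤ (2 ^ (k + 1) : ℝ) * (C * Y ^ (2 * k + 3)) := by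
            gcongr
            have h1 := Nat.sum_range_choose (k + 1)
            rw [Finset.sum_range_succ] at h1
            have h2 : ∑ i ∈ Finset.range (k + 1), (k + 1).choose i ≤ 2 ^ (k + 1) := by omega
            exact_mod_cast h2
        _ = _ := by ring
    have h2 : D * l ≤ Y + 2 ^ (k + 1) * C * Y ^ (2 * k + 3) := by
      have : iteratedDeriv (k + 1) (LSeries fun n => charLambda χ n) s *
          DirichletCharacter.LFunction χ s =
          -iteratedDeriv (k + 1 + 1) (DirichletCharacter.LFunction χ) s - S := by
        rw [← hsum]; ring
      rw [hD, hl, ← norm_mul, this]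
      refine (norm_sub_le _ _).trans ?_
      rw [norm_neg]
      exact add_le_add (hL _ le_rfl) hSle
    calc D ≤ D * (Y * l) := le_mul_of_one_le_right (norm_nonneg _) hinv
      _ = Y * (D * l) := by ring
      _ ≤ Y * (Y + 2 ^ (k + 1) * C * Y ^ (2 * k + 3)) := by gcongr
      _ = Y ^ 2 + 2 ^ (k + 1) * C * Y ^ (2 * (k + 1) + 2) := by ring
      _ ≤ Y ^ (2 * (k + 1) + 2) + 2 ^ (k + 1) * C * Y ^ (2 * (k + 1) + 2) := by
          gcongr
          omega
      _ = _ := by ring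

/-- `χ(n) Λ(n) (log n)^k`. -/
noncomputable def charLambdaLog {q : ℕ} (χ : DirichletCharacter ℂ q) (k : ℕ) (n : ℕ) : ℂ :=
  charLambda χ n * ((Real.log n ^ k : ℝ) : ℂ)

lemma iterate_logMul_charLambda {q : ℕ} (χ : DirichletCharacter ℂ q) (k : ℕ) :
    LSeries.logMul^[k] (fun n => charLambda χ n) = charLambdaLog χ k := by
  induction k with
  | zero => ext n; simp [charLambdaLog]
  | succ k ih =>
    rw [Function.iterate_succ_apply', ih]
    ext n
    rw [LSeries.logMul, charLambdaLog, charLambdaLog, ← Complex.natCast_log, pow_succ]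
    push_cast
    ring

lemma LSeriesSummable_charLambdaLog {q : ℕ} (χ : DirichletCharacter ℂ q) (k : ℕ) {s : ℂ}
    (hs : 1 < s.re) : LSeriesSummable (charLambdaLog χ k) s := by
  rw [← iterate_logMul_charLambda]
  refine LSeriesSummable_of_abscissaOfAbsConv_lt_re ?_
  rw [LSeries.absicssaOfAbsConv_logPowMul]
  exact abscissa_charLambda_lt χ hs

lemma norm_LSeries_charLambdaLog {q : ℕ} (χ : DirichletCharacter ℂ q) (k : ℕ) {s : ℂ}
    (hs : 1 < s.re) : ‖LSeries (charLambdaLog χ k) s‖ =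
      ‖iteratedDeriv k (LSeries fun n => charLambda χ n) s‖ := by
  rw [LSeries_iteratedDeriv k (abscissa_charLambda_lt χ hs), iterate_logMul_charLambda, norm_mul,
    norm_pow, norm_neg, norm_one, one_pow, one_mul]

lemma exists_norm_LSeries_charLambdaLog_le {ε : ℝ} (hε : 0 < ε) (k : ℕ) : ∃ C : ℝ, 0 < C ∧
    ∀ (q : ℕ) [NeZero q] (χ : DirichletCharacter ℂ q), χ.IsPrimitive → χ ≠ 1 → ∀ s : ℂ,
      1 < s.re → s.re ≤ 2 → ‖LSeries (charLambdaLog χ k) s‖ ≤ C * (q * (|s.im| + 2)) ^ ε := by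
  obtain ⟨C₀, hC₀, h₀⟩ := exists_norm_iteratedDeriv_charLambda_le k
  set δ : ℝ := ε / (2 * k + 2) with hδ
  have hδ0 : 0 < δ := by positivity
  have hder : ∀ m : ℕ, ∃ C : ℝ, 0 < C ∧ ∀ i < m,
      ∀ (q : ℕ) [NeZero q] (χ : DirichletCharacter ℂ q), χ ≠ 1 → ∀ s : ℂ, 1 ≤ s.re → s.re ≤ 2 →
      ‖iteratedDeriv i (DirichletCharacter.LFunction χ) s‖ ≤ C * (q * (|s.im| + 2)) ^ δ := by
    intro m
    induction m with
    | zero => exact ⟨1, one_pos, by simp⟩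
    | succ m ih =>
      obtain ⟨C, hC, h⟩ := ih
      obtain ⟨C', hC', h'⟩ := exists_norm_iteratedDeriv_LFunction_le hδ0 m
      refine ⟨C + C', by positivity, fun i hi q _ χ hχ s hs hs2 => ?_⟩
      have hpos : 0 ≤ ((q : ℝ) * (|s.im| + 2)) ^ δ := by positivity
      rcases Nat.lt_succ_iff_lt_or_eq.1 hi with hi | rfl
      · have := h i hi q χ hχ s hs hs2; nlinarith
      · have := h' q χ hχ s hs hs2; nlinarith
  obtain ⟨C₁, hC₁, h₁⟩ := hder (k + 2)
  obtain ⟨c, hc, h₂⟩ := exists_le_norm_LFunction hδ0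
  set K : ℝ := 1 + C₁ + c⁻¹ with hK
  have hci : 0 < c⁻¹ := inv_pos.2 hc
  refine ⟨C₀ * K ^ (2 * k + 2), by positivity, fun q _ χ hp hχ s hs hs2 => ?_⟩
  have hq : (1 : ℝ) ≤ q := by exact_mod_cast Nat.one_le_iff_ne_zero.2 (NeZero.ne q)
  have hlow := h₂ q χ hp hχ s hs hs2
  have hV1 : 1 ≤ (q : ℝ) * (|s.im| + 2) := by nlinarith [abs_nonneg s.im]
  have hder := fun i hi => h₁ i hi q χ hχ s hs.le hs2
  set V : ℝ := q * (|s.im| + 2) with hV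
  clear_value V
  have hVδ : 1 ≤ V ^ δ := Real.one_le_rpow hV1 hδ0.le
  rw [norm_LSeries_charLambdaLog χ k hs]
  refine (h₀ k le_rfl q χ hχ s hs (K * V ^ δ) ?_ ?_ ?_).trans (le_of_eq ?_)
  · have : 1 ≤ K := by rw [hK]; linarith
    nlinarith
  · intro i hi
    refine (hder i (by omega)).trans ?_
    gcongr
    rw [hK]; linarith
  · rw [Real.rpow_neg (by linarith)] at hlow
    calc (1 : ℝ) = c⁻¹ * V ^ δ * (c * (V ^ δ)⁻¹) := by field_simp
      _ ≤ K * V ^ δ * ‖DirichletCharacter.LFunction χ s‖ := by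
          gcongr
          rw [hK]; linarith
  · rw [mul_pow, ← Real.rpow_mul_natCast (by linarith), mul_assoc]
    congr 3
    rw [hδ]; push_cast; field_simp

lemma exists_norm_smoothSum_charLambdaLog_le (k : ℕ) : ∃ C : ℝ, 0 < C ∧
    ∀ (q : ℕ) [NeZero q] (χ : DirichletCharacter ℂ q), χ.IsPrimitive → χ ≠ 1 → ∀ x : ℝ,
      3 ≤ x → ‖smoothSum (charLambdaLog χ k) x‖ ≤ C * (q : ℝ) ^ (1 / 2 : ℝ) * x := by
  obtain ⟨C, hC, h⟩ := exists_norm_LSeries_charLambdaLog_le (ε := 1 / 2) (by norm_num) k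
  refine ⟨(perronConst + 1) * (2 * C) * Real.exp 1,
    by have := perronConst_nonneg; positivity, fun q _ χ hp hχ x hx => ?_⟩
  have hlog : 1 < Real.log x := by
    rw [Real.lt_log_iff_exp_lt (by linarith)]
    exact lt_of_lt_of_le (lt_trans Real.exp_one_lt_d9 (by norm_num)) hx
  set σ : ℝ := 1 + 1 / Real.log x with hσ
  have hinv : 0 < 1 / Real.log x := by positivity
  have hinv1 : 1 / Real.log x ≤ 1 := by rw [div_le_one (by linarith)]; exact hlog.le
  have hb := norm_smoothSum_le (a := charLambdaLog χ k) (σ := σ) (x := x)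
    (D := 2 * C * (q : ℝ) ^ (1 / 2 : ℝ)) (by linarith) (by linarith)
    (LSeriesSummable_charLambdaLog χ k (by simpa [hσ] using by linarith)) ?_
  · have hxσ : x ^ σ = Real.exp 1 * x := by
      rw [hσ, Real.rpow_add (by linarith), Real.rpow_one, mul_comm, Real.rpow_def_of_pos
        (by linarith), mul_one_div_cancel (by linarith)]
    rw [hxσ] at hb
    refine hb.trans ?_
    have : 0 ≤ 2 * C * (q : ℝ) ^ (1 / 2 : ℝ) * (Real.exp 1 * x) := by positivity
    nlinarith
  · intro t
    refine (h q χ hp hχ (σ + t * I) (by simp; linarith) (by simp; linarith)).trans ?_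
    have him : ((σ : ℂ) + t * I).im = t := by simp
    rw [him, Real.mul_rpow (by positivity) (by positivity)]
    have : (|t| + 2) ^ (1 / 2 : ℝ) ≤ 2 * (1 + t ^ 2) ^ (1 / 4 : ℝ) := by
      have h16 : (2 : ℝ) = (16 : ℝ) ^ (1 / 4 : ℝ) := by
        rw [show (16 : ℝ) = 2 ^ (4 : ℝ) by norm_num, ← Real.rpow_mul (by norm_num)]; norm_num
      have h2 : (|t| + 2) ^ (1 / 2 : ℝ) = ((|t| + 2) ^ 2) ^ (1 / 4 : ℝ) := by
        rw [← Real.rpow_natCast, ← Real.rpow_mul (by positivity)]; norm_num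
      rw [h2]
      calc _ ≤ (16 * (1 + t ^ 2)) ^ (1 / 4 : ℝ) := by
            gcongr
            nlinarith [sq_abs t, sq_nonneg (|t| - 1), abs_nonneg t]
        _ = 16 ^ (1 / 4 : ℝ) * (1 + t ^ 2) ^ (1 / 4 : ℝ) :=
            Real.mul_rpow (by norm_num) (by positivity)
        _ = _ := by rw [← h16]
    calc _ ≤ C * ((q : ℝ) ^ (1 / 2 : ℝ) * (2 * (1 + t ^ 2) ^ (1 / 4 : ℝ))) := by gcongr
      _ = _ := by ring

lemma natCast_mul_smoothSum (a : ℕ → ℂ) {M : ℕ} (hM : 1 ≤ M) :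
    (M : ℂ) * smoothSum a M = ∑ n ∈ Finset.Ico 1 (M + 1), a n * ((M : ℂ) - n) := by
  have h0 : (M : ℂ) ≠ 0 := by exact_mod_cast (by omega : M ≠ 0)
  rw [smoothSum, Nat.floor_natCast, Finset.mul_sum]
  refine Finset.sum_congr (by ext; simp) fun n _ => ?_
  push_cast
  field_simp

lemma norm_sum_le_of_norm_smoothSum_le {a : ℕ → ℂ} {R B : ℝ} {M h : ℕ} (hM : 1 ≤ M) (hh : 1 ≤ h)
    (hB : 0 ≤ B) (hS : ∀ m : ℕ, 1 ≤ m → ‖smoothSum a m‖ ≤ B * m)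
    (ha : ∀ n ≤ M + h, ‖a n‖ ≤ R) :
    ‖∑ n ∈ Finset.Ico 1 (M + 1), a n‖ * h ≤ 2 * B * (M + h) ^ 2 + R * h ^ 2 := by
  have h1 := natCast_mul_smoothSum a (M := M + h) (by omega)
  have h2 := natCast_mul_smoothSum a hM
  rw [← Finset.sum_Ico_consecutive _ (by omega : 1 ≤ M + 1) (by omega : M + 1 ≤ M + h + 1)] at h1
  have h3 : ∑ n ∈ Finset.Ico 1 (M + 1), a n * (((M + h : ℕ) : ℂ) - n) =
      ∑ n ∈ Finset.Ico 1 (M + 1), a n * ((M : ℂ) - n) +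
        (∑ n ∈ Finset.Ico 1 (M + 1), a n) * h := by
    rw [Finset.sum_mul, ← Finset.sum_add_distrib]
    refine Finset.sum_congr rfl fun n _ => ?_
    push_cast; ring
  rw [h3, ← h2] at h1
  have h4 : (∑ n ∈ Finset.Ico 1 (M + 1), a n) * h = ((M + h : ℕ) : ℂ) * smoothSum a (M + h : ℕ) -
      M * smoothSum a M - ∑ n ∈ Finset.Ico (M + 1) (M + h + 1), a n * (((M + h : ℕ) : ℂ) - n) := by
    rw [h1]; ring
  have h5 : ‖∑ n ∈ Finset.Ico (M + 1) (M + h + 1), a n * (((M + h : ℕ) : ℂ) - n)‖ ≤ R * h ^ 2 := by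
    have : ∀ n ∈ Finset.Ico (M + 1) (M + h + 1), ‖a n * (((M + h : ℕ) : ℂ) - n)‖ ≤ R * h := by
      intro n hn
      rw [Finset.mem_Ico] at hn
      rw [← Nat.cast_sub (by omega), norm_mul, Complex.norm_natCast]
      have hle : ((M + h - n : ℕ) : ℝ) ≤ h := by exact_mod_cast (by omega : M + h - n ≤ h)
      exact mul_le_mul (ha n (by omega)) hle (Nat.cast_nonneg _)
        ((norm_nonneg _).trans (ha n (by omega)))
    refine (norm_sum_le_of_le _ this).trans (le_of_eq ?_)
    rw [Finset.sum_const, Nat.card_Ico, nsmul_eq_mul, show M + h + 1 - (M + 1) = h by omega]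
    ring
  have h6 : ‖∑ n ∈ Finset.Ico 1 (M + 1), a n‖ * h =
      ‖(∑ n ∈ Finset.Ico 1 (M + 1), a n) * h‖ := by rw [norm_mul, Complex.norm_natCast]
  rw [h6, h4]
  have hb1 := hS (M + h) (by omega)
  have hb2 := hS M hM
  refine (norm_sub_le _ _).trans (add_le_add ((norm_sub_le _ _).trans ?_) h5)
  rw [norm_mul, norm_mul, Complex.norm_natCast, Complex.norm_natCast]
  have e1 : ((M + h : ℕ) : ℝ) * ‖smoothSum a (M + h : ℕ)‖ ≤ B * (M + h) ^ 2 := by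
    calc _ ≤ ((M + h : ℕ) : ℝ) * (B * (M + h : ℕ)) :=
          mul_le_mul_of_nonneg_left hb1 (Nat.cast_nonneg _)
      _ = _ := by push_cast; ring
  have e2 : (M : ℝ) * ‖smoothSum a M‖ ≤ B * (M + h) ^ 2 := by
    calc _ ≤ (M : ℝ) * (B * M) := mul_le_mul_of_nonneg_left hb2 (Nat.cast_nonneg _)
      _ = B * (M : ℝ) ^ 2 := by ring
      _ ≤ _ := by gcongr; linarith [(Nat.cast_nonneg h : (0 : ℝ) ≤ h)]
  linarith

lemma exists_log_pow_le (j : ℕ) {ε : ℝ} (hε : 0 < ε) : ∃ C : ℝ, 0 < C ∧ ∀ x : ℝ, 1 ≤ x →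
    Real.log x ^ j ≤ C * x ^ ε := by
  obtain ⟨δ, hδ⟩ : ∃ δ : ℝ, δ = ε / (j + 1) := ⟨_, rfl⟩
  have hδ0 : 0 < δ := by rw [hδ]; positivity
  refine ⟨(1 / δ) ^ j, by positivity, fun x hx => ?_⟩
  have h := Real.log_le_rpow_div (zero_le_one.trans hx) hδ0
  calc Real.log x ^ j ≤ (x ^ δ / δ) ^ j := pow_le_pow_left₀ (Real.log_nonneg hx) h j
    _ = (1 / δ) ^ j * x ^ (δ * j) := by
        rw [Real.rpow_mul (by linarith), Real.rpow_natCast, div_pow, div_pow, one_pow]; ring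
    _ ≤ (1 / δ) ^ j * x ^ ε := by
        refine mul_le_mul_of_nonneg_left (Real.rpow_le_rpow_of_exponent_le hx ?_) (by positivity)
        rw [hδ, div_mul_eq_mul_div, div_le_iff₀ (by positivity)]
        nlinarith

lemma norm_charLambda_le {q : ℕ} (χ : DirichletCharacter ℂ q) (n : ℕ) :
    ‖charLambda χ n‖ ≤ ArithmeticFunction.vonMangoldt n := by
  rw [charLambda_apply, norm_mul, Complex.norm_real,
    Real.norm_of_nonneg ArithmeticFunction.vonMangoldt_nonneg]
  exact mul_le_of_le_one_left ArithmeticFunction.vonMangoldt_nonneg (DirichletCharacter.norm_le_one χ _)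

lemma norm_charLambdaLog_le {q : ℕ} (χ : DirichletCharacter ℂ q) (k : ℕ) {n : ℕ} {x : ℝ}
    (hx : 1 ≤ x) (hn : n ≤ x) : ‖charLambdaLog χ k n‖ ≤ Real.log x ^ (k + 1) := by
  have hlog : Real.log n ≤ Real.log x := by
    rcases Nat.eq_zero_or_pos n with rfl | h
    · simpa using Real.log_nonneg hx
    · exact Real.log_le_log (by exact_mod_cast h) hn
  have h0 := Real.log_natCast_nonneg n
  rw [charLambdaLog, norm_mul, Complex.norm_real, Real.norm_of_nonneg (by positivity), pow_succ']
  exact mul_le_mul ((norm_charLambda_le χ n).trans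
    (ArithmeticFunction.vonMangoldt_le_log.trans hlog)) (pow_le_pow_left₀ h0 hlog k)
    (by positivity) (h0.trans hlog)

lemma one_lt_log {x : ℝ} (hx : 3 ≤ x) : 1 < Real.log x := by
  rw [Real.lt_log_iff_exp_lt (by linarith)]
  exact lt_of_lt_of_le (lt_trans Real.exp_one_lt_d9 (by norm_num)) hx

lemma exists_norm_sum_charLambdaLog_le (m : ℕ) : ∃ C : ℝ, 0 < C ∧
    ∀ (q : ℕ) [NeZero q] (χ : DirichletCharacter ℂ q), χ.IsPrimitive → χ ≠ 1 → ∀ x : ℝ,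
      3 ≤ x → ∀ M : ℕ, M ≤ x → ‖∑ n ∈ Finset.Ico 1 (M + 1), charLambdaLog χ (2 * m) n‖ ≤
        C * q * x * Real.log x ^ (m + 1) := by
  obtain ⟨C, hC, h⟩ := exists_norm_smoothSum_charLambdaLog_le (2 * m)
  obtain ⟨C₁, hC₁, h₁⟩ := exists_log_pow_le (2 * m + 1) one_pos
  refine ⟨32 * (C + 1) + 2 ^ (2 * m + 1) * (1 + C₁), by positivity,
    fun q _ χ hp hχ x hx M hM => ?_⟩
  have hq : (1 : ℝ) ≤ q := by exact_mod_cast NeZero.one_le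
  have hL := one_lt_log hx
  set L := Real.log x with hLdef
  rcases Nat.eq_zero_or_pos M with rfl | hM0
  · simp; positivity
  have hS : ∀ n : ℕ, 1 ≤ n → ‖smoothSum (charLambdaLog χ (2 * m)) n‖ ≤ (C + 1) * q * n := by
    intro n hn
    have hn1 : (1 : ℝ) ≤ n := by exact_mod_cast hn
    rcases Nat.lt_or_ge n 3 with h3 | h3
    · rw [smoothSum, Nat.floor_natCast]
      have hle : ∀ i ∈ Finset.Icc 1 n, ‖charLambdaLog χ (2 * m) i * ((1 - i / n : ℝ) : ℂ)‖ ≤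
          (1 : ℝ) := by
        intro i hi
        rw [Finset.mem_Icc] at hi
        rw [norm_mul, Complex.norm_real]
        have hi' : (i : ℝ) ≤ n := by exact_mod_cast hi.2
        have hi2 : (i : ℝ) ≤ 2 := by exact_mod_cast (by omega : i ≤ 2)
        have e1 := norm_charLambdaLog_le χ (2 * m) one_le_two hi2
        have e2 : Real.log 2 ^ (2 * m + 1) ≤ 1 :=
          pow_le_one₀ (Real.log_nonneg one_le_two) (by linarith [Real.log_two_lt_d9])
        have e3 : ‖(1 - i / n : ℝ)‖ ≤ 1 := by
          rw [Real.norm_eq_abs, abs_le]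
          have : (i : ℝ) / n ≤ 1 := div_le_one_of_le₀ hi' (by positivity)
          have : 0 ≤ (i : ℝ) / n := by positivity
          constructor <;> linarith
        exact mul_le_one₀ (e1.trans e2) (norm_nonneg _) e3
      refine (norm_sum_le_of_le _ hle).trans ?_
      rw [Finset.sum_const, Nat.card_Icc, nsmul_eq_mul, mul_one, Nat.add_sub_cancel]
      have : 1 * 1 ≤ (C + 1) * (q : ℝ) := mul_le_mul (by linarith) hq (by norm_num) (by positivity)
      nlinarith
    · refine (h q χ hp hχ n (by exact_mod_cast h3)).trans ?_
      have : (q : ℝ) ^ (1 / 2 : ℝ) ≤ q := by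
        conv_rhs => rw [← Real.rpow_one (q : ℝ)]
        exact Real.rpow_le_rpow_of_exponent_le hq (by norm_num)
      gcongr
      linarith
  set H : ℕ := ⌈x / L ^ m⌉₊ with hH
  have hLm : 1 ≤ L ^ m := one_le_pow₀ hL.le
  have hxL : 0 < x / L ^ m := by positivity
  have hH1 : 1 ≤ H := Nat.ceil_pos.2 hxL
  have hHge : x / L ^ m ≤ H := Nat.le_ceil _
  have hHle : (H : ℝ) ≤ x / L ^ m + 1 := (Nat.ceil_lt_add_one hxL.le).le
  have hxx : x / L ^ m ≤ x := div_le_self (by linarith) hLm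
  have hMH : ((M + H : ℕ) : ℝ) ≤ 3 * x := by push_cast; linarith
  have hlog3 : Real.log (3 * x) ≤ 2 * L := by
    rw [Real.log_mul (by norm_num) (by linarith)]
    linarith [Real.log_le_log (by norm_num) hx]
  have hR : ∀ n ≤ M + H, ‖charLambdaLog χ (2 * m) n‖ ≤ (2 * L) ^ (2 * m + 1) := by
    intro n hn
    refine (norm_charLambdaLog_le χ (2 * m) (x := 3 * x) (by linarith)
      ((Nat.cast_le.2 hn).trans hMH)).trans ?_
    exact pow_le_pow_left₀ (Real.log_nonneg (by linarith)) hlog3 _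
  have key := norm_sum_le_of_norm_smoothSum_le hM0 hH1 (by positivity) hS hR
  have hH0 : (0 : ℝ) < H := by exact_mod_cast hH1
  have hsq : ((M : ℝ) + H) ^ 2 ≤ 9 * x ^ 2 := by
    push_cast at hMH
    calc _ ≤ (3 * x) ^ 2 := by gcongr
      _ = _ := by ring
  have hLL := h₁ x (by linarith)
  rw [Real.rpow_one] at hLL
  have hdiv : ‖∑ n ∈ Finset.Ico 1 (M + 1), charLambdaLog χ (2 * m) n‖ ≤
      18 * ((C + 1) * q) * x * L ^ m + (2 * L) ^ (2 * m + 1) * H := by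
    rw [← mul_le_mul_iff_left₀ hH0]
    refine key.trans ?_
    have hxH : x ≤ H * L ^ m := by rwa [div_le_iff₀ (by positivity)] at hHge
    have e1 : 2 * ((C + 1) * q) * ((M : ℝ) + H) ^ 2 ≤ 18 * ((C + 1) * q) * x * L ^ m * H := by
      calc _ ≤ 2 * ((C + 1) * q) * (9 * x ^ 2) := by gcongr
        _ = 18 * ((C + 1) * q) * x * x := by ring
        _ ≤ 18 * ((C + 1) * q) * x * (H * L ^ m) := by gcongr
        _ = _ := by ring
    linarith
  refine hdiv.trans ?_
  have e2 : (2 * L) ^ (2 * m + 1) * H ≤ 2 ^ (2 * m + 1) * (1 + C₁) * (q * x * L ^ (m + 1)) := by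
    calc (2 * L) ^ (2 * m + 1) * H ≤ (2 * L) ^ (2 * m + 1) * (x / L ^ m + 1) := by gcongr
      _ = 2 ^ (2 * m + 1) * (x * L ^ (m + 1) + L ^ (2 * m + 1)) := by
          have : L ^ (2 * m + 1) = L ^ m * L ^ (m + 1) := by ring
          rw [mul_pow, this]; field_simp
      _ ≤ 2 ^ (2 * m + 1) * (1 * (x * L ^ (m + 1)) + C₁ * (x * L ^ (m + 1))) := by
          rw [one_mul]
          have : 1 ≤ L ^ (m + 1) := one_le_pow₀ hL.le
          have h3 : C₁ * x ≤ C₁ * (x * L ^ (m + 1)) :=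
            mul_le_mul_of_nonneg_left (le_mul_of_one_le_right (by linarith) this) hC₁.le
          gcongr
          linarith
      _ = 2 ^ (2 * m + 1) * (1 + C₁) * (1 * (x * L ^ (m + 1))) := by ring
      _ ≤ 2 ^ (2 * m + 1) * (1 + C₁) * (q * (x * L ^ (m + 1))) := by gcongr
      _ = _ := by ring
  have e3 : 18 * ((C + 1) * q) * x * L ^ m ≤ 32 * (C + 1) * (q * x * L ^ (m + 1)) := by
    have : L ^ m ≤ L ^ (m + 1) := pow_le_pow_right₀ hL.le (by omega)
    calc _ ≤ 32 * ((C + 1) * q) * x * L ^ (m + 1) := by gcongr; norm_num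
      _ = _ := by ring
  calc _ ≤ _ := add_le_add e3 e2
    _ = _ := by ring

/-- A smoothed Siegel–Walfisz theorem for primitive characters. -/
theorem exists_siegel_walfisz (A K : ℕ) : ∃ C : ℝ, 0 < C ∧
    ∀ (q : ℕ) [NeZero q] (χ : DirichletCharacter ℂ q), χ.IsPrimitive → χ ≠ 1 → ∀ x : ℝ,
      3 ≤ x → q ≤ Real.log x ^ K →
        ‖smoothSum (fun n => charLambda χ n) x‖ ≤ C * x / Real.log x ^ A := by
  set m := A + K + 1 with hm
  obtain ⟨C, hC, h⟩ := exists_norm_sum_charLambdaLog_le m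
  obtain ⟨C₁, hC₁, h₁⟩ := exists_log_pow_le (A + 1) (ε := 1 / 2) (by norm_num)
  refine ⟨C₁ + 2 * C * 4 ^ m, by positivity, fun q _ χ hp hχ x hx hqx => ?_⟩
  have hL := one_lt_log hx
  have hT := h q χ hp hχ x hx
  have hLx := h₁ x (by linarith)
  have hlam : ∀ n : ℕ, n ≤ x → ‖charLambda χ n‖ ≤ Real.log x := fun n hn => by
    have := norm_charLambdaLog_le χ 0 (by linarith) hn
    simpa [charLambdaLog] using this
  set L := Real.log x with hLdef
  set T : ℝ := C * q * x * L ^ (m + 1) with hTdef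
  have hT0 : 0 ≤ T := by positivity
  set X := ⌊x⌋₊ with hX
  have hXx : (X : ℝ) ≤ x := Nat.floor_le (by linarith)
  set Y := ⌊Real.sqrt x⌋₊ with hY
  have hsx : 1 ≤ Real.sqrt x := by rw [Real.one_le_sqrt]; linarith
  have hsx' : Real.sqrt x ≤ x := by
    have := Real.mul_self_sqrt (by linarith : 0 ≤ x)
    nlinarith
  have hYX : Y ≤ X := Nat.floor_le_floor hsx'
  have hYs : (Y : ℝ) ≤ Real.sqrt x := Nat.floor_le (by positivity)
  have hYs' : Real.sqrt x < Y + 1 := Nat.lt_floor_add_one _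
  have hY1 : 1 ≤ Y := Nat.le_floor (by simpa using hsx)
  set f : ℕ → ℂ := fun n => if n < X + 1 then charLambdaLog χ (2 * m) n else 0 with hf
  have hrange : ∀ N : ℕ, ‖∑ n ∈ Finset.range N, f n‖ ≤ T := by
    intro N
    have h0 : ∑ n ∈ Finset.range N, f n =
        ∑ n ∈ Finset.range (min N (X + 1)), charLambdaLog χ (2 * m) n := by
      rw [hf, ← Finset.sum_filter]
      refine Finset.sum_congr ?_ fun _ _ => rfl
      ext; simp
    rw [h0]
    rcases Nat.eq_zero_or_pos (min N (X + 1)) with h0 | h0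
    · rw [h0]; simpa using hT0
    · have hle : ((min N (X + 1) - 1 : ℕ) : ℝ) ≤ x := by
        refine le_trans ?_ hXx
        exact_mod_cast (by omega : min N (X + 1) - 1 ≤ X)
      have := hT _ hle
      rw [Nat.sub_add_cancel h0] at this
      rw [Finset.range_eq_Ico, Finset.sum_eq_sum_Ico_succ_bot h0]
      simpa [charLambdaLog] using this
  have hIco : ∀ M N, ‖∑ n ∈ Finset.Ico M N, f n‖ ≤ 2 * T := by
    intro M N
    rcases Nat.lt_or_ge N M with hlt | hge
    · rw [Finset.Ico_eq_empty (by omega)]; simpa using hT0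
    · rw [Finset.sum_Ico_eq_sub _ hge]
      refine (norm_sub_le _ _).trans ?_
      linarith [hrange M, hrange N]
  set g : ℕ → ℝ := fun n => max 0 (1 - n / x) / Real.log n ^ (2 * m) with hg
  have hg0 : ∀ n, 0 ≤ g n := fun n => by
    have := Real.log_natCast_nonneg n
    exact div_nonneg (le_max_left _ _) (by positivity)
  have hanti : ∀ n ∈ Finset.Ico (Y + 1) (X + 1), g (n + 1) ≤ g n := by
    intro n hn
    rw [Finset.mem_Ico] at hn
    have hlogn : 0 < Real.log n := Real.log_pos (by exact_mod_cast (by omega : 1 < n))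
    have hll : Real.log n ≤ Real.log (n + 1 : ℕ) :=
      Real.log_le_log (by exact_mod_cast (by omega : 0 < n)) (by push_cast; linarith)
    refine div_le_div₀ (le_max_left _ _) ?_ (by positivity) (pow_le_pow_left₀ hlogn.le hll _)
    refine max_le_max le_rfl ?_
    push_cast
    gcongr
    linarith
  have hab := norm_sum_Ico_mul_antitone_le hIco (by omega : Y + 1 ≤ X + 1) (hg0 _) hanti
  have hgY : g (Y + 1) ≤ 4 ^ m / L ^ (2 * m) := by
    have hl : L / 2 ≤ Real.log ((Y + 1 : ℕ) : ℝ) := by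
      rw [hLdef, ← Real.log_sqrt (by linarith)]
      refine Real.log_le_log (by linarith) ?_
      push_cast; exact hYs'.le
    calc g (Y + 1) ≤ 1 / (L / 2) ^ (2 * m) := by
          refine div_le_div₀ zero_le_one ?_ (by positivity) (by gcongr)
          refine max_le zero_le_one ?_
          have : 0 ≤ ((Y + 1 : ℕ) : ℝ) / x := by positivity
          linarith
      _ = 4 ^ m / L ^ (2 * m) := by
          rw [div_pow, show (4 : ℝ) = 2 ^ 2 by norm_num, ← pow_mul]
          field_simp
  have hsplit : smoothSum (fun n => charLambda χ n) x =
      ∑ n ∈ Finset.Ico 1 (Y + 1), charLambda χ n * ((1 - n / x : ℝ) : ℂ) +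
        ∑ n ∈ Finset.Ico (Y + 1) (X + 1), f n * (g n : ℂ) := by
    have : ∑ n ∈ Finset.Ico (Y + 1) (X + 1), f n * (g n : ℂ) =
        ∑ n ∈ Finset.Ico (Y + 1) (X + 1), charLambda χ n * ((1 - n / x : ℝ) : ℂ) := by
      refine Finset.sum_congr rfl fun n hn => ?_
      rw [Finset.mem_Ico] at hn
      have hlogn : 0 < Real.log n := Real.log_pos (by exact_mod_cast (by omega : 1 < n))
      have hnx : (n : ℝ) ≤ x := le_trans (by exact_mod_cast (by omega : n ≤ X)) hXx
      have hpos : 0 ≤ 1 - (n : ℝ) / x := by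
        rw [sub_nonneg]; exact div_le_one_of_le₀ hnx (by linarith)
      simp only [hf, hg]
      rw [if_pos hn.2, max_eq_right hpos, charLambdaLog, mul_assoc, ← Complex.ofReal_mul]
      congr 2
      field_simp
    rw [this, Finset.sum_Ico_consecutive _ (by omega) (by omega), smoothSum]
    refine Finset.sum_congr ?_ fun _ _ => rfl
    ext; simp; omega
  have hsmall : ‖∑ n ∈ Finset.Ico 1 (Y + 1), charLambda χ n * ((1 - n / x : ℝ) : ℂ)‖ ≤
      Real.sqrt x * L := by
    have hle : ∀ n ∈ Finset.Ico 1 (Y + 1), ‖charLambda χ n * ((1 - n / x : ℝ) : ℂ)‖ ≤ L := by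
      intro n hn
      rw [Finset.mem_Ico] at hn
      have hnx : (n : ℝ) ≤ x := le_trans (by exact_mod_cast (by omega : n ≤ X)) hXx
      rw [norm_mul, Complex.norm_real]
      have e3 : ‖(1 - n / x : ℝ)‖ ≤ 1 := by
        rw [Real.norm_eq_abs, abs_le]
        have : (n : ℝ) / x ≤ 1 := div_le_one_of_le₀ hnx (by linarith)
        have : 0 ≤ (n : ℝ) / x := by positivity
        constructor <;> linarith
      calc _ ≤ L * 1 := mul_le_mul (hlam n hnx) e3 (norm_nonneg _) (by linarith)
        _ = L := mul_one _
    refine (norm_sum_le_of_le _ hle).trans ?_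
    rw [Finset.sum_const, Nat.card_Ico, nsmul_eq_mul, Nat.add_sub_cancel]
    gcongr
  have hs1 : Real.sqrt x * L ≤ C₁ * x / L ^ A := by
    rw [le_div_iff₀ (by positivity)]
    calc Real.sqrt x * L * L ^ A = Real.sqrt x * L ^ (A + 1) := by ring
      _ ≤ Real.sqrt x * (C₁ * Real.sqrt x) := by
          rw [Real.sqrt_eq_rpow] at *
          gcongr
      _ = C₁ * x := by
          rw [mul_left_comm, Real.mul_self_sqrt (by linarith)]
  have hs2 : 2 * T * g (Y + 1) ≤ 2 * C * 4 ^ m * x / L ^ A := by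
    calc 2 * T * g (Y + 1) ≤ 2 * T * (4 ^ m / L ^ (2 * m)) := by gcongr
      _ ≤ 2 * (C * L ^ K * x * L ^ (m + 1)) * (4 ^ m / L ^ (2 * m)) := by
          rw [hTdef]; gcongr
      _ = 2 * C * 4 ^ m * x / L ^ A := by
          have : L ^ (2 * m) = L ^ A * (L ^ K * L ^ (m + 1)) := by
            rw [← pow_add, ← pow_add]; congr 1; omega
          rw [this]
          field_simp
  rw [hsplit]
  calc _ ≤ _ := norm_add_le _ _
    _ ≤ C₁ * x / L ^ A + 2 * C * 4 ^ m * x / L ^ A :=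
        add_le_add (hsmall.trans hs1) (hab.trans hs2)
    _ = _ := by ring

/-- `e(β) = exp(2πiβ)`. -/
noncomputable def expTwoPi (β : ℝ) : ℂ := Complex.exp (2 * Real.pi * I * β)

lemma norm_expTwoPi (β : ℝ) : ‖expTwoPi β‖ = 1 := by
  rw [expTwoPi, show (2 * Real.pi * I * β : ℂ) = ((2 * Real.pi * β : ℝ) : ℂ) * I by push_cast; ring]
  exact Complex.norm_exp_ofReal_mul_I _

lemma expTwoPi_ne_zero (β : ℝ) : expTwoPi β ≠ 0 := Complex.exp_ne_zero _

lemma expTwoPi_sub_int (β : ℝ) (m : ℤ) : expTwoPi (β - m) = expTwoPi β := by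
  rw [expTwoPi, expTwoPi, Complex.exp_eq_exp_iff_exists_int]
  exact ⟨-m, by push_cast; ring⟩

lemma expTwoPi_mul_conj (α β : ℝ) :
    expTwoPi α * (starRingEnd ℂ) (expTwoPi β) = expTwoPi (α - β) := by
  rw [expTwoPi, expTwoPi, expTwoPi, ← Complex.exp_conj, ← Complex.exp_add]
  congr 1
  simp only [map_mul, Complex.conj_ofReal, Complex.conj_I, map_ofNat, Complex.ofReal_sub]
  ring

lemma norm_geom_sum_expTwoPi_le (K : ℕ) (β : ℝ) :
    ‖∑ j ∈ Finset.range K, expTwoPi β ^ j‖ ≤ K := by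
  refine (norm_sum_le_of_le _ (f := fun j => expTwoPi β ^ j) (n := fun _ => (1 : ℝ))
    fun j _ => ?_).trans (by simp)
  rw [norm_pow, norm_expTwoPi, one_pow]

lemma norm_geom_sum_expTwoPi_mul_le (K : ℕ) {β : ℝ} (hβ : |β| ≤ 1 / 2) :
    ‖∑ j ∈ Finset.range K, expTwoPi β ^ j‖ * (2 * |β|) ≤ 1 := by
  have hpi := Real.pi_pos
  rcases eq_or_ne β 0 with rfl | h0
  · simp
  have h1 : 4 * |β| ≤ ‖expTwoPi β - 1‖ := by
    rw [expTwoPi, show (2 * Real.pi * I * β : ℂ) = I * ((2 * Real.pi * β : ℝ) : ℂ) by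
      push_cast; ring, Complex.norm_exp_I_mul_ofReal_sub_one, norm_mul, Real.norm_eq_abs,
      Real.norm_eq_abs, abs_two]
    have h2 : |2 * Real.pi * β / 2| = Real.pi * |β| := by
      rw [show 2 * Real.pi * β / 2 = Real.pi * β by ring, abs_mul, abs_of_pos hpi]
    have h3 := Real.mul_abs_le_abs_sin (x := 2 * Real.pi * β / 2) (by rw [h2]; nlinarith)
    rw [h2] at h3
    have : 2 / Real.pi * (Real.pi * |β|) = 2 * |β| := by field_simp
    linarith
  have hb : 0 < |β| := abs_pos.2 h0
  have h2 : 0 < ‖expTwoPi β - 1‖ := by linarith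
  have hne : expTwoPi β ≠ 1 := fun h => by simp [h] at h2
  have h3 : ‖expTwoPi β ^ K - 1‖ ≤ 2 := by
    refine (norm_sub_le _ _).trans ?_
    rw [norm_pow, norm_expTwoPi, one_pow, norm_one]; norm_num
  rw [geom_sum_eq hne, norm_div, div_mul_eq_mul_div, div_le_one h2]
  calc _ ≤ 2 * (2 * |β|) := by gcongr
    _ ≤ _ := by linarith

lemma sum_inv_sq_le_two (T : Finset ℕ) (h0 : 0 ∉ T) : ∑ k ∈ T, ((k : ℝ) ^ 2)⁻¹ ≤ 2 := by
  have hsub : T ⊆ Finset.Ioo 0 (T.sup id + 1) := fun k hk => by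
    rw [Finset.mem_Ioo]
    have : k ≤ T.sup id := Finset.le_sup (f := id) hk
    have : k ≠ 0 := fun h => h0 (h ▸ hk)
    omega
  refine (Finset.sum_le_sum_of_subset_of_nonneg hsub fun _ _ _ => by positivity).trans ?_
  refine (sum_Ioo_inv_sq_le 0 _).trans (by norm_num)

lemma sum_int_inv_sq_le_four (T : Finset ℤ) (h0 : 0 ∉ T) : ∑ k ∈ T, ((k : ℝ) ^ 2)⁻¹ ≤ 4 := by
  rw [← Finset.sum_filter_add_sum_filter_not T (fun k => 0 < k)]
  have key : ∀ S ⊆ T, (∀ a ∈ S, ∀ b ∈ S, a.natAbs = b.natAbs → a = b) →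
      ∑ k ∈ S, ((k : ℝ) ^ 2)⁻¹ ≤ 2 := by
    intro S hS hinj
    have h1 : ∑ k ∈ S, ((k : ℝ) ^ 2)⁻¹ = ∑ n ∈ S.image Int.natAbs, ((n : ℝ) ^ 2)⁻¹ := by
      rw [Finset.sum_image hinj]
      refine Finset.sum_congr rfl fun k _ => ?_
      rw [Nat.cast_natAbs, Int.cast_abs, sq_abs]
    rw [h1]
    refine sum_inv_sq_le_two _ fun h => ?_
    obtain ⟨k, hk, hk0⟩ := Finset.mem_image.1 h
    exact h0 (Int.natAbs_eq_zero.1 hk0 ▸ hS hk)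
  have h1 := key _ (Finset.filter_subset (fun k => 0 < k) T) fun a ha b hb h => by
    have := (Finset.mem_filter.1 ha).2
    have := (Finset.mem_filter.1 hb).2
    omega
  have h2 := key _ (Finset.filter_subset (fun k => ¬ 0 < k) T) fun a ha b hb h => by
    have := (Finset.mem_filter.1 ha).2
    have := (Finset.mem_filter.1 hb).2
    omega
  linarith

lemma sum_norm_geom_sum_sq_le {ι : Type*} (s : Finset ι) (α : ι → ℝ) {R : ℝ} (hR : 0 < R)
    (hsp : ∀ i ∈ s, ∀ j ∈ s, i ≠ j → ∀ m : ℤ, 1 ≤ R * |α i - α j - m|) (K : ℕ) {r : ι}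
    (hr : r ∈ s) :
    ∑ i ∈ s, ‖∑ j ∈ Finset.range K, expTwoPi (α r - α i) ^ j‖ ^ 2 ≤ K ^ 2 + 4 * R ^ 2 := by
  rw [← Finset.add_sum_erase s _ hr]
  refine add_le_add (pow_le_pow_left₀ (norm_nonneg _) (norm_geom_sum_expTwoPi_le K _) 2) ?_
  set β : ι → ℝ := fun i => α r - α i - round (α r - α i) with hβ
  set k : ι → ℤ := fun i => ⌊R * β i⌋ with hk
  have hβ1 : ∀ i ∈ s.erase r, 1 ≤ R * |β i| := fun i hi =>
    hsp r hr i (Finset.mem_of_mem_erase hi) (Finset.ne_of_mem_erase hi).symm _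
  have hkle : ∀ i, (k i : ℝ) ≤ R * β i := fun i => Int.floor_le _
  have hklt : ∀ i, R * β i < k i + 1 := fun i => Int.lt_floor_add_one _
  have habs : ∀ i, R * |β i| = |R * β i| := fun i => by rw [abs_mul, abs_of_pos hR]
  have hk0 : ∀ i ∈ s.erase r, k i ≠ 0 := by
    intro i hi h
    have h1 := hkle i
    have h2 := hklt i
    have h3 := hβ1 i hi
    rw [h, Int.cast_zero] at h1 h2
    rw [habs, abs_of_nonneg h1] at h3
    linarith
  have hkabs : ∀ i ∈ s.erase r, |(k i : ℝ)| ≤ 2 * (R * |β i|) := by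
    intro i hi
    have h1 := hkle i
    have h2 := hklt i
    have h3 := hβ1 i hi
    rw [habs] at h3 ⊢
    rw [abs_le]
    have h4 := le_abs_self (R * β i)
    have h5 := neg_abs_le (R * β i)
    constructor <;> linarith
  have hinj : ∀ i ∈ s.erase r, ∀ j ∈ s.erase r, k i = k j → i = j := by
    intro i hi j hj hij
    by_contra hne
    have h1 := hsp i (Finset.mem_of_mem_erase hi) j (Finset.mem_of_mem_erase hj) hne
      (round (α r - α j) - round (α r - α i))
    have h2 : α i - α j - ((round (α r - α j) - round (α r - α i) : ℤ) : ℝ) = β j - β i := by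
      simp only [hβ]; push_cast; ring
    rw [h2, ← abs_of_pos hR, ← abs_mul] at h1
    have hij' : (k i : ℝ) = k j := by exact_mod_cast hij
    have : |R * (β j - β i)| < 1 := by
      rw [abs_lt]
      constructor <;> nlinarith [hkle i, hkle j, hklt i, hklt j]
    linarith
  have hterm : ∀ i ∈ s.erase r, ‖∑ j ∈ Finset.range K, expTwoPi (α r - α i) ^ j‖ ^ 2 ≤
      R ^ 2 * ((k i : ℝ) ^ 2)⁻¹ := by
    intro i hi
    have h1 := norm_geom_sum_expTwoPi_mul_le K (β := β i) (abs_sub_round _)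
    rw [hβ] at h1
    simp only [expTwoPi_sub_int] at h1
    have hk2 : 0 < |(k i : ℝ)| := abs_pos.2 (by exact_mod_cast hk0 i hi)
    have h2 := hkabs i hi
    simp only [hβ] at h2
    set D := ‖∑ j ∈ Finset.range K, expTwoPi (α r - α i) ^ j‖ with hD
    have hD0 : 0 ≤ D := norm_nonneg _
    have h3 : D * |(k i : ℝ)| ≤ R := by
      calc _ ≤ D * (2 * (R * |α r - α i - round (α r - α i)|)) := by gcongr
        _ = R * (D * (2 * |α r - α i - round (α r - α i)|)) := by ring
        _ ≤ R * 1 := by gcongr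
        _ = R := mul_one R
    rw [← div_eq_mul_inv, ← sq_abs (k i : ℝ), le_div_iff₀ (by positivity), ← mul_pow]
    gcongr
  refine (Finset.sum_le_sum hterm).trans ?_
  rw [← Finset.mul_sum]
  have h4 : ∑ i ∈ s.erase r, ((k i : ℝ) ^ 2)⁻¹ ≤ 4 := by
    rw [← Finset.sum_image (f := fun n : ℤ => ((n : ℝ) ^ 2)⁻¹) hinj]
    refine sum_int_inv_sq_le_four _ fun h => ?_
    obtain ⟨i, hi, h⟩ := Finset.mem_image.1 h
    exact hk0 i hi h
  nlinarith [sq_nonneg R]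

lemma mul_sum_range_le (g : ℤ → ℝ) (hg : ∀ n, 0 ≤ g n) (N : ℕ) :
    N * ∑ n ∈ Finset.range N, g n ≤
      ∑ k ∈ Finset.range (2 * N), ∑ j ∈ Finset.range (2 * N), g ((j : ℤ) - k) := by
  calc N * ∑ n ∈ Finset.range N, g n
      = ∑ k ∈ Finset.range N, ∑ j ∈ Finset.Ico k (k + N), g ((j : ℤ) - k) := by
        have : ∀ k ∈ Finset.range N, ∑ j ∈ Finset.Ico k (k + N), g ((j : ℤ) - k) =
            ∑ n ∈ Finset.range N, g n := fun k _ => by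
          rw [Finset.sum_Ico_eq_sum_range, Nat.add_sub_cancel_left]
          refine Finset.sum_congr rfl fun n _ => ?_
          push_cast; congr 1; ring
        rw [Finset.sum_congr rfl this]; simp
    _ ≤ ∑ k ∈ Finset.range N, ∑ j ∈ Finset.range (2 * N), g ((j : ℤ) - k) := by
        refine Finset.sum_le_sum fun k hk => ?_
        refine Finset.sum_le_sum_of_subset_of_nonneg (fun j hj => ?_) fun _ _ _ => hg _
        rw [Finset.mem_range] at *
        rw [Finset.mem_Ico] at hj
        omega
    _ ≤ _ := by
        refine Finset.sum_le_sum_of_subset_of_nonneg (fun j hj => ?_)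
          fun _ _ _ => Finset.sum_nonneg fun _ _ => hg _
        rw [Finset.mem_range] at *
        omega

lemma sum_sum_norm_sq_eq {ι : Type*} (s : Finset ι) (α : ι → ℝ) (b : ι → ℂ) (K : ℕ) :
    ((∑ k ∈ Finset.range K, ∑ j ∈ Finset.range K,
      ‖∑ i ∈ s, b i * expTwoPi (α i) ^ ((j : ℤ) - k)‖ ^ 2 : ℝ) : ℂ) =
    ∑ r ∈ s, ∑ i ∈ s, b r * (starRingEnd ℂ) (b i) *
      ((‖∑ j ∈ Finset.range K, expTwoPi (α r - α i) ^ j‖ ^ 2 : ℝ) : ℂ) := by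
  have hconj : ∀ β : ℝ, (starRingEnd ℂ) (expTwoPi β) = (expTwoPi β)⁻¹ := fun β => by
    rw [Complex.inv_def, Complex.normSq_eq_norm_sq, norm_expTwoPi]; simp
  have h1 : ∀ k j : ℕ, ((‖∑ i ∈ s, b i * expTwoPi (α i) ^ ((j : ℤ) - k)‖ ^ 2 : ℝ) : ℂ) =
      ∑ r ∈ s, ∑ i ∈ s, b r * (starRingEnd ℂ) (b i) *
        (expTwoPi (α r - α i) ^ j * (starRingEnd ℂ) (expTwoPi (α r - α i)) ^ k) := by
    intro k j
    rw [← Complex.normSq_eq_norm_sq, ← Complex.mul_conj, map_sum, Finset.sum_mul_sum]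
    refine Finset.sum_congr rfl fun r _ => Finset.sum_congr rfl fun i _ => ?_
    rw [map_mul, map_zpow₀, hconj, hconj, ← expTwoPi_mul_conj, hconj,
      zpow_sub₀ (expTwoPi_ne_zero _), zpow_sub₀ (inv_ne_zero (expTwoPi_ne_zero _)),
      zpow_natCast, zpow_natCast, zpow_natCast, zpow_natCast]
    have := expTwoPi_ne_zero (α i)
    have := expTwoPi_ne_zero (α r)
    simp only [mul_pow, inv_pow, mul_inv, inv_inv]
    field_simp
  have h2 : ∀ β : ℝ, ((‖∑ j ∈ Finset.range K, expTwoPi β ^ j‖ ^ 2 : ℝ) : ℂ) =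
      ∑ k ∈ Finset.range K, ∑ j ∈ Finset.range K,
        expTwoPi β ^ j * (starRingEnd ℂ) (expTwoPi β) ^ k := by
    intro β
    rw [← Complex.normSq_eq_norm_sq, ← Complex.mul_conj, map_sum, Finset.sum_mul_sum,
      Finset.sum_comm]
    simp
  rw [Complex.ofReal_sum]
  simp_rw [Complex.ofReal_sum, h1, h2]
  simp_rw [Finset.mul_sum]
  rw [Finset.sum_congr rfl fun k _ => Finset.sum_comm, Finset.sum_comm]
  refine Finset.sum_congr rfl fun r _ => ?_
  rw [Finset.sum_congr rfl fun k _ => Finset.sum_comm, Finset.sum_comm]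

/-- The dual large sieve inequality at well-spaced points. -/
lemma dual_large_sieve {ι : Type*} (s : Finset ι) (α : ι → ℝ) {R : ℝ} (hR : 0 < R)
    (hsp : ∀ i ∈ s, ∀ j ∈ s, i ≠ j → ∀ m : ℤ, 1 ≤ R * |α i - α j - m|) (b : ι → ℂ) (N : ℕ) :
    N * ∑ n ∈ Finset.range N, ‖∑ i ∈ s, b i * expTwoPi (α i) ^ n‖ ^ 2 ≤
      4 * (N ^ 2 + R ^ 2) * ∑ i ∈ s, ‖b i‖ ^ 2 := by
  have h1 := mul_sum_range_le (fun n => ‖∑ i ∈ s, b i * expTwoPi (α i) ^ n‖ ^ 2)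
    (fun _ => by positivity) N
  simp only [zpow_natCast] at h1
  refine h1.trans ?_
  have h2 := sum_sum_norm_sq_eq s α b (2 * N)
  set X := ∑ k ∈ Finset.range (2 * N), ∑ j ∈ Finset.range (2 * N),
      ‖∑ i ∈ s, b i * expTwoPi (α i) ^ ((j : ℤ) - k)‖ ^ 2 with hX
  have hX0 : 0 ≤ X := Finset.sum_nonneg fun _ _ => Finset.sum_nonneg fun _ _ => by positivity
  set D : ι → ι → ℝ := fun r i => ‖∑ j ∈ Finset.range (2 * N), expTwoPi (α r - α i) ^ j‖ ^ 2 with hD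
  have hD0 : ∀ r i, 0 ≤ D r i := fun _ _ => by positivity
  have hsymm : ∀ r i, D r i = D i r := by
    intro r i
    simp only [hD]
    congr 1
    rw [← Complex.norm_conj, map_sum]
    congr 1
    refine Finset.sum_congr rfl fun j _ => ?_
    rw [map_pow, ← expTwoPi_mul_conj, ← expTwoPi_mul_conj, map_mul, Complex.conj_conj, mul_comm]
  have h3 : X ≤ ∑ r ∈ s, ∑ i ∈ s, ‖b r‖ * ‖b i‖ * D r i := by
    have : X = ‖(X : ℂ)‖ := by rw [Complex.norm_real, Real.norm_of_nonneg hX0]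
    rw [this, h2]
    refine norm_sum_le_of_le _ fun r _ => norm_sum_le_of_le _ fun i _ => ?_
    rw [norm_mul, norm_mul, Complex.norm_conj, Complex.norm_real, Real.norm_of_nonneg (hD0 r i)]
  have h4 : ∑ r ∈ s, ∑ i ∈ s, ‖b r‖ * ‖b i‖ * D r i ≤
      ∑ r ∈ s, ∑ i ∈ s, (‖b r‖ ^ 2 * D r i + ‖b i‖ ^ 2 * D i r) / 2 := by
    refine Finset.sum_le_sum fun r _ => Finset.sum_le_sum fun i _ => ?_
    rw [hsymm i r]
    nlinarith [hD0 r i, mul_nonneg (sq_nonneg (‖b r‖ - ‖b i‖)) (hD0 r i)]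
  have h5 : ∑ r ∈ s, ∑ i ∈ s, (‖b r‖ ^ 2 * D r i + ‖b i‖ ^ 2 * D i r) / 2 =
      ∑ r ∈ s, ‖b r‖ ^ 2 * ∑ i ∈ s, D r i := by
    simp_rw [← Finset.sum_div, Finset.sum_add_distrib]
    rw [Finset.sum_comm (f := fun r i => ‖b i‖ ^ 2 * D i r)]
    simp_rw [Finset.mul_sum]
    ring
  refine h3.trans (h4.trans (h5.le.trans ?_))
  rw [Finset.mul_sum]
  refine Finset.sum_le_sum fun r hr => ?_
  have := sum_norm_geom_sum_sq_le s α hR hsp (2 * N) hr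
  rw [mul_comm]
  refine mul_le_mul_of_nonneg_right (this.trans (le_of_eq ?_)) (by positivity)
  push_cast; ring

lemma sum_mul_norm_sq_le_of_dual {ι κ : Type*} (s : Finset ι) (t : Finset κ) (z : ι → κ → ℂ)
    {Δ : ℝ} (hΔ : 0 ≤ Δ) (h : ∀ b : ι → ℂ, ∑ n ∈ t, ‖∑ i ∈ s, b i * z i n‖ ^ 2 ≤ Δ * ∑ i ∈ s, ‖b i‖ ^ 2)
    (a : κ → ℂ) : ∑ i ∈ s, ‖∑ n ∈ t, a n * z i n‖ ^ 2 ≤ Δ * ∑ n ∈ t, ‖a n‖ ^ 2 := by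
  set b : ι → ℂ := fun i => (starRingEnd ℂ) (∑ n ∈ t, a n * z i n) with hb
  set X := ∑ i ∈ s, ‖∑ n ∈ t, a n * z i n‖ ^ 2 with hX
  have hX0 : 0 ≤ X := Finset.sum_nonneg fun _ _ => by positivity
  have h1 : (X : ℂ) = ∑ n ∈ t, a n * ∑ i ∈ s, b i * z i n := by
    simp_rw [Finset.mul_sum]
    rw [Finset.sum_comm, hX, Complex.ofReal_sum]
    refine Finset.sum_congr rfl fun i _ => ?_
    rw [← Complex.normSq_eq_norm_sq, ← Complex.mul_conj, mul_comm]
    rw [Finset.mul_sum]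
    refine Finset.sum_congr rfl fun n _ => ?_
    simp only [hb]; ring
  have h2 : X ≤ ∑ n ∈ t, ‖a n‖ * ‖∑ i ∈ s, b i * z i n‖ := by
    have : X = ‖(X : ℂ)‖ := by rw [Complex.norm_real, Real.norm_of_nonneg hX0]
    rw [this, h1]
    exact norm_sum_le_of_le _ fun n _ => (norm_mul _ _).le
  have h3 : X ^ 2 ≤ (∑ n ∈ t, ‖a n‖ ^ 2) * (Δ * X) := by
    have hbX : ∑ i ∈ s, ‖b i‖ ^ 2 = X := by simp only [hb, Complex.norm_conj, hX]
    calc X ^ 2 ≤ (∑ n ∈ t, ‖a n‖ * ‖∑ i ∈ s, b i * z i n‖) ^ 2 := by gcongr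
      _ ≤ (∑ n ∈ t, ‖a n‖ ^ 2) * ∑ n ∈ t, ‖∑ i ∈ s, b i * z i n‖ ^ 2 :=
          Finset.sum_mul_sq_le_sq_mul_sq _ _ _
      _ ≤ (∑ n ∈ t, ‖a n‖ ^ 2) * (Δ * X) := by
          rw [← hbX]
          exact mul_le_mul_of_nonneg_left (h b) (Finset.sum_nonneg fun _ _ => by positivity)
  rcases hX0.eq_or_lt with h0 | h0
  · rw [← h0]
    exact mul_nonneg hΔ (Finset.sum_nonneg fun _ _ => by positivity)
  · refine le_of_mul_le_mul_right ?_ h0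
    calc X * X = X ^ 2 := by ring
      _ ≤ _ := h3
      _ = _ := by ring


lemma spaced_fractions {Q : ℕ} {q a q' a' : ℕ} (hq : 0 < q) (hq' : 0 < q') (hqQ : q ≤ Q)
    (hqQ' : q' ≤ Q) (ha : a < q) (ha' : a' < q') (hc : a.Coprime q) (hc' : a'.Coprime q')
    (hne : (q, a) ≠ (q', a')) (m : ℤ) :
    1 ≤ (Q : ℝ) ^ 2 * |-((a : ℝ) / q) - -((a' : ℝ) / q') - m| := by
  have hq0 : (0 : ℝ) < q := by exact_mod_cast hq
  have hq0' : (0 : ℝ) < q' := by exact_mod_cast hq'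
  set z : ℤ := (a' * q - a * q' - m * (q * q') : ℤ) with hz
  have h1 : -((a : ℝ) / q) - -((a' : ℝ) / q') - m = z / (q * q') := by
    rw [hz]; push_cast; field_simp; ring
  have hz0 : z ≠ 0 := by
    intro h0
    apply hne
    have hd1 : q ∣ q' := by
      have : (q : ℤ) ∣ a * q' := ⟨a' - m * q', by linear_combination -h0 - hz⟩
      exact hc.symm.dvd_of_dvd_mul_left (by exact_mod_cast this)
    have hd2 : q' ∣ q := by
      have : (q' : ℤ) ∣ a' * q := ⟨a + m * q, by linear_combination h0 + hz⟩
      exact hc'.symm.dvd_of_dvd_mul_left (by exact_mod_cast this)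
    obtain rfl := Nat.dvd_antisymm hd1 hd2
    have hq0 : (q : ℤ) ≠ 0 := by omega
    have h2 : (a' : ℤ) - a = m * q := by
      apply mul_right_cancel₀ hq0
      linear_combination h0 + hz
    have h3 : (a : ℤ) ≡ a' [ZMOD q] := (Int.modEq_iff_dvd).2 ⟨m, by rw [h2]; ring⟩
    have h4 : a ≡ a' [MOD q] := by exact_mod_cast h3
    rw [Nat.ModEq.eq_of_lt_of_lt h4 ha ha']
  have hz1 : (1 : ℝ) ≤ |(z : ℝ)| := by exact_mod_cast Int.one_le_abs hz0
  have hqq : (q : ℝ) * q' ≤ Q ^ 2 := by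
    have e1 : (q : ℝ) ≤ Q := by exact_mod_cast hqQ
    have e2 : (q' : ℝ) ≤ Q := by exact_mod_cast hqQ'
    rw [sq]; gcongr
  rw [h1, abs_div, abs_of_pos (by positivity : (0 : ℝ) < q * q'), ← mul_div_assoc,
    one_le_div (by positivity)]
  calc (q : ℝ) * q' ≤ Q ^ 2 * 1 := by rw [mul_one]; exact hqq
    _ ≤ _ := by gcongr

/-- The additive large sieve at Farey fractions. -/
lemma large_sieve_fractions (Q N : ℕ) (a : ℕ → ℂ) :
    ∑ q ∈ Finset.Icc 1 Q, ∑ u ∈ (Finset.range q).filter (fun u => u.Coprime q),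
      ‖∑ n ∈ Finset.range N, a n * expTwoPi (-((u : ℝ) / q)) ^ n‖ ^ 2 ≤
      8 * (N + Q ^ 2) * ∑ n ∈ Finset.range N, ‖a n‖ ^ 2 := by
  rcases Nat.eq_zero_or_pos Q with rfl | hQ
  · simp; positivity
  rw [Finset.sum_sigma']
  refine sum_mul_norm_sq_le_of_dual _ _ _ (by positivity) (fun b => ?_) a
  set s := (Finset.Icc 1 Q).sigma fun q => (Finset.range q).filter (fun u => u.Coprime q) with hs
  have hQ0 : (0 : ℝ) < (Q : ℝ) ^ 2 := by positivity
  have hsp : ∀ i ∈ s, ∀ j ∈ s, i ≠ j → ∀ m : ℤ,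
      1 ≤ (Q : ℝ) ^ 2 * |-((i.2 : ℝ) / i.1) - -((j.2 : ℝ) / j.1) - m| := by
    rintro ⟨q, u⟩ hi ⟨q', u'⟩ hj hij m
    simp only [hs, Finset.mem_sigma, Finset.mem_Icc, Finset.mem_filter, Finset.mem_range] at hi hj
    refine spaced_fractions (by omega) (by omega) hi.1.2 hj.1.2 hi.2.1 hj.2.1 hi.2.2 hj.2.2
      (fun h => hij ?_) m
    rw [Prod.mk.injEq] at h
    rw [h.1, h.2]
  set M := max N (Q ^ 2) with hM
  have hMpos : 0 < M := lt_of_lt_of_le (by positivity) (le_max_right _ _)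
  have hM0 : (0 : ℝ) < M := by exact_mod_cast hMpos
  have key := dual_large_sieve s (fun i => -((i.2 : ℝ) / i.1)) hQ0 hsp b M
  have hQM : (Q : ℝ) ^ 2 ≤ M := by exact_mod_cast le_max_right N (Q ^ 2)
  have hMle : (M : ℝ) ≤ N + Q ^ 2 := by
    have : M ≤ N + Q ^ 2 := max_le (by omega) (by omega)
    exact_mod_cast this
  have hb0 : 0 ≤ ∑ i ∈ s, ‖b i‖ ^ 2 := Finset.sum_nonneg fun _ _ => by positivity
  have h1 : ∑ n ∈ Finset.range N, ‖∑ i ∈ s, b i * expTwoPi (-((i.2 : ℝ) / i.1)) ^ n‖ ^ 2 ≤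
      ∑ n ∈ Finset.range M, ‖∑ i ∈ s, b i * expTwoPi (-((i.2 : ℝ) / i.1)) ^ n‖ ^ 2 :=
    Finset.sum_le_sum_of_subset_of_nonneg (Finset.range_mono (le_max_left _ _))
      fun _ _ _ => by positivity
  refine h1.trans ?_
  have h2 : 4 * ((M : ℝ) ^ 2 + ((Q : ℝ) ^ 2) ^ 2) ≤ M * (8 * M) := by nlinarith
  have h3 : M * ∑ n ∈ Finset.range M, ‖∑ i ∈ s, b i * expTwoPi (-((i.2 : ℝ) / i.1)) ^ n‖ ^ 2 ≤
      M * (8 * M * ∑ i ∈ s, ‖b i‖ ^ 2) := by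
    refine key.trans ?_
    rw [← mul_assoc]
    exact mul_le_mul_of_nonneg_right h2 hb0
  refine (le_of_mul_le_mul_left h3 hM0).trans ?_
  gcongr

lemma sum_norm_sq_sum_char {q : ℕ} [NeZero q] (f : ZMod q → ℂ) :
    ∑ χ : DirichletCharacter ℂ q, ‖∑ j, χ j * f j‖ ^ 2 =
      q.totient * ∑ j ∈ Finset.univ.filter (fun j : ZMod q => IsUnit j), ‖f j‖ ^ 2 := by
  have h : ((∑ χ : DirichletCharacter ℂ q, ‖∑ j, χ j * f j‖ ^ 2 : ℝ) : ℂ) =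
      ((q.totient * ∑ j ∈ Finset.univ.filter (fun j : ZMod q => IsUnit j), ‖f j‖ ^ 2 : ℝ) : ℂ) := by
    have h1 : ∀ χ : DirichletCharacter ℂ q, ((‖∑ j, χ j * f j‖ ^ 2 : ℝ) : ℂ) =
        ∑ i, ∑ j, (f i * (starRingEnd ℂ) (f j)) * (χ i * (starRingEnd ℂ) (χ j)) := by
      intro χ
      rw [← Complex.normSq_eq_norm_sq, ← Complex.mul_conj, map_sum, Finset.sum_mul_sum]
      refine Finset.sum_congr rfl fun i _ => Finset.sum_congr rfl fun j _ => ?_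
      rw [map_mul]; ring
    have h2 : ∀ i j : ZMod q, ∑ χ : DirichletCharacter ℂ q, χ i * (starRingEnd ℂ) (χ j) =
        if IsUnit j ∧ j = i then (q.totient : ℂ) else 0 := by
      intro i j
      by_cases hj : IsUnit j
      · have h3 := DirichletCharacter.sum_char_inv_mul_char_eq ℂ hj i
        simp only [hj, true_and]
        rw [← h3]
        refine Finset.sum_congr rfl fun χ _ => ?_
        rw [mul_comm]
        congr 1
        have h4 := MulChar.star_apply' χ j
        rw [Complex.star_def] at h4
        rw [h4, MulChar.inv_apply_eq_inv']
        have h5 : χ j⁻¹ * χ j = 1 := by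
          rw [← map_mul, ZMod.inv_mul_of_unit j hj, map_one]
        exact (eq_inv_of_mul_eq_one_left h5).symm
      · simp only [hj, false_and, if_false]
        refine Finset.sum_eq_zero fun χ _ => ?_
        rw [MulChar.map_nonunit χ hj, map_zero, mul_zero]
    rw [Complex.ofReal_sum]
    simp_rw [h1]
    rw [Finset.sum_comm]
    have h3 : ∀ i : ZMod q, ∑ χ : DirichletCharacter ℂ q,
        ∑ j, (f i * (starRingEnd ℂ) (f j)) * (χ i * (starRingEnd ℂ) (χ j)) =
        if IsUnit i then (q.totient : ℂ) * ((‖f i‖ ^ 2 : ℝ) : ℂ) else 0 := by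
      intro i
      rw [Finset.sum_comm]
      simp_rw [← Finset.mul_sum, h2]
      rw [Finset.sum_eq_single i]
      · split_ifs with h4 h5 h5
        · rw [Complex.mul_conj, Complex.normSq_eq_norm_sq, mul_comm]
        · exact absurd h4.1 h5
        · exact absurd ⟨h5, rfl⟩ h4
        · rw [mul_zero]
      · intro j _ hj
        rw [if_neg (fun h => hj h.2), mul_zero]
      · simp
    rw [Finset.sum_congr rfl fun i _ => h3 i, ← Finset.sum_filter]
    push_cast
    rw [Finset.mul_sum]
  exact_mod_cast h

open ZMod in
lemma norm_gaussSum_sq {q : ℕ} [NeZero q] {χ : DirichletCharacter ℂ q} (hχ : χ.IsPrimitive) :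
    ‖gaussSum χ stdAddChar‖ ^ 2 = q := by
  have h1 := congrFun (dft_dft (χ : ZMod q → ℂ)) (-1)
  have h2 : dft (χ : ZMod q → ℂ) = fun k => gaussSum χ stdAddChar * χ⁻¹ (-k) := by
    ext k
    rw [hχ.fourierTransform_eq_inv_mul_gaussSum, mul_comm]
  rw [h2, dft_const_mul, dft_comp_neg (fun k => χ⁻¹ k)] at h1
  simp only [neg_neg, map_one, smul_eq_mul, mul_one] at h1
  rw [DirichletCharacter.fourierTransform_eq_gaussSum_mulShift] at h1
  have h3 : (stdAddChar (N := q)).mulShift (-1) = (stdAddChar (N := q))⁻¹ := by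
    ext x
    rw [AddChar.mulShift_apply, AddChar.inv_apply, neg_one_mul]
  rw [h3, ← star_gaussSum_eq, Complex.star_def, Complex.mul_conj, Complex.normSq_eq_norm_sq] at h1
  exact_mod_cast h1

lemma stdAddChar_neg_natCast_mul {q : ℕ} [NeZero q] (j : ZMod q) (n : ℕ) :
    ZMod.stdAddChar (-(j * (n : ZMod q))) = expTwoPi (-((j.val : ℝ) / q)) ^ n := by
  have : -(j * (n : ZMod q)) = ((-(j.val * n : ℕ) : ℤ) : ZMod q) := by push_cast; simp
  rw [this, ZMod.stdAddChar_coe, expTwoPi, ← Complex.exp_nat_mul]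
  congr 1
  push_cast
  ring

open ZMod in
lemma sum_primitive_norm_sq_le (q : ℕ) [NeZero q] (N : ℕ) (a : ℕ → ℂ) :
    q * ∑ χ ∈ Finset.univ.filter (fun χ : DirichletCharacter ℂ q => χ.IsPrimitive),
      ‖∑ n ∈ Finset.range N, a n * χ n‖ ^ 2 ≤
    q.totient * ∑ u ∈ (Finset.range q).filter (fun u => u.Coprime q),
      ‖∑ n ∈ Finset.range N, a n * expTwoPi (-((u : ℝ) / q)) ^ n‖ ^ 2 := by
  set S : ZMod q → ℂ := fun j => ∑ n ∈ Finset.range N, a n * stdAddChar (-(j * (n : ZMod q))) with hS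
  have h1 : ∀ χ : DirichletCharacter ℂ q, χ.IsPrimitive →
      ‖∑ j, χ j * S j‖ ^ 2 = q * ‖∑ n ∈ Finset.range N, a n * χ⁻¹ n‖ ^ 2 := by
    intro χ hχ
    have e1 : ∑ j, χ j * S j = χ⁻¹ (-1) * gaussSum χ stdAddChar *
        ∑ n ∈ Finset.range N, a n * χ⁻¹ n := by
      simp_rw [hS, Finset.mul_sum]
      rw [Finset.sum_comm]
      refine Finset.sum_congr rfl fun n _ => ?_
      have e2 := hχ.fourierTransform_eq_inv_mul_gaussSum (n : ZMod q)
      rw [dft_apply] at e2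
      calc _ = a n * ∑ j, stdAddChar (-(j * (n : ZMod q))) • χ j := by
            rw [Finset.mul_sum]
            refine Finset.sum_congr rfl fun j _ => ?_
            rw [smul_eq_mul]; ring
        _ = _ := by rw [e2, ← neg_one_mul (n : ZMod q), map_mul]; ring
    have e3 : ‖χ⁻¹ (-1)‖ = 1 := by
      have : χ⁻¹ (-1) * χ⁻¹ (-1) = 1 := by rw [← map_mul]; simp
      have h := congrArg norm this
      rw [norm_mul, norm_one] at h
      nlinarith [norm_nonneg (χ⁻¹ (-1))]
    rw [e1, norm_mul, norm_mul, e3, one_mul, mul_pow, norm_gaussSum_sq hχ]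
  have h2 : ∑ χ ∈ Finset.univ.filter (fun χ : DirichletCharacter ℂ q => χ.IsPrimitive),
      ‖∑ n ∈ Finset.range N, a n * χ n‖ ^ 2 =
      ∑ χ ∈ Finset.univ.filter (fun χ : DirichletCharacter ℂ q => χ.IsPrimitive),
      ‖∑ n ∈ Finset.range N, a n * χ⁻¹ n‖ ^ 2 := by
    refine Finset.sum_nbij' (fun χ => χ⁻¹) (fun χ => χ⁻¹) ?_ ?_ (by simp) (by simp) (by simp)
    all_goals
      intro χ hχ
      simp only [Finset.mem_filter, Finset.mem_univ, true_and,
        DirichletCharacter.isPrimitive_def, DirichletCharacter.conductor_inv] at hχ ⊢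
      exact hχ
  have h3 := sum_norm_sq_sum_char S
  have h4 : ∑ j ∈ Finset.univ.filter (fun j : ZMod q => IsUnit j), ‖S j‖ ^ 2 ≤
      ∑ u ∈ (Finset.range q).filter (fun u => u.Coprime q),
      ‖∑ n ∈ Finset.range N, a n * expTwoPi (-((u : ℝ) / q)) ^ n‖ ^ 2 := by
    have e1 : ∀ j : ZMod q, ‖S j‖ ^ 2 =
        ‖∑ n ∈ Finset.range N, a n * expTwoPi (-((j.val : ℝ) / q)) ^ n‖ ^ 2 := by
      intro j
      simp only [hS, stdAddChar_neg_natCast_mul]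
    rw [Finset.sum_congr rfl fun j _ => e1 j, ← Finset.sum_image (g := ZMod.val)
      (f := fun u : ℕ => ‖∑ n ∈ Finset.range N, a n * expTwoPi (-((u : ℝ) / q)) ^ n‖ ^ 2)
      (fun _ _ _ _ h => ZMod.val_injective q h)]
    refine Finset.sum_le_sum_of_subset_of_nonneg (fun u hu => ?_) fun _ _ _ => by positivity
    obtain ⟨j, hj, rfl⟩ := Finset.mem_image.1 hu
    rw [Finset.mem_filter] at hj ⊢
    refine ⟨Finset.mem_range.2 (ZMod.val_lt j), ?_⟩
    rw [← ZMod.isUnit_iff_coprime, ZMod.natCast_val, ZMod.cast_id]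
    exact hj.2
  rw [h2, Finset.mul_sum, Finset.sum_congr rfl fun χ hχ => (h1 χ (Finset.mem_filter.1 hχ).2).symm]
  refine le_trans ?_ (mul_le_mul_of_nonneg_left h4 (Nat.cast_nonneg _))
  rw [← h3]
  exact Finset.sum_le_sum_of_subset_of_nonneg (Finset.filter_subset _ _) fun _ _ _ => by positivity

/-- The large sieve inequality for primitive characters. -/
theorem large_sieve (Q N : ℕ) (a : ℕ → ℂ) :
    ∑ q ∈ Finset.Icc 1 Q, (q / q.totient : ℝ) *
      ∑ χ ∈ Finset.univ.filter (fun χ : DirichletCharacter ℂ q => χ.IsPrimitive),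
        ‖∑ n ∈ Finset.range N, a n * χ n‖ ^ 2 ≤
      8 * (N + Q ^ 2) * ∑ n ∈ Finset.range N, ‖a n‖ ^ 2 := by
  refine le_trans (Finset.sum_le_sum fun q hq => ?_) (large_sieve_fractions Q N a)
  have hq0 : 0 < q := (Finset.mem_Icc.1 hq).1
  have : NeZero q := ⟨hq0.ne'⟩
  have hφ : (0 : ℝ) < q.totient := by exact_mod_cast Nat.totient_pos.2 hq0
  rw [div_mul_eq_mul_div, div_le_iff₀ hφ, mul_comm _ (q.totient : ℝ)]
  exact sum_primitive_norm_sq_le q N a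

lemma sum_norm_mul_norm_le_large_sieve (Q M N : ℕ) (α β : ℕ → ℂ) :
    ∑ q ∈ Finset.Icc 1 Q, (q / q.totient : ℝ) *
      ∑ χ ∈ Finset.univ.filter (fun χ : DirichletCharacter ℂ q => χ.IsPrimitive),
        ‖∑ m ∈ Finset.range M, α m * χ m‖ * ‖∑ n ∈ Finset.range N, β n * χ n‖ ≤
      8 * (√((M + Q ^ 2) * (N + Q ^ 2)) *
        √((∑ m ∈ Finset.range M, ‖α m‖ ^ 2) * ∑ n ∈ Finset.range N, ‖β n‖ ^ 2)) := by
  have h1 : ∀ q ∈ Finset.Icc 1 Q, (q / q.totient : ℝ) *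
      ∑ χ ∈ Finset.univ.filter (fun χ : DirichletCharacter ℂ q => χ.IsPrimitive),
        ‖∑ m ∈ Finset.range M, α m * χ m‖ * ‖∑ n ∈ Finset.range N, β n * χ n‖ ≤
      √((q / q.totient : ℝ) *
        ∑ χ ∈ Finset.univ.filter (fun χ : DirichletCharacter ℂ q => χ.IsPrimitive),
        ‖∑ m ∈ Finset.range M, α m * χ m‖ ^ 2) * √((q / q.totient : ℝ) *
        ∑ χ ∈ Finset.univ.filter (fun χ : DirichletCharacter ℂ q => χ.IsPrimitive),
        ‖∑ n ∈ Finset.range N, β n * χ n‖ ^ 2) := by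
    intro q _
    have hc : (0 : ℝ) ≤ q / q.totient := by positivity
    rw [Real.sqrt_mul hc, Real.sqrt_mul hc, mul_mul_mul_comm, Real.mul_self_sqrt hc]
    exact mul_le_mul_of_nonneg_left (Real.sum_mul_le_sqrt_mul_sqrt _ _ _) hc
  refine (Finset.sum_le_sum h1).trans
    ((Real.sum_sqrt_mul_sqrt_le _ (fun _ => by positivity) fun _ => by positivity).trans ?_)
  refine (mul_le_mul (Real.sqrt_le_sqrt (large_sieve Q M α))
    (Real.sqrt_le_sqrt (large_sieve Q N β)) (Real.sqrt_nonneg _) (Real.sqrt_nonneg _)).trans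
    (le_of_eq ?_)
  rw [← Real.sqrt_mul (by positivity), ← Real.sqrt_mul (by positivity),
    show (8 : ℝ) = √(8 ^ 2) by rw [Real.sqrt_sq (by norm_num)],
    ← Real.sqrt_mul (by positivity), Real.sqrt_sq (by norm_num)]
  congr 1
  ring

/-- The kernel in the separation of variables for bilinear sums. -/
lemma integrable_cpow_mul_lineKernel {u : ℝ} (hu : 0 < u) :
    Integrable fun t : ℝ => (u : ℂ) ^ (-(((1 / 2 : ℝ) : ℂ) + t * I)) * lineKernel (1 / 2) t := by
  refine Integrable.bdd_mul (c := u ^ (-(1 / 2) : ℝ)) (integrable_lineKernel le_rfl) ?_ ?_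
  · refine Continuous.aestronglyMeasurable ?_
    exact Continuous.const_cpow (by fun_prop) (Or.inl (by exact_mod_cast hu.ne'))
  · refine Eventually.of_forall fun t => le_of_eq ?_
    rw [Complex.norm_cpow_eq_rpow_re_of_pos hu]
    simp

lemma bilinear_integrand_eq {q : ℕ} (χ : DirichletCharacter ℂ q) (M N : ℕ) (α β : ℕ → ℂ)
    {x : ℝ} (hx : 0 < x) (s k : ℂ) :
    ∑ m ∈ Finset.range M, ∑ n ∈ Finset.range N, α m * β n * (χ m * χ n) *
      ((((m * n : ℕ) / x : ℝ) : ℂ) ^ (-s) * k) =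
    (∑ m ∈ Finset.range M, α m * (m : ℂ) ^ (-s) * χ m) *
      (∑ n ∈ Finset.range N, β n * (n : ℂ) ^ (-s) * χ n) * ((x : ℂ) ^ s * k) := by
  rw [Finset.sum_mul_sum, Finset.sum_mul]
  refine Finset.sum_congr rfl fun m _ => ?_
  rw [Finset.sum_mul]
  refine Finset.sum_congr rfl fun n _ => ?_
  rw [div_cpow_neg hx, Nat.cast_mul, Complex.natCast_mul_natCast_cpow, Complex.cpow_neg,
    Complex.cpow_neg, div_eq_mul_inv, mul_inv]
  ring

lemma sum_norm_sq_mul_cpow {α : ℕ → ℂ} (hα : α 0 = 0) (M : ℕ) (t : ℝ) :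
    ∑ m ∈ Finset.range M, ‖α m * (m : ℂ) ^ (-(((1 / 2 : ℝ) : ℂ) + t * I))‖ ^ 2 =
      ∑ m ∈ Finset.range M, ‖α m‖ ^ 2 / m := by
  refine Finset.sum_congr rfl fun m _ => ?_
  rcases Nat.eq_zero_or_pos m with rfl | hm
  · simp [hα]
  have hm' : (0 : ℝ) < m := by exact_mod_cast hm
  rw [norm_mul, norm_cpow_neg_nat _ hm, mul_pow, ← Real.rpow_natCast ((m : ℝ) ^ _),
    ← Real.rpow_mul hm'.le]
  simp [Real.rpow_neg_one, div_eq_mul_inv]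

/-- Bilinear form of the large sieve, with a smooth cutoff on the product of the variables. -/
theorem bilinear_large_sieve (Q M N : ℕ) {α β : ℕ → ℂ} (hα : α 0 = 0) (hβ : β 0 = 0)
    {x : ℝ} (hx : 0 < x) :
    ∑ q ∈ Finset.Icc 1 Q, (q / q.totient : ℝ) *
      ∑ χ ∈ Finset.univ.filter (fun χ : DirichletCharacter ℂ q => χ.IsPrimitive),
        ‖∑ m ∈ Finset.range M, ∑ n ∈ Finset.range N, α m * β n * (χ m * χ n) *
          ((max 0 (1 - (m * n : ℕ) / x) : ℝ) : ℂ)‖ ≤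
      16 * √x * (√((M + Q ^ 2) * (N + Q ^ 2)) *
        √((∑ m ∈ Finset.range M, ‖α m‖ ^ 2 / m) * ∑ n ∈ Finset.range N, ‖β n‖ ^ 2 / n)) := by
  have hpi := Real.pi_pos
  obtain ⟨G, hG⟩ : ∃ G : ∀ q : ℕ, DirichletCharacter ℂ q → ℝ → ℂ, G =
      fun (q : ℕ) (χ : DirichletCharacter ℂ q) (t : ℝ) =>
      ∑ m ∈ Finset.range M, ∑ n ∈ Finset.range N, α m * β n * (χ m * χ n) *
      ((((m * n : ℕ) / x : ℝ) : ℂ) ^ (-(((1 / 2 : ℝ) : ℂ) + t * I)) * lineKernel (1 / 2) t) :=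
    ⟨_, rfl⟩
  have hterm : ∀ (q : ℕ) (χ : DirichletCharacter ℂ q) (m n : ℕ), Integrable fun t : ℝ =>
      α m * β n * (χ m * χ n) *
      ((((m * n : ℕ) / x : ℝ) : ℂ) ^ (-(((1 / 2 : ℝ) : ℂ) + t * I)) * lineKernel (1 / 2) t) := by
    intro q χ m n
    rcases Nat.eq_zero_or_pos m with rfl | hm
    · simp [hα]
    rcases Nat.eq_zero_or_pos n with rfl | hn
    · simp [hβ]
    exact (integrable_cpow_mul_lineKernel (by positivity)).const_mul _
  have hGint : ∀ q χ, Integrable (G q χ) := by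
    intro q χ
    rw [hG]
    exact integrable_finsetSum _ fun m _ => integrable_finsetSum _ fun n _ => hterm q χ m n
  have hD : ∀ (q : ℕ) (χ : DirichletCharacter ℂ q),
      ∑ m ∈ Finset.range M, ∑ n ∈ Finset.range N, α m * β n * (χ m * χ n) *
          ((max 0 (1 - (m * n : ℕ) / x) : ℝ) : ℂ) = 1 / (2 * Real.pi) * ∫ t, G q χ t := by
    intro q χ
    rw [hG]
    simp only
    rw [integral_finsetSum _ fun m _ => integrable_finsetSum _ fun n _ => hterm q χ m n,
      Finset.mul_sum]
    refine Finset.sum_congr rfl fun m _ => ?_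
    rw [integral_finsetSum _ fun n _ => hterm q χ m n, Finset.mul_sum]
    refine Finset.sum_congr rfl fun n _ => ?_
    rcases Nat.eq_zero_or_pos m with rfl | hm
    · simp [hα]
    rcases Nat.eq_zero_or_pos n with rfl | hn
    · simp [hβ]
    rw [integral_const_mul, max_one_sub_eq_integral (σ := 1 / 2) le_rfl (by positivity)]
    ring
  obtain ⟨K, hK⟩ : ∃ K : ℝ, K = √((M + Q ^ 2) * (N + Q ^ 2)) *
        √((∑ m ∈ Finset.range M, ‖α m‖ ^ 2 / m) * ∑ n ∈ Finset.range N, ‖β n‖ ^ 2 / n) := ⟨_, rfl⟩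
  have hpt : ∀ t : ℝ, ∑ q ∈ Finset.Icc 1 Q, (q / q.totient : ℝ) *
      ∑ χ ∈ Finset.univ.filter (fun χ : DirichletCharacter ℂ q => χ.IsPrimitive), ‖G q χ t‖ ≤
      32 * √x * K * (1 + t ^ 2)⁻¹ := by
    intro t
    have h1 := sum_norm_mul_norm_le_large_sieve Q M N
      (fun m => α m * (m : ℂ) ^ (-(((1 / 2 : ℝ) : ℂ) + t * I)))
      (fun n => β n * (n : ℂ) ^ (-(((1 / 2 : ℝ) : ℂ) + t * I)))
    rw [sum_norm_sq_mul_cpow hα, sum_norm_sq_mul_cpow hβ, ← hK] at h1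
    have h2 : ∀ q χ, ‖G q χ t‖ =
        (‖∑ m ∈ Finset.range M, α m * (m : ℂ) ^ (-(((1 / 2 : ℝ) : ℂ) + t * I)) * χ m‖ *
        ‖∑ n ∈ Finset.range N, β n * (n : ℂ) ^ (-(((1 / 2 : ℝ) : ℂ) + t * I)) * χ n‖) *
        (√x * ‖lineKernel (1 / 2) t‖) := by
      intro q χ
      rw [hG]
      simp only
      rw [bilinear_integrand_eq χ M N α β hx, norm_mul, norm_mul, norm_mul,
        norm_ofReal_cpow_line hx, Real.sqrt_eq_rpow]
    simp_rw [h2, ← Finset.sum_mul, ← mul_assoc, ← Finset.sum_mul]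
    simp only [mul_assoc] at h1 ⊢
    have h3 := norm_lineKernel_le (σ := 1 / 2) le_rfl t
    have hK0 : 0 ≤ K := by rw [hK]; positivity
    calc _ ≤ 8 * K * (√x * ‖lineKernel (1 / 2) t‖) :=
          mul_le_mul_of_nonneg_right h1 (by positivity)
      _ ≤ 8 * K * (√x * (4 * (1 + t ^ 2)⁻¹)) := by gcongr
      _ = _ := by ring
  have hInt : ∀ q : ℕ, Integrable fun t => (q / q.totient : ℝ) *
      ∑ χ ∈ Finset.univ.filter (fun χ : DirichletCharacter ℂ q => χ.IsPrimitive), ‖G q χ t‖ :=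
    fun q => (integrable_finsetSum _ fun χ _ => (hGint q χ).norm).const_mul _
  calc _ ≤ ∑ q ∈ Finset.Icc 1 Q, (q / q.totient : ℝ) *
      ∑ χ ∈ Finset.univ.filter (fun χ : DirichletCharacter ℂ q => χ.IsPrimitive),
        1 / (2 * Real.pi) * ∫ t, ‖G q χ t‖ := by
        refine Finset.sum_le_sum fun q _ => mul_le_mul_of_nonneg_left
          (Finset.sum_le_sum fun χ _ => ?_) (by positivity)
        rw [hD, norm_mul]
        refine mul_le_mul (le_of_eq ?_) (norm_integral_le_integral_norm _) (norm_nonneg _)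
          (by positivity)
        rw [norm_div, norm_one, norm_mul, Complex.norm_real, Real.norm_of_nonneg hpi.le]
        norm_num
    _ = 1 / (2 * Real.pi) * ∫ t, ∑ q ∈ Finset.Icc 1 Q, (q / q.totient : ℝ) *
      ∑ χ ∈ Finset.univ.filter (fun χ : DirichletCharacter ℂ q => χ.IsPrimitive),
        ‖G q χ t‖ := by
        rw [integral_finsetSum _ fun q _ => hInt q, Finset.mul_sum]
        refine Finset.sum_congr rfl fun q _ => ?_
        rw [integral_const_mul, integral_finsetSum _ fun χ _ => (hGint q χ).norm,
          ← Finset.mul_sum]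
        ring
    _ ≤ 1 / (2 * Real.pi) * ∫ t : ℝ, 32 * √x * K * (1 + t ^ 2)⁻¹ := by
        refine mul_le_mul_of_nonneg_left ?_ (by positivity)
        exact integral_mono (integrable_finsetSum _ fun q _ => hInt q)
          (integrable_inv_one_add_sq.const_mul _) hpt
    _ = _ := by
        rw [integral_const_mul, integral_univ_inv_one_add_sq, hK]
        field_simp
        ring

end BombieriVinogradov

namespace BombieriVinogradov

open Complex MeasureTheory Set Filter Topology
open scoped ArithmeticFunction.zeta ArithmeticFunction.vonMangoldt ArithmeticFunction.Moebius

lemma sum_range_mul_convolution (f g : ArithmeticFunction ℝ) (c : ℕ → ℂ) {N : ℕ}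
    (hc : ∀ n, N ≤ n → c n = 0) :
    ∑ n ∈ Finset.range N, ((f * g) n : ℂ) * c n =
      ∑ m ∈ Finset.range N, ∑ n ∈ Finset.range N, (f m : ℂ) * (g n : ℂ) * c (m * n) := by
  have h1 : ∀ n ∈ Finset.range N, ((f * g) n : ℂ) * c n =
      ∑ p ∈ Finset.range N ×ˢ Finset.range N,
        if p.1 * p.2 = n then (f p.1 : ℂ) * (g p.2 : ℂ) * c n else 0 := by
    intro n hn
    rcases Nat.eq_zero_or_pos n with rfl | hn0
    · rw [ArithmeticFunction.map_zero, Complex.ofReal_zero, zero_mul]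
      refine (Finset.sum_eq_zero fun p _ => ?_).symm
      split_ifs with h
      · rcases Nat.mul_eq_zero.1 h with h | h <;> simp [h]
      · rfl
    · rw [ArithmeticFunction.mul_apply, Complex.ofReal_sum, Finset.sum_mul, ← Finset.sum_filter]
      refine Finset.sum_subset_zero_on_sdiff (fun p hp => ?_) (fun p hp => ?_) fun p _ => by
        push_cast; ring
      · obtain ⟨h, _⟩ := Nat.mem_divisorsAntidiagonal.1 hp
        have h2 : p.1 ≤ n := Nat.le_of_dvd hn0 ⟨p.2, h.symm⟩
        have h3 : p.2 ≤ n := Nat.le_of_dvd hn0 ⟨p.1, by rw [← h, mul_comm]⟩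
        have := Finset.mem_range.1 hn
        simp only [Finset.mem_filter, Finset.mem_product, Finset.mem_range]
        exact ⟨⟨by omega, by omega⟩, h⟩
      · exfalso
        simp only [Finset.mem_sdiff, Finset.mem_filter, Nat.mem_divisorsAntidiagonal] at hp
        exact hp.2 ⟨hp.1.2, hn0.ne'⟩
  rw [Finset.sum_congr rfl h1, Finset.sum_comm, Finset.sum_product]
  refine Finset.sum_congr rfl fun m _ => Finset.sum_congr rfl fun n _ => ?_
  rw [Finset.sum_ite_eq]
  split_ifs with h
  · rfl
  · rw [hc _ (by simpa using h), mul_zero]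

/-- The smooth cutoff `max (1 - n / x) 0`. -/
noncomputable def cutoff (x : ℝ) (n : ℕ) : ℝ := max 0 (1 - n / x)

lemma cutoff_nonneg (x : ℝ) (n : ℕ) : 0 ≤ cutoff x n := le_max_left _ _

lemma cutoff_le_one {x : ℝ} (hx : 0 < x) (n : ℕ) : cutoff x n ≤ 1 :=
  max_le zero_le_one (sub_le_self _ (by positivity))

lemma cutoff_eq_zero {x : ℝ} (hx : 0 < x) {n : ℕ} (h : x ≤ n) : cutoff x n = 0 :=
  max_eq_left (sub_nonpos.2 ((one_le_div hx).2 h))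

lemma cutoff_anti {x : ℝ} (hx : 0 < x) {m n : ℕ} (h : m ≤ n) : cutoff x n ≤ cutoff x m := by
  have : (m : ℝ) ≤ n := by exact_mod_cast h
  unfold cutoff
  gcongr

lemma smoothSum_eq_sum_range {a : ℕ → ℂ} (ha : a 0 = 0) {x : ℝ} (hx : 0 < x) {N : ℕ}
    (hN : ⌊x⌋₊ < N) : smoothSum a x = ∑ n ∈ Finset.range N, a n * (cutoff x n : ℂ) := by
  unfold smoothSum
  refine Finset.sum_subset_zero_on_sdiff (fun n hn => ?_) (fun n hn => ?_) fun n hn => ?_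
  · rw [Finset.mem_Icc] at hn
    exact Finset.mem_range.2 (by omega)
  · simp only [Finset.mem_sdiff, Finset.mem_range, Finset.mem_Icc, not_and, not_le] at hn
    rcases Nat.eq_zero_or_pos n with rfl | hn0
    · rw [ha, zero_mul]
    · rw [cutoff_eq_zero hx ((Nat.lt_floor_add_one x).le.trans (by exact_mod_cast hn.2 hn0)),
        Complex.ofReal_zero, mul_zero]
  · rw [cutoff, max_eq_right]
    have := (Nat.le_floor_iff hx.le).1 (Finset.mem_Icc.1 hn).2
    rw [sub_nonneg, div_le_one hx]
    exact this

lemma sum_range_le_of_support {f : ℕ → ℝ} {c : ℝ} {Y : ℕ} (h0 : f 0 = 0) (hc : 0 ≤ c)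
    (hf : ∀ n, f n ≤ c) (hY : ∀ n, Y < n → f n = 0) (N : ℕ) :
    ∑ n ∈ Finset.range N, f n ≤ Y * c := by
  calc ∑ n ∈ Finset.range N, f n ≤ ∑ n ∈ Finset.range N, if n ∈ Finset.Icc 1 Y then c else 0 := by
        refine Finset.sum_le_sum fun n _ => ?_
        split_ifs with h
        · exact hf n
        · rw [Finset.mem_Icc] at h
          rcases Nat.eq_zero_or_pos n with rfl | hn
          · exact h0.le
          · exact (hY n (by omega)).le
    _ ≤ ∑ n ∈ Finset.Icc 1 Y, c := by
        rw [← Finset.sum_filter]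
        exact Finset.sum_le_sum_of_subset_of_nonneg
          (fun n hn => (Finset.mem_filter.1 hn).2) fun _ _ _ => hc
    _ = Y * c := by simp

/-- Type I sums. -/
lemma norm_type_one_le {q : ℕ} (χ : DirichletCharacter ℂ q) (f g : ArithmeticFunction ℝ)
    {x B : ℝ} (hx : 0 < x) (N : ℕ)
    (hg : ∀ a b, ‖∑ n ∈ Finset.Ico a b, if n < N then χ n * (g n : ℂ) else 0‖ ≤ B) :
    ‖∑ m ∈ Finset.range N, ∑ n ∈ Finset.range N, (f m : ℂ) * (g n : ℂ) *
      (χ (m * n : ℕ) * (cutoff x (m * n) : ℂ))‖ ≤ B * ∑ m ∈ Finset.range N, |f m| := by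
  rw [Finset.mul_sum]
  refine norm_sum_le_of_le _ fun m _ => ?_
  have h1 : ∑ n ∈ Finset.range N, (f m : ℂ) * (g n : ℂ) *
      (χ (m * n : ℕ) * (cutoff x (m * n) : ℂ)) = (f m : ℂ) * χ m *
      ∑ n ∈ Finset.Ico 0 N, (if n < N then χ n * (g n : ℂ) else 0) * (cutoff x (m * n) : ℂ) := by
    rw [Finset.mul_sum, Finset.range_eq_Ico]
    refine Finset.sum_congr rfl fun n hn => ?_
    rw [if_pos (Finset.mem_Ico.1 hn).2]
    push_cast
    rw [map_mul]
    ring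
  have hB : 0 ≤ B := (norm_nonneg _).trans (hg 0 0)
  have h2 := norm_sum_Ico_mul_antitone_le hg (g := fun n => cutoff x (m * n)) (Nat.zero_le N)
    (cutoff_nonneg _ _) fun n _ => cutoff_anti hx (Nat.mul_le_mul_left m (Nat.le_succ n))
  rw [h1, norm_mul, norm_mul, Complex.norm_real, Real.norm_eq_abs, mul_comm B]
  refine mul_le_mul ?_ (h2.trans (mul_le_of_le_one_right hB (cutoff_le_one hx _)))
    (norm_nonneg _) (abs_nonneg _)
  exact mul_le_of_le_one_right (abs_nonneg _) (χ.norm_le_one _)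

lemma norm_sum_Ico_ite_le {f : ℕ → ℂ} {B : ℝ} {N : ℕ}
    (hf : ∀ a b, a ≤ b → b ≤ N → ‖∑ n ∈ Finset.Ico a b, f n‖ ≤ B) (a b : ℕ) :
    ‖∑ n ∈ Finset.Ico a b, if n < N then f n else 0‖ ≤ B := by
  rw [← Finset.sum_filter, show (Finset.Ico a b).filter (fun n => n < N) =
    Finset.Ico a (min b N) by ext n; simp only [Finset.mem_filter, Finset.mem_Ico]; omega]
  by_cases h : a ≤ min b N
  · exact hf _ _ h (min_le_right _ _)
  · rw [Finset.Ico_eq_empty_of_le (not_le.1 h).le, Finset.sum_empty, norm_zero]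
    exact (norm_nonneg _).trans (hf 0 0 le_rfl (Nat.zero_le _))

lemma norm_sum_char_zeta_le {q : ℕ} [NeZero q] {χ : DirichletCharacter ℂ q} (hχ : χ ≠ 1)
    (N a b : ℕ) : ‖∑ n ∈ Finset.Ico a b,
      if n < N then χ n * (((ζ : ArithmeticFunction ℝ) n : ℝ) : ℂ) else 0‖ ≤ q + 1 := by
  refine norm_sum_Ico_ite_le (fun a b hab _ => ?_) a b
  have h1 : ∀ n : ℕ, χ n * (((ζ : ArithmeticFunction ℝ) n : ℝ) : ℂ) =
      χ n - if n = 0 then χ n else 0 := by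
    intro n
    rcases eq_or_ne n 0 with rfl | hn
    · simp
    · simp [hn, ArithmeticFunction.natCoe_apply, ArithmeticFunction.zeta_apply_ne hn]
  simp_rw [h1, Finset.sum_sub_distrib]
  refine (norm_sub_le _ _).trans (add_le_add (norm_sum_Ico_char_le hχ a b) ?_)
  rw [Finset.sum_ite_eq']
  split_ifs
  · exact χ.norm_le_one _
  · simp

lemma norm_sum_char_log_le {q : ℕ} [NeZero q] {χ : DirichletCharacter ℂ q} (hχ : χ ≠ 1)
    (N a b : ℕ) : ‖∑ n ∈ Finset.Ico a b,
      if n < N then χ n * ((ArithmeticFunction.log n : ℝ) : ℂ) else 0‖ ≤ 2 * q * Real.log N := by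
  refine norm_sum_Ico_ite_le (fun a b hab hb => ?_) a b
  refine (norm_sum_Ico_mul_monotone_le (norm_sum_Ico_char_le hχ)
    (g := fun n => ArithmeticFunction.log n) hab ?_ ?_).trans ?_
  · simp only [ArithmeticFunction.log_apply]
    exact Real.log_natCast_nonneg _
  · intro n _
    simp only [ArithmeticFunction.log_apply]
    rcases Nat.eq_zero_or_pos n with rfl | hn
    · simp
    · exact Real.log_le_log (by exact_mod_cast hn) (by push_cast; linarith)
  · simp only [ArithmeticFunction.log_apply]
    rcases Nat.eq_zero_or_pos b with rfl | hn
    · have := Real.log_natCast_nonneg N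
      simp only [Nat.cast_zero, Real.log_zero, mul_zero]
      positivity
    · have : Real.log b ≤ Real.log N :=
        Real.log_le_log (by exact_mod_cast hn) (by exact_mod_cast hb)
      gcongr

lemma sum_inv_range_le (N : ℕ) : ∑ n ∈ Finset.range (N + 1), (1 : ℝ) / n ≤ 1 + Real.log N := by
  have h := harmonic_le_one_add_log N
  rw [harmonic] at h
  push_cast at h
  rw [Finset.sum_range_succ']
  simpa using h

lemma card_divisors_mul_le (a b : ℕ) :
    (a * b).divisors.card ≤ a.divisors.card * b.divisors.card := by
  rw [Nat.divisors_mul]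
  exact Finset.card_mul_le

lemma sum_range_mul_card_divisors_le {c : ℕ → ℝ} (hc : ∀ n, 0 ≤ c n) (hc0 : c 0 = 0) (N : ℕ) :
    ∑ n ∈ Finset.range N, (n.divisors.card : ℝ) * c n ≤
      ∑ a ∈ Finset.range N, ∑ b ∈ Finset.range N, c (a * b) := by
  have h1 : ∀ n ∈ Finset.range N, (n.divisors.card : ℝ) * c n ≤
      ∑ p ∈ Finset.range N ×ˢ Finset.range N, if p.1 * p.2 = n then c n else 0 := by
    intro n hn
    rcases Nat.eq_zero_or_pos n with rfl | hn0
    · simp [hc0]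
    rw [← Finset.sum_filter, Finset.sum_const, nsmul_eq_mul]
    refine mul_le_mul_of_nonneg_right ?_ (hc n)
    norm_cast
    refine Finset.card_le_card_of_injOn (fun d => (d, n / d)) (fun d hd => ?_)
      fun d _ e _ h => congrArg Prod.fst h
    have hd' := Nat.dvd_of_mem_divisors hd
    have h2 := Nat.le_of_dvd hn0 hd'
    have h3 := Nat.div_le_self n d
    have := Finset.mem_range.1 hn
    simp only [Finset.coe_filter, Finset.mem_product, Finset.mem_range, Set.mem_ofPred_eq]
    exact ⟨⟨by omega, by omega⟩, Nat.mul_div_cancel' hd'⟩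
  refine (Finset.sum_le_sum h1).trans ?_
  rw [Finset.sum_comm, Finset.sum_product]
  refine Finset.sum_le_sum fun m _ => Finset.sum_le_sum fun n _ => ?_
  rw [Finset.sum_ite_eq]
  split_ifs with h
  · rfl
  · exact hc _

lemma sum_card_divisors_div_le (N : ℕ) :
    ∑ n ∈ Finset.range (N + 1), (n.divisors.card : ℝ) / n ≤ (1 + Real.log N) ^ 2 := by
  have h := sum_range_mul_card_divisors_le (c := fun n => 1 / (n : ℝ)) (fun _ => by positivity)
    (by simp) (N + 1)
  simp only [mul_one_div] at h
  refine h.trans (le_trans (le_of_eq ?_) (pow_le_pow_left₀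
    (Finset.sum_nonneg fun _ _ => by positivity) (sum_inv_range_le N) 2))
  rw [sq, Finset.sum_mul_sum]
  refine Finset.sum_congr rfl fun a _ => Finset.sum_congr rfl fun b _ => ?_
  push_cast
  rw [div_mul_div_comm, one_mul]

lemma sum_card_divisors_sq_div_le (N : ℕ) :
    ∑ n ∈ Finset.range (N + 1), (n.divisors.card : ℝ) ^ 2 / n ≤ (1 + Real.log N) ^ 4 := by
  have h := sum_range_mul_card_divisors_le (c := fun n => (n.divisors.card : ℝ) / n)
    (fun _ => by positivity) (by simp) (N + 1)
  calc ∑ n ∈ Finset.range (N + 1), (n.divisors.card : ℝ) ^ 2 / n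
      = ∑ n ∈ Finset.range (N + 1), (n.divisors.card : ℝ) * ((n.divisors.card : ℝ) / n) :=
        Finset.sum_congr rfl fun n _ => by ring
    _ ≤ _ := h
    _ ≤ (∑ n ∈ Finset.range (N + 1), (n.divisors.card : ℝ) / n) ^ 2 := by
        rw [sq, Finset.sum_mul_sum]
        refine Finset.sum_le_sum fun a _ => Finset.sum_le_sum fun b _ => ?_
        rw [div_mul_div_comm, Nat.cast_mul]
        refine div_le_div_of_nonneg_right ?_ (by positivity)
        exact_mod_cast card_divisors_mul_le a b
    _ ≤ ((1 + Real.log N) ^ 2) ^ 2 :=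
        pow_le_pow_left₀ (Finset.sum_nonneg fun _ _ => by positivity) (sum_card_divisors_div_le N) 2
    _ = _ := by ring

/-- The restriction of an arithmetic function to `n ≤ U`. -/
noncomputable def truncate (f : ArithmeticFunction ℝ) (U : ℕ) : ArithmeticFunction ℝ :=
  ⟨fun n => if n ≤ U then f n else 0, by simp⟩

lemma truncate_apply (f : ArithmeticFunction ℝ) (U n : ℕ) :
    truncate f U n = if n ≤ U then f n else 0 := rfl

lemma vaughan_identity (F G : ArithmeticFunction ℝ) :
    Λ = F + G * ArithmeticFunction.log - (F * G) * (ζ : ArithmeticFunction ℝ) +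
      (Λ - F) * (1 - G * (ζ : ArithmeticFunction ℝ)) := by
  have h := ArithmeticFunction.vonMangoldt_mul_zeta
  rw [← h]
  ring

/-- The second factor in the type II part of Vaughan's identity. -/
noncomputable def vaughanTail (U : ℕ) : ArithmeticFunction ℝ :=
  1 - truncate ((μ : ArithmeticFunction ℤ) : ArithmeticFunction ℝ) U * (ζ : ArithmeticFunction ℝ)

lemma truncate_moebius_mul_zeta_apply (U n : ℕ) :
    (truncate ((μ : ArithmeticFunction ℤ) : ArithmeticFunction ℝ) U *
      (ζ : ArithmeticFunction ℝ)) n = ∑ d ∈ n.divisors, if d ≤ U then (μ d : ℝ) else 0 := by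
  rw [ArithmeticFunction.coe_mul_zeta_apply]
  rfl

lemma vaughanTail_eq_zero {U n : ℕ} (hn : n ≤ U) : vaughanTail U n = 0 := by
  rcases Nat.eq_zero_or_pos n with rfl | hn0
  · simp
  have h1 : (truncate ((μ : ArithmeticFunction ℤ) : ArithmeticFunction ℝ) U *
      (ζ : ArithmeticFunction ℝ)) n = (1 : ArithmeticFunction ℝ) n := by
    rw [← ArithmeticFunction.coe_moebius_mul_coe_zeta, truncate_moebius_mul_zeta_apply,
      ArithmeticFunction.coe_mul_zeta_apply]
    refine Finset.sum_congr rfl fun d hd => ?_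
    rw [if_pos ((Nat.divisor_le hd).trans hn), ArithmeticFunction.intCoe_apply]
  rw [vaughanTail, sub_eq_add_neg, ArithmeticFunction.add_apply, ArithmeticFunction.neg_apply, h1]
  ring

lemma abs_vaughanTail_le {U : ℕ} (hU : 1 ≤ U) (n : ℕ) : |vaughanTail U n| ≤ n.divisors.card := by
  rcases le_or_gt n U with h | h
  · rw [vaughanTail_eq_zero h, abs_zero]
    positivity
  · rw [vaughanTail, sub_eq_add_neg, ArithmeticFunction.add_apply, ArithmeticFunction.neg_apply,
      ArithmeticFunction.one_apply_ne (by omega), zero_add, abs_neg,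
      truncate_moebius_mul_zeta_apply]
    refine (Finset.abs_sum_le_sum_abs _ _).trans ?_
    rw [Finset.card_eq_sum_ones, Nat.cast_sum]
    refine Finset.sum_le_sum fun d _ => ?_
    split_ifs
    · rw [Nat.cast_one]
      exact_mod_cast ArithmeticFunction.abs_moebius_le_one
    · simp

/-- Sums of `χ(n) f(n) max (1 - n / x) 0`. -/
noncomputable def cutoffSum {q : ℕ} (χ : DirichletCharacter ℂ q) (x : ℝ) (N : ℕ)
    (f : ArithmeticFunction ℝ) : ℂ :=
  ∑ n ∈ Finset.range N, (f n : ℂ) * (χ n * (cutoff x n : ℂ))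

lemma cutoffSum_add {q : ℕ} (χ : DirichletCharacter ℂ q) (x : ℝ) (N : ℕ)
    (f g : ArithmeticFunction ℝ) :
    cutoffSum χ x N (f + g) = cutoffSum χ x N f + cutoffSum χ x N g := by
  unfold cutoffSum
  rw [← Finset.sum_add_distrib]
  refine Finset.sum_congr rfl fun n _ => ?_
  rw [ArithmeticFunction.add_apply, Complex.ofReal_add, add_mul]

lemma cutoffSum_sub {q : ℕ} (χ : DirichletCharacter ℂ q) (x : ℝ) (N : ℕ)
    (f g : ArithmeticFunction ℝ) :
    cutoffSum χ x N (f - g) = cutoffSum χ x N f - cutoffSum χ x N g := by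
  unfold cutoffSum
  rw [← Finset.sum_sub_distrib]
  refine Finset.sum_congr rfl fun n _ => ?_
  rw [sub_eq_add_neg, ArithmeticFunction.add_apply, ArithmeticFunction.neg_apply,
    Complex.ofReal_add, add_mul, Complex.ofReal_neg]
  ring

lemma norm_cutoffSum_le {q : ℕ} (χ : DirichletCharacter ℂ q) {x : ℝ} (hx : 0 < x) (N : ℕ)
    (f : ArithmeticFunction ℝ) : ‖cutoffSum χ x N f‖ ≤ ∑ n ∈ Finset.range N, |f n| := by
  refine norm_sum_le_of_le _ fun n _ => ?_
  rw [norm_mul, norm_mul, Complex.norm_real, Complex.norm_real,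
    Real.norm_of_nonneg (cutoff_nonneg x n), Real.norm_eq_abs]
  exact mul_le_of_le_one_right (abs_nonneg _)
    (mul_le_one₀ (χ.norm_le_one _) (cutoff_nonneg x n) (cutoff_le_one hx n))

lemma cutoffSum_mul {q : ℕ} (χ : DirichletCharacter ℂ q) {x : ℝ} (hx : 0 < x) {N : ℕ}
    (hN : x ≤ N) (f g : ArithmeticFunction ℝ) :
    cutoffSum χ x N (f * g) = ∑ m ∈ Finset.range N, ∑ n ∈ Finset.range N,
      (f m : ℂ) * (g n : ℂ) * (χ (m * n : ℕ) * (cutoff x (m * n) : ℂ)) := by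
  refine sum_range_mul_convolution f g (fun n => χ n * (cutoff x n : ℂ)) fun n hn => ?_
  rw [cutoff_eq_zero hx (hN.trans (by exact_mod_cast hn)), Complex.ofReal_zero, mul_zero]

lemma smoothSum_charLambda_eq {q : ℕ} (χ : DirichletCharacter ℂ q) {x : ℝ} (hx : 0 < x) {N : ℕ}
    (hN : x < N) : smoothSum (fun n => charLambda χ n) x = cutoffSum χ x N Λ := by
  rw [smoothSum_eq_sum_range (by simp) hx ((Nat.floor_lt hx.le).2 hN)]
  refine Finset.sum_congr rfl fun n _ => ?_
  rw [charLambda_apply]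
  ring

lemma abs_truncate_moebius_le (U n : ℕ) :
    |truncate ((μ : ArithmeticFunction ℤ) : ArithmeticFunction ℝ) U n| ≤ 1 := by
  rw [truncate_apply]
  split_ifs
  · rw [ArithmeticFunction.intCoe_apply]
    exact_mod_cast ArithmeticFunction.abs_moebius_le_one
  · simp

lemma truncate_vonMangoldt_nonneg (U n : ℕ) : 0 ≤ truncate Λ U n := by
  rw [truncate_apply]
  split_ifs
  · exact ArithmeticFunction.vonMangoldt_nonneg
  · rfl

lemma truncate_vonMangoldt_le (U n : ℕ) : truncate Λ U n ≤ Λ n := by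
  rw [truncate_apply]
  split_ifs
  · rfl
  · exact ArithmeticFunction.vonMangoldt_nonneg

lemma abs_truncate_mul_truncate_le {U n : ℕ} :
    |(truncate Λ U * truncate ((μ : ArithmeticFunction ℤ) : ArithmeticFunction ℝ) U) n| ≤
      Real.log n := by
  rw [ArithmeticFunction.mul_apply, ← ArithmeticFunction.vonMangoldt_sum,
    ← Nat.sum_divisorsAntidiagonal (fun d _ => Λ d)]
  refine (Finset.abs_sum_le_sum_abs _ _).trans (Finset.sum_le_sum fun p _ => ?_)
  rw [abs_mul, abs_of_nonneg (truncate_vonMangoldt_nonneg U _)]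
  exact (mul_le_of_le_one_right (truncate_vonMangoldt_nonneg U _)
    (abs_truncate_moebius_le U _)).trans (truncate_vonMangoldt_le U _)

lemma truncate_mul_truncate_eq_zero {U n : ℕ} (f g : ArithmeticFunction ℝ) (hn : U * U < n) :
    (truncate f U * truncate g U) n = 0 := by
  rw [ArithmeticFunction.mul_apply]
  refine Finset.sum_eq_zero fun p hp => ?_
  have h := (Nat.mem_divisorsAntidiagonal.1 hp).1
  rw [truncate_apply, truncate_apply]
  split_ifs with h1 h2
  · exact absurd (Nat.mul_le_mul h1 h2) (by omega)
  all_goals simp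

lemma norm_smoothSum_charLambda_sub_le {q : ℕ} [NeZero q] {χ : DirichletCharacter ℂ q}
    (hχ : χ ≠ 1) {x : ℝ} (hx : 3 ≤ x) {U N : ℕ} (hU : 1 ≤ U) (hUx : U ≤ x) (hN : x < N)
    (hN2 : N ≤ 2 * x) :
    ‖smoothSum (fun n => charLambda χ n) x‖ ≤ 13 * q * U ^ 2 * Real.log x +
      ‖cutoffSum χ x N ((Λ - truncate Λ U) * vaughanTail U)‖ := by
  have hx0 : 0 < x := by linarith
  have hL := one_lt_log hx
  have hq1 : (1 : ℝ) ≤ q := by exact_mod_cast Nat.one_le_iff_ne_zero.2 (NeZero.ne q)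
  have hU1 : (1 : ℝ) ≤ U := by exact_mod_cast hU
  have hlogN : Real.log N ≤ 2 * Real.log x := by
    rw [← Real.log_rpow hx0]
    refine Real.log_le_log (by linarith) (hN2.trans ?_)
    rw [Real.rpow_two]; nlinarith
  have hlogU : Real.log U ≤ Real.log x := Real.log_le_log (by linarith) hUx
  have e1 : ‖cutoffSum χ x N (truncate Λ U)‖ ≤ U * Real.log x := by
    refine (norm_cutoffSum_le χ hx0 N _).trans ?_
    refine sum_range_le_of_support (by simp) (by linarith) (fun n => ?_) (fun n hn => ?_) N
    · rw [abs_of_nonneg (truncate_vonMangoldt_nonneg U n), truncate_apply]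
      split_ifs with h
      · refine ArithmeticFunction.vonMangoldt_le_log.trans ?_
        rcases Nat.eq_zero_or_pos n with rfl | hn
        · simp; linarith
        · exact (Real.log_le_log (by exact_mod_cast hn) (by exact_mod_cast h)).trans hlogU
      · linarith
    · rw [truncate_apply, if_neg (by omega), abs_zero]
  have e2 : ‖cutoffSum χ x N (truncate ((μ : ArithmeticFunction ℤ) : ArithmeticFunction ℝ) U *
      ArithmeticFunction.log)‖ ≤ 4 * q * Real.log x * U := by
    rw [cutoffSum_mul χ hx0 hN.le]
    refine (norm_type_one_le χ _ _ hx0 N (norm_sum_char_log_le hχ N)).trans ?_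
    have h1 : ∑ m ∈ Finset.range N,
        |truncate ((μ : ArithmeticFunction ℤ) : ArithmeticFunction ℝ) U m| ≤ U * 1 :=
      sum_range_le_of_support (by simp) zero_le_one (abs_truncate_moebius_le U)
        (fun n hn => by rw [truncate_apply, if_neg (by omega), abs_zero]) N
    rw [mul_one] at h1
    refine mul_le_mul ?_ h1 (Finset.sum_nonneg fun _ _ => abs_nonneg _) (by positivity)
    have := mul_le_mul_of_nonneg_left hlogN (by linarith : (0 : ℝ) ≤ 2 * q)
    linarith
  have e3 : ‖cutoffSum χ x N ((truncate Λ U *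
      truncate ((μ : ArithmeticFunction ℤ) : ArithmeticFunction ℝ) U) *
      (ζ : ArithmeticFunction ℝ))‖ ≤ (q + 1) * ((U * U : ℕ) * (2 * Real.log x)) := by
    rw [cutoffSum_mul χ hx0 hN.le]
    refine (norm_type_one_le χ _ _ hx0 N (norm_sum_char_zeta_le hχ N)).trans ?_
    refine mul_le_mul_of_nonneg_left ?_ (by positivity)
    refine sum_range_le_of_support (by simp) (by linarith) (fun n => ?_) (fun n hn => ?_) N
    · rcases le_or_gt n (U * U) with h | h
      · refine abs_truncate_mul_truncate_le.trans ?_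
        rcases Nat.eq_zero_or_pos n with rfl | hn
        · simp; linarith
        · refine (Real.log_le_log (by exact_mod_cast hn)
            (show (n : ℝ) ≤ U * U by exact_mod_cast h)).trans ?_
          rw [Real.log_mul (by positivity) (by positivity)]
          linarith
      · rw [truncate_mul_truncate_eq_zero _ _ h, abs_zero]; linarith
    · rw [truncate_mul_truncate_eq_zero _ _ hn, abs_zero]
  rw [smoothSum_charLambda_eq χ hx0 hN]
  have hV : cutoffSum χ x N Λ = cutoffSum χ x N (truncate Λ U) +
      cutoffSum χ x N (truncate ((μ : ArithmeticFunction ℤ) : ArithmeticFunction ℝ) U *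
      ArithmeticFunction.log) - cutoffSum χ x N ((truncate Λ U *
      truncate ((μ : ArithmeticFunction ℤ) : ArithmeticFunction ℝ) U) *
      (ζ : ArithmeticFunction ℝ)) +
      cutoffSum χ x N ((Λ - truncate Λ U) * vaughanTail U) := by
    rw [← cutoffSum_add, ← cutoffSum_sub, ← cutoffSum_add]
    exact congrArg _ (vaughan_identity _ _)
  rw [hV]
  refine (norm_add_le _ _).trans (add_le_add_left ?_ _)
  refine (norm_sub_le _ _).trans ((add_le_add (norm_add_le _ _) le_rfl).trans ?_)
  refine (add_le_add (add_le_add e1 e2) e3).trans ?_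
  push_cast
  have hqU : (U : ℝ) * Real.log x ≤ q * U ^ 2 * Real.log x := by
    have : (1 : ℝ) * U ≤ q * (U * U) :=
      mul_le_mul hq1 (by nlinarith) (by linarith) (by linarith)
    calc (U : ℝ) * Real.log x = 1 * U * Real.log x := by ring
      _ ≤ q * (U * U) * Real.log x := mul_le_mul_of_nonneg_right this (by linarith)
      _ = _ := by ring
  have hqU2 : (q : ℝ) * Real.log x * U ≤ q * U ^ 2 * Real.log x := by
    have : (U : ℝ) ≤ U ^ 2 := by nlinarith
    calc (q : ℝ) * Real.log x * U ≤ q * Real.log x * U ^ 2 := by gcongr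
      _ = _ := by ring
  have hqU3 : (q + 1 : ℝ) * (U * U * (2 * Real.log x)) ≤ 4 * (q * U ^ 2 * Real.log x) := by
    calc (q + 1 : ℝ) * (U * U * (2 * Real.log x)) ≤ (q + q) * (U * U * (2 * Real.log x)) := by
          gcongr
      _ = _ := by ring
  have : 0 ≤ (q : ℝ) * U ^ 2 * Real.log x := by positivity
  linarith

lemma sum_Ico_one_two_pow {M : Type*} [AddCommMonoid M] (f : ℕ → M) (K : ℕ) :
    ∑ m ∈ Finset.Ico 1 (2 ^ K), f m =
      ∑ k ∈ Finset.range K, ∑ m ∈ Finset.Ico (2 ^ k) (2 ^ (k + 1)), f m := by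
  induction K with
  | zero => simp
  | succ K ih =>
    rw [Finset.sum_range_succ, ← ih, Finset.sum_Ico_consecutive _ Nat.one_le_two_pow
      (Nat.pow_le_pow_right (by norm_num) (Nat.le_succ K))]

/-- The dyadic pieces of the first factor in the type II part of Vaughan's identity. -/
noncomputable def dyadicLambda (U k m : ℕ) : ℂ :=
  if 2 ^ k ≤ m then (((Λ - truncate Λ U) m : ℝ) : ℂ) else 0

lemma sub_truncate_apply (U m : ℕ) : (Λ - truncate Λ U) m = if m ≤ U then 0 else Λ m := by
  rw [sub_eq_add_neg, ArithmeticFunction.add_apply, ArithmeticFunction.neg_apply, truncate_apply]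
  split_ifs <;> ring

/-- A dyadic block of the type II sum in Vaughan's identity. -/
noncomputable def dyadicBlock {q : ℕ} (χ : DirichletCharacter ℂ q) (x : ℝ) (U k : ℕ) : ℂ :=
  ∑ m ∈ Finset.range (2 ^ (k + 1)), ∑ n ∈ Finset.range (⌊x / 2 ^ k⌋₊ + 1),
    dyadicLambda U k m * (vaughanTail U n : ℂ) * (χ m * χ n) *
      ((max 0 (1 - (m * n : ℕ) / x) : ℝ) : ℂ)

lemma cutoffSum_eq_sum_dyadicBlock {q : ℕ} (χ : DirichletCharacter ℂ q) {x : ℝ} (hx : 0 < x)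
    {U K : ℕ} (hK : x < 2 ^ K) :
    cutoffSum χ x (2 ^ K) ((Λ - truncate Λ U) * vaughanTail U) =
      ∑ k ∈ Finset.range K, dyadicBlock χ x U k := by
  have hK' : x ≤ ((2 ^ K : ℕ) : ℝ) := by push_cast; exact hK.le
  rw [cutoffSum_mul χ hx hK', Finset.range_eq_Ico,
    Finset.sum_eq_sum_Ico_succ_bot (by positivity), ← Finset.range_eq_Ico]
  rw [Finset.sum_eq_zero fun n _ => by simp, zero_add, zero_add, sum_Ico_one_two_pow]
  refine Finset.sum_congr rfl fun k hk => ?_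
  rw [dyadicBlock]
  refine Eq.trans ?_ (Finset.sum_subset (s₁ := Finset.Ico (2 ^ k) (2 ^ (k + 1))) ?_ ?_)
  · refine Finset.sum_congr rfl fun m hm => ?_
    have hm' := (Finset.mem_Ico.1 hm).1
    refine (Finset.sum_subset_zero_on_sdiff (fun n hn => ?_) (fun n hn => ?_) fun n _ => ?_).symm
    · rw [Finset.mem_range] at hn ⊢
      have h1 : ⌊x / 2 ^ k⌋₊ < 2 ^ K := by
        rw [Nat.floor_lt (by positivity)]
        push_cast
        exact (div_le_self hx.le (one_le_pow₀ (by norm_num))).trans_lt hK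
      omega
    · rw [Finset.mem_sdiff, Finset.mem_range, Finset.mem_range, not_lt] at hn
      rw [cutoff_eq_zero hx]
      · simp
      · have h1 : x / 2 ^ k < n := (Nat.lt_floor_add_one _).trans_le (by exact_mod_cast hn.2)
        rw [div_lt_iff₀ (by positivity)] at h1
        push_cast
        refine h1.le.trans ?_
        rw [mul_comm]
        exact mul_le_mul_of_nonneg_right (by exact_mod_cast hm') (Nat.cast_nonneg _)
    · rw [dyadicLambda, if_pos hm', cutoff, Nat.cast_mul (α := ZMod q), map_mul]
      ring
  · intro m hm
    exact Finset.mem_range.2 (Finset.mem_Ico.1 hm).2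
  · intro m hm hm'
    rw [Finset.mem_range] at hm
    rw [Finset.mem_Ico, not_and, not_lt] at hm'
    refine Finset.sum_eq_zero fun n _ => ?_
    rw [dyadicLambda, if_neg fun h => absurd (hm' h) (by omega)]
    simp

lemma dyadicBlock_eq_zero {q : ℕ} (χ : DirichletCharacter ℂ q) {x : ℝ} {U k : ℕ}
    (h : 2 ^ (k + 1) ≤ U ∨ x < U * 2 ^ k) : dyadicBlock χ x U k = 0 := by
  refine Finset.sum_eq_zero fun m hm => Finset.sum_eq_zero fun n hn => ?_
  rw [Finset.mem_range] at hm hn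
  rcases h with h | h
  · rw [dyadicLambda, sub_truncate_apply, if_pos (by omega : m ≤ U)]
    simp
  · have h1 : ⌊x / 2 ^ k⌋₊ ≤ U :=
      Nat.floor_le_of_le ((div_le_iff₀ (by positivity)).2 h.le)
    rw [vaughanTail_eq_zero (by omega : n ≤ U)]
    simp

lemma sum_dyadicLambda_le {x : ℝ} (hx : 3 ≤ x) (U : ℕ) {k : ℕ} (hk : (2 : ℝ) ^ k ≤ x) :
    ∑ m ∈ Finset.range (2 ^ (k + 1)), ‖dyadicLambda U k m‖ ^ 2 / m ≤ (2 * Real.log x) ^ 2 := by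
  have hx0 : 0 < x := by linarith
  have hL := one_lt_log hx
  rw [← Finset.sum_subset (s₁ := Finset.Ico (2 ^ k) (2 ^ (k + 1)))
    (fun m hm => Finset.mem_range.2 (Finset.mem_Ico.1 hm).2) fun m hm hm' => ?_]
  · have h1 : ∀ m ∈ Finset.Ico (2 ^ k) (2 ^ (k + 1)),
        ‖dyadicLambda U k m‖ ^ 2 / m ≤ (2 * Real.log x) ^ 2 / 2 ^ k := by
      intro m hm
      rw [Finset.mem_Ico] at hm
      have hm0 : 0 < m := (by positivity : 0 < 2 ^ k).trans_le hm.1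
      have h2 : ‖dyadicLambda U k m‖ ≤ 2 * Real.log x := by
        rw [dyadicLambda, if_pos hm.1, sub_truncate_apply, Complex.norm_real, Real.norm_eq_abs]
        split_ifs
        · simpa using by linarith
        · rw [abs_of_nonneg ArithmeticFunction.vonMangoldt_nonneg]
          refine ArithmeticFunction.vonMangoldt_le_log.trans ?_
          rw [← Real.log_rpow hx0]
          refine Real.log_le_log (by exact_mod_cast hm0) ?_
          have h3 : (m : ℝ) ≤ 2 ^ (k + 1) := by exact_mod_cast hm.2.le
          rw [pow_succ] at h3
          rw [Real.rpow_two]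
          nlinarith
      have h3 : (2 : ℝ) ^ k ≤ m := by exact_mod_cast hm.1
      gcongr
    refine (Finset.sum_le_sum h1).trans (le_of_eq ?_)
    rw [Finset.sum_const, Nat.card_Ico, nsmul_eq_mul, pow_succ, mul_two, Nat.add_sub_cancel]
    push_cast
    field_simp
  · rw [Finset.mem_range] at hm
    rw [Finset.mem_Ico, not_and, not_lt] at hm'
    rw [dyadicLambda, if_neg fun h => absurd (hm' h) (by omega)]
    simp

lemma sum_vaughanTail_le {x : ℝ} (hx : 3 ≤ x) {U : ℕ} (hU : 1 ≤ U) (k : ℕ) :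
    ∑ n ∈ Finset.range (⌊x / 2 ^ k⌋₊ + 1), ‖(vaughanTail U n : ℂ)‖ ^ 2 / n ≤
      (2 * Real.log x) ^ 4 := by
  have hx0 : 0 < x := by linarith
  have hL := one_lt_log hx
  calc _ ≤ ∑ n ∈ Finset.range (⌊x / 2 ^ k⌋₊ + 1), (n.divisors.card : ℝ) ^ 2 / n := by
        refine Finset.sum_le_sum fun n _ => ?_
        rw [Complex.norm_real, Real.norm_eq_abs]
        have := abs_vaughanTail_le hU n
        gcongr
    _ ≤ (1 + Real.log ⌊x / 2 ^ k⌋₊) ^ 4 := sum_card_divisors_sq_div_le _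
    _ ≤ (2 * Real.log x) ^ 4 := by
        have h1 := Real.log_natCast_nonneg ⌊x / 2 ^ k⌋₊
        have h2 : Real.log ⌊x / 2 ^ k⌋₊ ≤ Real.log x := by
          rcases Nat.eq_zero_or_pos ⌊x / 2 ^ k⌋₊ with h | h
          · rw [h]; simp; linarith
          · exact Real.log_le_log (by exact_mod_cast h) ((Nat.floor_le (by positivity)).trans
              (div_le_self hx0.le (one_le_pow₀ (by norm_num))))
        gcongr
        linarith

lemma sqrt_dyadic_le {x y U Q : ℝ} (hU : 1 ≤ U) (hQ : 0 ≤ Q) (hx : 0 < x)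
    (hy : U ≤ 2 * y) (hxy : U * y ≤ x) :
    √((2 * y + Q ^ 2) * (2 * (x / y) + Q ^ 2)) ≤ 2 * √x + 3 * (√x * Q / √U) + Q ^ 2 := by
  have hy0 : 0 < y := by linarith
  have hU0 : 0 < U := by linarith
  refine Real.sqrt_le_iff.2 ⟨by positivity, ?_⟩
  have h1 : √x ^ 2 = x := Real.sq_sqrt hx.le
  have h2 : (√x * Q / √U) ^ 2 = x / U * Q ^ 2 := by
    rw [div_pow, mul_pow, h1, Real.sq_sqrt hU0.le]; ring
  have h3 : y ≤ x / U := by rw [le_div_iff₀ hU0]; linarith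
  have h4 : x / y ≤ 2 * (x / U) := by
    rw [div_le_iff₀ hy0]
    have : x / U * U = x := by field_simp
    have hxU : 0 < x / U := by positivity
    nlinarith
  have h5 : (2 * y + Q ^ 2) * (2 * (x / y) + Q ^ 2) =
      4 * x + 2 * (y * Q ^ 2) + 2 * (x / y * Q ^ 2) + (Q ^ 2) ^ 2 := by
    field_simp
    ring
  have h6 := mul_le_mul_of_nonneg_right h3 (sq_nonneg Q)
  have h7 := mul_le_mul_of_nonneg_right h4 (sq_nonneg Q)
  have h8 : 0 ≤ √x := Real.sqrt_nonneg x
  have h9 : 0 ≤ √x * Q / √U := by positivity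
  have h10 := mul_nonneg h8 h9
  have h11 := mul_nonneg h8 (sq_nonneg Q)
  have h12 := mul_nonneg h9 (sq_nonneg Q)
  have h13 : 0 ≤ x / U * Q ^ 2 := by positivity
  have h14 : (2 * √x + 3 * (√x * Q / √U) + Q ^ 2) ^ 2 = 4 * √x ^ 2 + 9 * (√x * Q / √U) ^ 2 +
      (Q ^ 2) ^ 2 + 12 * (√x * (√x * Q / √U)) + 4 * (√x * Q ^ 2) +
      6 * ((√x * Q / √U) * Q ^ 2) := by ring
  rw [h5, h14, h1, h2]
  linarith

lemma sum_norm_dyadicBlock_le {x : ℝ} (hx : 3 ≤ x) {U : ℕ} (hU : 1 ≤ U) (Q : ℕ) {k : ℕ}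
    (hk : (2 : ℝ) ^ k ≤ x) :
    ∑ q ∈ Finset.Icc 1 Q, (q / q.totient : ℝ) *
      ∑ χ ∈ Finset.univ.filter (fun χ : DirichletCharacter ℂ q => χ.IsPrimitive),
        ‖dyadicBlock χ x U k‖ ≤
      128 * √x * (2 * √x + 3 * (√x * Q / √U) + Q ^ 2) * Real.log x ^ 3 := by
  have hx0 : 0 < x := by linarith
  have hL := one_lt_log hx
  by_cases h : 2 ^ (k + 1) ≤ U ∨ x < U * 2 ^ k
  · simp_rw [dyadicBlock_eq_zero _ h]
    simp only [norm_zero, Finset.sum_const_zero, mul_zero]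
    positivity
  push Not at h
  have h1 := bilinear_large_sieve Q (2 ^ (k + 1)) (⌊x / 2 ^ k⌋₊ + 1)
    (α := dyadicLambda U k) (β := fun n => (vaughanTail U n : ℂ)) (by simp [dyadicLambda])
    (by simp) hx0
  refine h1.trans ?_
  have h2 : √((∑ m ∈ Finset.range (2 ^ (k + 1)), ‖dyadicLambda U k m‖ ^ 2 / m) *
      ∑ n ∈ Finset.range (⌊x / 2 ^ k⌋₊ + 1), ‖(vaughanTail U n : ℂ)‖ ^ 2 / n) ≤
      8 * Real.log x ^ 3 := by
    refine Real.sqrt_le_iff.2 ⟨by positivity, ?_⟩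
    refine (mul_le_mul (sum_dyadicLambda_le hx U hk) (sum_vaughanTail_le hx hU k)
      (Finset.sum_nonneg fun _ _ => by positivity) (by positivity)).trans (le_of_eq ?_)
    ring
  have h3 : √((((2 ^ (k + 1) : ℕ) : ℝ) + Q ^ 2) * (((⌊x / 2 ^ k⌋₊ + 1 : ℕ) : ℝ) + Q ^ 2)) ≤
      2 * √x + 3 * (√x * Q / √U) + Q ^ 2 := by
    refine le_trans (Real.sqrt_le_sqrt ?_) (sqrt_dyadic_le (y := 2 ^ k) (by exact_mod_cast hU)
      (Nat.cast_nonneg Q) hx0 ?_ h.2)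
    · push_cast
      have h4 : (⌊x / 2 ^ k⌋₊ : ℝ) ≤ x / 2 ^ k := Nat.floor_le (by positivity)
      have h5 : 1 ≤ x / 2 ^ k := (one_le_div (by positivity)).2 hk
      refine mul_le_mul (le_of_eq (by ring)) (by linarith) (by positivity) (by positivity)
    · have : (U : ℝ) ≤ 2 ^ (k + 1) := by exact_mod_cast h.1.le
      rw [pow_succ] at this
      linarith
  calc _ ≤ 16 * √x * ((2 * √x + 3 * (√x * Q / √U) + Q ^ 2) * (8 * Real.log x ^ 3)) := by
        refine mul_le_mul_of_nonneg_left ?_ (by positivity)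
        exact mul_le_mul h3 h2 (Real.sqrt_nonneg _) (by positivity)
    _ = _ := by ring

lemma exists_two_pow_gt {x : ℝ} (hx : 3 ≤ x) : ∃ K : ℕ, x < 2 ^ K ∧ (2 : ℝ) ^ K ≤ 2 * x ∧
    (K : ℝ) ≤ 3 * Real.log x ∧ ∀ k < K, (2 : ℝ) ^ k ≤ x := by
  have hx0 : 0 < x := by linarith
  have hL := one_lt_log hx
  have hfl : ⌊x⌋₊ ≠ 0 := (Nat.floor_pos.2 (by linarith)).ne'
  have h1 : (2 : ℝ) ^ Nat.log 2 ⌊x⌋₊ ≤ x := by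
    have := Nat.pow_log_le_self 2 hfl
    exact (Nat.le_floor_iff hx0.le).1 (by exact_mod_cast this) |>.trans' (by push_cast; rfl)
  refine ⟨Nat.log 2 ⌊x⌋₊ + 1, ?_, ?_, ?_, fun k hk => ?_⟩
  · have := (Nat.floor_lt hx0.le).1 (Nat.lt_pow_succ_log_self (b := 2) (by norm_num) ⌊x⌋₊)
    exact_mod_cast this
  · rw [pow_succ]; linarith
  · have h2 := Real.log_le_log (by positivity) h1
    rw [Real.log_pow] at h2
    have h3 := Real.log_two_gt_d9
    have h4 : (0 : ℝ) ≤ Nat.log 2 ⌊x⌋₊ := Nat.cast_nonneg _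
    push_cast
    nlinarith
  · exact (pow_le_pow_right₀ (by norm_num) (by omega)).trans h1

lemma card_finset_dirichletCharacter_le {q : ℕ} (hq : 0 < q)
    (S : Finset (DirichletCharacter ℂ q)) : S.card ≤ q.totient := by
  have : NeZero q := ⟨hq.ne'⟩
  refine (Finset.card_le_univ S).trans (le_of_eq ?_)
  rw [← Nat.card_eq_fintype_card, DirichletCharacter.card_eq_totient_of_hasEnoughRootsOfUnity]

/-- The large sieve estimate for `∑ χ(n) Λ(n) (1 - n / x)` obtained from Vaughan's identity. -/
theorem vaughan_large_sieve {x : ℝ} (hx : 3 ≤ x) {U : ℕ} (hU : 1 ≤ U) (hUx : U ≤ x) (Q : ℕ) :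
    ∑ q ∈ Finset.Icc 1 Q, (q / q.totient : ℝ) *
      ∑ χ ∈ Finset.univ.filter (fun χ : DirichletCharacter ℂ q => χ.IsPrimitive ∧ χ ≠ 1),
        ‖smoothSum (fun n => charLambda χ n) x‖ ≤
      1200 * (Q ^ 3 * U ^ 2 + x + x * Q / √U + √x * Q ^ 2) * Real.log x ^ 4 := by
  have hx0 : 0 < x := by linarith
  have hL := one_lt_log hx
  obtain ⟨K, hK1, hK2, hK3, hK4⟩ := exists_two_pow_gt hx
  have h1 : ∀ q ∈ Finset.Icc 1 Q, (q / q.totient : ℝ) *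
      ∑ χ ∈ Finset.univ.filter (fun χ : DirichletCharacter ℂ q => χ.IsPrimitive ∧ χ ≠ 1),
        ‖smoothSum (fun n => charLambda χ n) x‖ ≤
      13 * Q ^ 2 * U ^ 2 * Real.log x + ∑ k ∈ Finset.range K, (q / q.totient : ℝ) *
      ∑ χ ∈ Finset.univ.filter (fun χ : DirichletCharacter ℂ q => χ.IsPrimitive),
        ‖dyadicBlock χ x U k‖ := by
    intro q hq
    rw [Finset.mem_Icc] at hq
    obtain ⟨S, hS⟩ : ∃ S : Finset (DirichletCharacter ℂ q),
      S = Finset.univ.filter (fun χ => χ.IsPrimitive ∧ χ ≠ 1) := ⟨_, rfl⟩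
    obtain ⟨T, hT⟩ : ∃ T : Finset (DirichletCharacter ℂ q),
      T = Finset.univ.filter (fun χ => χ.IsPrimitive) := ⟨_, rfl⟩
    have hST : S ⊆ T := fun χ hχ => by
      rw [hS, Finset.mem_filter] at hχ
      rw [hT, Finset.mem_filter]
      exact ⟨hχ.1, hχ.2.1⟩
    have hS1 : ∀ χ ∈ S, χ ≠ 1 := fun χ hχ => by
      rw [hS, Finset.mem_filter] at hχ
      exact hχ.2.2
    rw [← hS, ← hT]
    have : NeZero q := ⟨by omega⟩
    have hφ : (0 : ℝ) < q.totient := by exact_mod_cast Nat.totient_pos.2 hq.1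
    have hqQ : (q : ℝ) ≤ Q := by exact_mod_cast hq.2
    have h2 : ∀ χ ∈ S, ‖smoothSum (fun n => charLambda χ n) x‖ ≤ 13 * q * U ^ 2 * Real.log x +
        ∑ k ∈ Finset.range K, ‖dyadicBlock χ x U k‖ := by
      intro χ hχ
      have h3 := norm_smoothSum_charLambda_sub_le (hS1 χ hχ) hx hU hUx
        (N := 2 ^ K) (by push_cast; exact hK1) (by push_cast; exact hK2)
      rw [cutoffSum_eq_sum_dyadicBlock χ hx0 hK1] at h3
      exact h3.trans (add_le_add_right (norm_sum_le _ _) _)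
    have h4 : ∑ χ ∈ S, (13 * q * U ^ 2 * Real.log x : ℝ) ≤
        q.totient * (13 * q * U ^ 2 * Real.log x) := by
      rw [Finset.sum_const, nsmul_eq_mul]
      refine mul_le_mul_of_nonneg_right ?_ (by positivity)
      exact_mod_cast card_finset_dirichletCharacter_le hq.1 S
    have h5 : ∑ χ ∈ S, ∑ k ∈ Finset.range K, ‖dyadicBlock χ x U k‖ ≤
        ∑ k ∈ Finset.range K, ∑ χ ∈ T, ‖dyadicBlock χ x U k‖ := by
      rw [Finset.sum_comm]
      exact Finset.sum_le_sum fun k _ =>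
        Finset.sum_le_sum_of_subset_of_nonneg hST fun _ _ _ => norm_nonneg _
    refine (mul_le_mul_of_nonneg_left (Finset.sum_le_sum h2)
      (by positivity : (0 : ℝ) ≤ q / q.totient)).trans ?_
    rw [Finset.sum_add_distrib, mul_add]
    refine add_le_add ?_ ((mul_le_mul_of_nonneg_left h5
      (by positivity : (0 : ℝ) ≤ q / q.totient)).trans (le_of_eq (Finset.mul_sum _ _ _)))
    refine (mul_le_mul_of_nonneg_left h4 (by positivity)).trans ?_
    calc (q / q.totient : ℝ) * (q.totient * (13 * q * U ^ 2 * Real.log x))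
        = 13 * q ^ 2 * U ^ 2 * Real.log x := by field_simp
      _ ≤ _ := by gcongr
  refine (Finset.sum_le_sum h1).trans ?_
  rw [Finset.sum_add_distrib, Finset.sum_comm, Finset.sum_const, Nat.card_Icc, nsmul_eq_mul,
    Nat.add_sub_cancel]
  have h6 := Finset.sum_le_sum fun k (hk : k ∈ Finset.range K) =>
    sum_norm_dyadicBlock_le hx hU Q (hK4 k (Finset.mem_range.1 hk))
  refine (add_le_add_right h6 _).trans ?_
  rw [Finset.sum_const, Finset.card_range, nsmul_eq_mul]
  have hxx : √x * √x = x := Real.mul_self_sqrt hx0.le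
  have hUs : (0 : ℝ) < √U := Real.sqrt_pos.2 (by exact_mod_cast hU)
  have e1 : √x * (2 * √x + 3 * (√x * Q / √U) + Q ^ 2) =
      2 * x + 3 * (x * Q / √U) + √x * Q ^ 2 := by
    rw [mul_add, mul_add, show √x * (2 * √x) = 2 * (√x * √x) by ring,
      show √x * (3 * (√x * Q / √U)) = 3 * (√x * √x * Q / √U) by ring, hxx]
  have e2 : (K : ℝ) * (128 * √x * (2 * √x + 3 * (√x * Q / √U) + Q ^ 2) * Real.log x ^ 3) ≤
      3 * Real.log x * (128 * (3 * x + 3 * (x * Q / √U) + 3 * (√x * Q ^ 2)) *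
        Real.log x ^ 3) := by
    rw [mul_assoc 128, e1]
    have h7 : 0 ≤ √x * Q ^ 2 := by positivity
    refine mul_le_mul hK3 ?_ (by positivity) (by positivity)
    refine mul_le_mul_of_nonneg_right ?_ (by positivity)
    linarith
  have e3 : Real.log x ≤ Real.log x ^ 4 := by
    simpa using pow_le_pow_right₀ hL.le (show 1 ≤ 4 by norm_num)
  have e4 : (Q : ℝ) * (13 * Q ^ 2 * U ^ 2 * Real.log x) ≤
      1200 * (Q ^ 3 * U ^ 2) * Real.log x ^ 4 := by
    calc (Q : ℝ) * (13 * Q ^ 2 * U ^ 2 * Real.log x) = 13 * (Q ^ 3 * U ^ 2) * Real.log x := by ring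
      _ ≤ 1200 * (Q ^ 3 * U ^ 2) * Real.log x ^ 4 := by gcongr; norm_num
  have h8 : 0 ≤ (x + x * Q / √U + √x * Q ^ 2) * Real.log x ^ 4 := by positivity
  calc _ ≤ 1200 * (Q ^ 3 * U ^ 2) * Real.log x ^ 4 + 3 * Real.log x * (128 *
        (3 * x + 3 * (x * Q / √U) + 3 * (√x * Q ^ 2)) * Real.log x ^ 3) := add_le_add e4 e2
    _ = 1200 * (Q ^ 3 * U ^ 2) * Real.log x ^ 4 +
        1152 * ((x + x * Q / √U + √x * Q ^ 2) * Real.log x ^ 4) := by ring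
    _ ≤ 1200 * (Q ^ 3 * U ^ 2) * Real.log x ^ 4 +
        1200 * ((x + x * Q / √U + √x * Q ^ 2) * Real.log x ^ 4) := by linarith
    _ = _ := by ring

end BombieriVinogradov

namespace BombieriVinogradov

open Complex MeasureTheory Set Filter Topology

lemma sum_le_of_dyadic {g : ℕ → ℝ} (hg : ∀ q, 0 ≤ g q) {x D M : ℝ} (hx : 3 ≤ x) {Q : ℕ}
    (hQ : Q ≤ x) (hM : 0 ≤ M)
    (h : ∀ R : ℕ, 0 < R → R ≤ Q → D ≤ 2 * R → (∑ q ∈ Finset.Icc 1 (2 * R), g q) / R ≤ M) :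
    ∑ q ∈ (Finset.Icc 1 Q).filter (fun q : ℕ => D < q), g q / q ≤ 3 * Real.log x * M := by
  obtain ⟨K, hK1, _, hK3, _⟩ := exists_two_pow_gt hx
  have hQK : Q < 2 ^ K := by
    have : (Q : ℝ) < 2 ^ K := hQ.trans_lt hK1
    exact_mod_cast this
  have hsub : (Finset.Icc 1 Q).filter (fun q : ℕ => D < q) =
      (Finset.Ico 1 (2 ^ K)).filter (fun q : ℕ => q ≤ Q ∧ D < q) := by
    ext q
    simp only [Finset.mem_filter, Finset.mem_Icc, Finset.mem_Ico]
    refine ⟨fun h => ⟨⟨h.1.1, h.1.2.trans_lt hQK⟩, h.1.2, h.2⟩,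
      fun h => ⟨⟨h.1.1, h.2.1⟩, h.2.2⟩⟩
  rw [hsub, Finset.sum_filter, sum_Ico_one_two_pow]
  have hblock : ∀ k ∈ Finset.range K, ∑ q ∈ Finset.Ico (2 ^ k) (2 ^ (k + 1)),
      (if q ≤ Q ∧ D < q then g q / q else 0) ≤ M := by
    intro k _
    by_cases hk : 2 ^ k ≤ Q ∧ D ≤ 2 * (2 ^ k : ℕ)
    · refine le_trans ?_ (h (2 ^ k) (by positivity) hk.1 hk.2)
      rw [Finset.sum_div]
      calc ∑ q ∈ Finset.Ico (2 ^ k) (2 ^ (k + 1)), (if q ≤ Q ∧ D < q then g q / q else 0)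
          ≤ ∑ q ∈ Finset.Ico (2 ^ k) (2 ^ (k + 1)), g q / (2 ^ k : ℕ) := by
            refine Finset.sum_le_sum fun q hq => ?_
            have hq1 : ((2 ^ k : ℕ) : ℝ) ≤ q := by exact_mod_cast (Finset.mem_Ico.1 hq).1
            have hq2 : (0 : ℝ) < (2 ^ k : ℕ) := by positivity
            have := hg q
            split_ifs
            · gcongr
            · positivity
        _ ≤ _ := by
            refine Finset.sum_le_sum_of_subset_of_nonneg (fun q hq => ?_) fun q _ _ =>
              div_nonneg (hg q) (Nat.cast_nonneg _)
            rw [Finset.mem_Ico, pow_succ] at hq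
            rw [Finset.mem_Icc]
            have : 0 < 2 ^ k := by positivity
            omega
    · refine le_trans (le_of_eq (Finset.sum_eq_zero fun q hq => if_neg fun hq2 => hk ?_)) hM
      rw [Finset.mem_Ico, pow_succ] at hq
      refine ⟨hq.1.trans hq2.1, hq2.2.le.trans ?_⟩
      have : q ≤ 2 * 2 ^ k := by omega
      exact_mod_cast this
  refine (Finset.sum_le_sum hblock).trans ?_
  rw [Finset.sum_const, Finset.card_range, nsmul_eq_mul]
  exact mul_le_mul_of_nonneg_right hK3 hM

/-- The sum of `‖ψ₁(x, χ)‖` over nontrivial primitive characters modulo `q`. -/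
noncomputable def primitiveSum (x : ℝ) (q : ℕ) : ℝ :=
  ∑ χ ∈ Finset.univ.filter (fun χ : DirichletCharacter ℂ q => χ.IsPrimitive ∧ χ ≠ 1),
    ‖smoothSum (fun n => charLambda χ n) x‖

lemma primitiveSum_nonneg (x : ℝ) (q : ℕ) : 0 ≤ primitiveSum x q :=
  Finset.sum_nonneg fun _ _ => norm_nonneg _

lemma sum_primitiveSum_large_le {A Q : ℕ} {x : ℝ} (hx : 3 ≤ x) (hQ0 : 1 ≤ Q)
    (hQ : Q * Real.log x ^ (4 * A + 20) ≤ √x) :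
    ∑ q ∈ (Finset.Icc 1 Q).filter (fun q : ℕ => Real.log x ^ (A + 5) < q),
      primitiveSum x q / q.totient ≤ 64800 * x / Real.log x ^ A := by
  have hx0 : 0 < x := by linarith
  have hL := one_lt_log hx
  obtain ⟨ℓ, hℓ⟩ : ∃ ℓ, ℓ = Real.log x := ⟨_, rfl⟩
  rw [← hℓ] at hL hQ ⊢
  have hL0 : 0 < ℓ := by linarith
  have hsx : √x ^ 2 = x := Real.sq_sqrt hx0.le
  have hQ1 : (1 : ℝ) ≤ Q := by exact_mod_cast hQ0
  have hp1 : ∀ n : ℕ, 1 ≤ ℓ ^ n := fun n => one_le_pow₀ hL.le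
  have hQx : (Q : ℝ) ^ 2 * ℓ ^ (8 * A + 40) ≤ x := by
    have := pow_le_pow_left₀ (by positivity) hQ 2
    rw [hsx] at this
    calc (Q : ℝ) ^ 2 * ℓ ^ (8 * A + 40) = (Q * ℓ ^ (4 * A + 20)) ^ 2 := by ring
      _ ≤ x := this
  obtain ⟨U, hU⟩ : ∃ U : ℕ, U = ⌊ℓ ^ (2 * A + 10)⌋₊ := ⟨_, rfl⟩
  have hU1 : 1 ≤ U := by rw [hU]; exact Nat.le_floor (by exact_mod_cast hp1 _)
  have hU2 : (U : ℝ) ≤ ℓ ^ (2 * A + 10) := by rw [hU]; exact Nat.floor_le (by positivity)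
  have hU3 : ℓ ^ (2 * A + 10) ≤ 2 * U := by
    have h1 : ℓ ^ (2 * A + 10) < U + 1 := by rw [hU]; exact Nat.lt_floor_add_one _
    have h2 : (1 : ℝ) ≤ U := by exact_mod_cast hU1
    linarith
  have hUs : ℓ ^ (A + 5) / 2 ≤ √U := by
    refine Real.le_sqrt_of_sq_le ?_
    calc (ℓ ^ (A + 5) / 2) ^ 2 = ℓ ^ (2 * A + 10) / 4 := by ring
      _ ≤ U := by linarith [(by positivity : (0 : ℝ) ≤ U)]
  have hUx : (U : ℝ) ≤ x := by
    refine hU2.trans (le_trans ?_ hQx)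
    calc ℓ ^ (2 * A + 10) ≤ ℓ ^ (8 * A + 40) := pow_le_pow_right₀ hL.le (by omega)
      _ = 1 ^ 2 * ℓ ^ (8 * A + 40) := by ring
      _ ≤ _ := by gcongr
  have hQx' : (Q : ℝ) ≤ x := by
    calc (Q : ℝ) ≤ Q ^ 2 := by nlinarith
      _ = Q ^ 2 * 1 := by ring
      _ ≤ Q ^ 2 * ℓ ^ (8 * A + 40) := by gcongr; exact hp1 _
      _ ≤ x := hQx
  obtain ⟨Y, hY⟩ : ∃ Y, Y = x / ℓ ^ (A + 5) := ⟨_, rfl⟩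
  have hY0 : 0 < Y := by rw [hY]; positivity
  have b1 : (Q : ℝ) ^ 2 * U ^ 2 ≤ Y := by
    rw [hY, le_div_iff₀ (by positivity)]
    calc (Q : ℝ) ^ 2 * U ^ 2 * ℓ ^ (A + 5) ≤
          Q ^ 2 * (ℓ ^ (2 * A + 10)) ^ 2 * ℓ ^ (A + 5) := by gcongr
      _ = Q ^ 2 * ℓ ^ (5 * A + 25) := by ring
      _ ≤ Q ^ 2 * ℓ ^ (8 * A + 40) :=
          mul_le_mul_of_nonneg_left (pow_le_pow_right₀ hL.le (by omega)) (by positivity)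
      _ ≤ x := hQx
  have b2 : √x * Q ≤ Y := by
    rw [hY, le_div_iff₀ (by positivity)]
    calc √x * Q * ℓ ^ (A + 5) ≤ √x * Q * ℓ ^ (4 * A + 20) :=
          mul_le_mul_of_nonneg_left (pow_le_pow_right₀ hL.le (by omega)) (by positivity)
      _ = √x * (Q * ℓ ^ (4 * A + 20)) := by ring
      _ ≤ √x * √x := by gcongr
      _ = x := by rw [← sq, hsx]
  have b3 : x / √U ≤ 2 * Y := by
    rw [hY, show 2 * (x / ℓ ^ (A + 5)) = x / (ℓ ^ (A + 5) / 2) by field_simp]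
    exact div_le_div_of_nonneg_left hx0.le (by positivity) hUs
  have key := sum_le_of_dyadic (g := fun q => (q / q.totient : ℝ) * primitiveSum x q)
    (fun q => mul_nonneg (by positivity) (primitiveSum_nonneg x q)) (D := ℓ ^ (A + 5))
    (M := 21600 * Y * ℓ ^ 4) hx hQx' (by positivity) ?_
  · calc _ = ∑ q ∈ (Finset.Icc 1 Q).filter (fun q : ℕ => ℓ ^ (A + 5) < q),
          (q / q.totient : ℝ) * primitiveSum x q / q := by
          refine Finset.sum_congr rfl fun q hq => ?_
          have hq1 : 0 < q := (Finset.mem_Icc.1 (Finset.mem_filter.1 hq).1).1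
          have : (q : ℝ) ≠ 0 := by positivity
          field_simp
      _ ≤ _ := key
      _ = _ := by
          rw [← hℓ, hY]
          field_simp
          ring
  · intro R hR hRQ hDR
    have hR0 : (0 : ℝ) < R := by exact_mod_cast hR
    have hRQ' : (R : ℝ) ≤ Q := by exact_mod_cast hRQ
    have h1 := vaughan_large_sieve hx hU1 hUx (2 * R)
    rw [← hℓ] at h1
    have h2 := div_le_div_of_nonneg_right h1 hR0.le
    refine h2.trans ?_
    have b4 : x / R ≤ 2 * Y := by
      rw [hY, show 2 * (x / ℓ ^ (A + 5)) = x / (ℓ ^ (A + 5) / 2) by field_simp]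
      exact div_le_div_of_nonneg_left hx0.le (by positivity) (by linarith)
    have b5 : (R : ℝ) ^ 2 * U ^ 2 ≤ Y := le_trans (by gcongr) b1
    have b6 : √x * R ≤ Y := le_trans (by gcongr) b2
    have hUs0 : 0 < √(U : ℝ) := lt_of_lt_of_le (by positivity) hUs
    have e : 1200 * ((((2 * R : ℕ) : ℝ)) ^ 3 * U ^ 2 + x + x * ((2 * R : ℕ) : ℝ) / √U +
        √x * ((2 * R : ℕ) : ℝ) ^ 2) * ℓ ^ 4 / R =
        1200 * (8 * (R ^ 2 * U ^ 2) + x / R + 2 * (x / √U) + 4 * (√x * R)) * ℓ ^ 4 := by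
      push_cast
      field_simp
      ring
    rw [e]
    refine mul_le_mul_of_nonneg_right ?_ (by positivity)
    linarith

/-- Average of `‖ψ₁(x, χ)‖` over primitive characters. -/
theorem exists_sum_primitiveSum_le (A : ℕ) : ∃ C : ℝ, 0 < C ∧ ∀ x : ℝ, 3 ≤ x → ∀ Q : ℕ,
    Q * Real.log x ^ (4 * A + 20) ≤ √x →
    ∑ q ∈ Finset.Icc 1 Q, primitiveSum x q / q.totient ≤ C * x / Real.log x ^ A := by
  obtain ⟨C, hC, hSW⟩ := exists_siegel_walfisz (2 * A + 5) (A + 5)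
  refine ⟨C + 64800, by positivity, fun x hx Q hQ => ?_⟩
  have hx0 : 0 < x := by linarith
  have hL := one_lt_log hx
  have hL0 : 0 < Real.log x := by linarith
  rcases Nat.eq_zero_or_pos Q with rfl | hQ0
  · simp only [Finset.Icc_eq_empty_of_lt zero_lt_one, Finset.sum_empty]
    positivity
  rw [← Finset.sum_filter_not_add_sum_filter _ (fun q : ℕ => Real.log x ^ (A + 5) < q), add_mul,
    add_div]
  refine add_le_add ?_ (sum_primitiveSum_large_le hx hQ0 hQ)
  have h1 : ∀ q ∈ (Finset.Icc 1 Q).filter (fun q : ℕ => ¬ Real.log x ^ (A + 5) < q),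
      primitiveSum x q / q.totient ≤ C * x / Real.log x ^ (2 * A + 5) := by
    intro q hq
    rw [Finset.mem_filter, Finset.mem_Icc, not_lt] at hq
    have hφ : (0 : ℝ) < q.totient := by exact_mod_cast Nat.totient_pos.2 hq.1.1
    rw [div_le_iff₀ hφ, primitiveSum]
    refine (Finset.sum_le_card_nsmul _ _ (C * x / Real.log x ^ (2 * A + 5))
      fun χ hχ => ?_).trans ?_
    · obtain ⟨-, h2, h3⟩ := Finset.mem_filter.1 hχ
      have : NeZero q := ⟨by omega⟩
      exact hSW q χ h2 h3 x hx hq.2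
    · rw [nsmul_eq_mul, mul_comm]
      refine mul_le_mul_of_nonneg_left ?_ (by positivity)
      exact_mod_cast card_finset_dirichletCharacter_le hq.1.1 _
  refine (Finset.sum_le_card_nsmul _ _ _ h1).trans ?_
  have h2 : (((Finset.Icc 1 Q).filter (fun q : ℕ => ¬ Real.log x ^ (A + 5) < q)).card : ℝ) ≤
      Real.log x ^ (A + 5) := by
    refine le_trans ?_ (Nat.floor_le (by positivity))
    norm_cast
    rw [← Nat.card_Icc 1 ⌊Real.log x ^ (A + 5)⌋₊ |>.trans (Nat.add_sub_cancel _ _)]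
    refine Finset.card_le_card fun q hq => ?_
    rw [Finset.mem_filter, Finset.mem_Icc, not_lt] at hq
    exact Finset.mem_Icc.2 ⟨hq.1.1, Nat.le_floor hq.2⟩
  rw [nsmul_eq_mul]
  refine (mul_le_mul_of_nonneg_right h2 (by positivity)).trans (le_of_eq ?_)
  rw [show 2 * A + 5 = (A + 5) + A by ring, pow_add _ (A + 5) A]
  field_simp

/-- The weight `log p` on primes. -/
noncomputable def primeLog (n : ℕ) : ℝ := if n.Prime then Real.log n else 0

lemma primeLog_nonneg (n : ℕ) : 0 ≤ primeLog n := by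
  unfold primeLog
  split_ifs
  · exact Real.log_natCast_nonneg n
  · rfl

lemma primeLog_le (n : ℕ) : primeLog n ≤ Real.log n := by
  unfold primeLog
  split_ifs
  · rfl
  · exact Real.log_natCast_nonneg n

lemma primeLog_le_vonMangoldt (n : ℕ) : primeLog n ≤ ArithmeticFunction.vonMangoldt n := by
  unfold primeLog
  split_ifs with h
  · exact (ArithmeticFunction.vonMangoldt_apply_prime h).ge
  · exact ArithmeticFunction.vonMangoldt_nonneg

/-- The smoothed sum of `χ(p) log p` over primes. -/
noncomputable def charTheta {q : ℕ} (χ : DirichletCharacter ℂ q) (x : ℝ) : ℂ :=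
  smoothSum (fun n => χ (n : ZMod q) * (primeLog n : ℂ)) x

lemma sum_dvd_primeLog_le {q : ℕ} (hq : 0 < q) (s : Finset ℕ) :
    ∑ n ∈ s.filter (fun n => n ∣ q), primeLog n ≤ Real.log q := by
  rw [← ArithmeticFunction.vonMangoldt_sum]
  calc ∑ n ∈ s.filter (fun n => n ∣ q), primeLog n
      ≤ ∑ n ∈ s.filter (fun n => n ∣ q), ArithmeticFunction.vonMangoldt n :=
        Finset.sum_le_sum fun n _ => primeLog_le_vonMangoldt n
    _ ≤ _ := by
        refine Finset.sum_le_sum_of_subset_of_nonneg (fun n hn => ?_)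
          fun _ _ _ => ArithmeticFunction.vonMangoldt_nonneg
        exact Nat.mem_divisors.2 ⟨(Finset.mem_filter.1 hn).2, hq.ne'⟩

lemma sum_vonMangoldt_sub_primeLog_le {x : ℝ} (hx : 1 ≤ x) :
    ∑ n ∈ Finset.Icc 1 ⌊x⌋₊, (ArithmeticFunction.vonMangoldt n - primeLog n) ≤
      2 * √x * Real.log x := by
  refine le_trans (le_of_eq ?_) (Chebyshev.psi_sub_theta_le hx)
  rw [Chebyshev.psi_sub_theta_eq_sum_not_prime, Finset.sum_filter]
  refine Finset.sum_congr (by ext; simp [Nat.succ_le_iff]) fun n _ => ?_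
  unfold primeLog
  by_cases h : n.Prime
  · simp [h, ArithmeticFunction.vonMangoldt_apply_prime]
  · simp [h]

lemma weight_mem {x : ℝ} (hx : 0 < x) {n : ℕ} (hn : n ∈ Finset.Icc 1 ⌊x⌋₊) :
    0 ≤ 1 - n / x ∧ 1 - n / x ≤ 1 := by
  have h : (n : ℝ) ≤ x := (Nat.le_floor_iff hx.le).1 (Finset.mem_Icc.1 hn).2
  have h1 : n / x ≤ 1 := (div_le_one hx).2 h
  have h2 : 0 ≤ n / x := by positivity
  constructor <;> linarith

lemma norm_smoothSum_sub_le {a b : ℕ → ℂ} {c : ℕ → ℝ} {x : ℝ} (hx : 0 < x)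
    (h : ∀ n ∈ Finset.Icc 1 ⌊x⌋₊, ‖a n - b n‖ ≤ c n) :
    ‖smoothSum a x - smoothSum b x‖ ≤ ∑ n ∈ Finset.Icc 1 ⌊x⌋₊, c n := by
  rw [smoothSum, smoothSum, ← Finset.sum_sub_distrib]
  refine (norm_sum_le _ _).trans (Finset.sum_le_sum fun n hn => ?_)
  obtain ⟨h0, h1⟩ := weight_mem hx hn
  rw [← sub_mul, norm_mul, Complex.norm_real, Real.norm_of_nonneg h0]
  exact (mul_le_of_le_one_right (norm_nonneg _) h1).trans (h n hn)

lemma norm_charTheta_le {q : ℕ} (hq : 0 < q) (χ : DirichletCharacter ℂ q) {x : ℝ} (hx : 1 ≤ x) :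
    ‖charTheta χ x‖ ≤ ‖smoothSum (fun n => charLambda χ.primitiveCharacter n) x‖ +
      (Real.log q + 2 * √x * Real.log x) := by
  have hx0 : 0 < x := by linarith
  have key : ‖charTheta χ x - smoothSum (fun n => charLambda χ.primitiveCharacter n) x‖ ≤
      ∑ n ∈ Finset.Icc 1 ⌊x⌋₊, ((if n ∣ q then primeLog n else 0) +
        (ArithmeticFunction.vonMangoldt n - primeLog n)) := by
    refine norm_smoothSum_sub_le hx0 fun n hn => ?_
    have hΛ : 0 ≤ ArithmeticFunction.vonMangoldt n - primeLog n :=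
      sub_nonneg.2 (primeLog_le_vonMangoldt n)
    rw [charLambda_apply]
    by_cases hp : n.Prime
    · have hpl : primeLog n = ArithmeticFunction.vonMangoldt n := by
        rw [primeLog, if_pos hp, ArithmeticFunction.vonMangoldt_apply_prime hp]
      rw [hpl, sub_self, add_zero]
      by_cases hd : n ∣ q
      · rw [if_pos hd, char_natCast_eq_zero χ (fun hc => ?_), zero_mul, zero_sub, norm_neg,
          norm_mul, Complex.norm_real, Real.norm_of_nonneg ArithmeticFunction.vonMangoldt_nonneg]
        · exact mul_le_of_le_one_left ArithmeticFunction.vonMangoldt_nonneg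
            (DirichletCharacter.norm_le_one _ _)
        · exact hp.one_lt.ne' (Nat.Coprime.eq_one_of_dvd hc hd)
      · have hc : n.Coprime q := (Nat.Prime.coprime_iff_not_dvd hp).2 hd
        have := changeLevel_natCast χ.conductor_dvd_level χ.primitiveCharacter hc
        rw [DirichletCharacter.changeLevel_primitiveCharacter] at this
        rw [if_neg hd, this, sub_self, norm_zero]
    · have hpl : primeLog n = 0 := if_neg hp
      rw [hpl]
      simp only [ofReal_zero, mul_zero, zero_sub, norm_neg, ite_self, sub_zero, zero_add,
        norm_mul, Complex.norm_real, Real.norm_of_nonneg ArithmeticFunction.vonMangoldt_nonneg]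
      exact mul_le_of_le_one_left ArithmeticFunction.vonMangoldt_nonneg
            (DirichletCharacter.norm_le_one _ _)
  rw [Finset.sum_add_distrib, ← Finset.sum_filter] at key
  have h1 := sum_dvd_primeLog_le hq (Finset.Icc 1 ⌊x⌋₊)
  have h2 := sum_vonMangoldt_sub_primeLog_le hx
  have h3 := norm_le_norm_add_norm_sub' (charTheta χ x)
    (smoothSum (fun n => charLambda χ.primitiveCharacter n) x)
  linarith

/-- The sum of `‖θ₁(x, χ)‖` over nontrivial characters modulo `q`. -/
noncomputable def nontrivialSum (x : ℝ) (q : ℕ) : ℝ :=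
  ∑ χ ∈ Finset.univ.filter (fun χ : DirichletCharacter ℂ q => χ ≠ 1), ‖charTheta χ x‖

lemma sum_primitiveCharacter_le {q : ℕ} (hq : 0 < q)
    (f : (r : ℕ) → DirichletCharacter ℂ r → ℝ) (hf : ∀ r χ, 0 ≤ f r χ) :
    ∑ χ ∈ Finset.univ.filter (fun χ : DirichletCharacter ℂ q => χ ≠ 1),
        f χ.conductor χ.primitiveCharacter ≤
      ∑ r ∈ q.divisors, ∑ ψ ∈ Finset.univ.filter
        (fun ψ : DirichletCharacter ℂ r => ψ.IsPrimitive ∧ ψ ≠ 1), f r ψ := by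
  rw [Finset.sum_sigma']
  obtain ⟨S, hS⟩ : ∃ S, S = Finset.univ.filter (fun χ : DirichletCharacter ℂ q => χ ≠ 1) :=
    ⟨_, rfl⟩
  have hS' : ∀ χ ∈ S, χ ≠ 1 := fun χ hχ => by
    rw [hS] at hχ
    exact (Finset.mem_filter.1 hχ).2
  rw [← hS]
  have hinj : Set.InjOn (fun χ : DirichletCharacter ℂ q =>
      (⟨χ.conductor, χ.primitiveCharacter⟩ : Σ r : ℕ, DirichletCharacter ℂ r)) S := by
    have hg : ∀ (u v : Σ r : ℕ, DirichletCharacter ℂ r) (hu : u.1 ∣ q) (hv : v.1 ∣ q), u = v →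
        DirichletCharacter.changeLevel hu u.2 = DirichletCharacter.changeLevel hv v.2 := by
      rintro u v hu hv rfl
      rfl
    intro χ₁ _ χ₂ _ h
    have := hg _ _ χ₁.conductor_dvd_level χ₂.conductor_dvd_level h
    rwa [DirichletCharacter.changeLevel_primitiveCharacter,
      DirichletCharacter.changeLevel_primitiveCharacter] at this
  rw [← Finset.sum_image (f := fun u : Σ r : ℕ, DirichletCharacter ℂ r => f u.1 u.2) hinj]
  refine Finset.sum_le_sum_of_subset_of_nonneg (fun u hu => ?_) fun u _ _ => hf _ _
  obtain ⟨χ, hχ, rfl⟩ := Finset.mem_image.1 hu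
  refine Finset.mem_sigma.2 ⟨Nat.mem_divisors.2 ⟨χ.conductor_dvd_level, hq.ne'⟩,
    Finset.mem_filter.2 ⟨Finset.mem_univ _, χ.primitiveCharacter_isPrimitive, fun h => ?_⟩⟩
  refine hS' χ hχ ?_
  have h' : χ.primitiveCharacter = 1 := h
  rw [← DirichletCharacter.changeLevel_primitiveCharacter χ, h', map_one]

lemma nontrivialSum_le {q : ℕ} (hq : 0 < q) {x : ℝ} (hx : 1 ≤ x) :
    nontrivialSum x q ≤ ∑ r ∈ q.divisors, primitiveSum x r +
      q.totient * (Real.log q + 2 * √x * Real.log x) := by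
  refine (Finset.sum_le_sum fun χ _ => norm_charTheta_le hq χ hx).trans ?_
  rw [Finset.sum_add_distrib]
  refine add_le_add (sum_primitiveCharacter_le hq
    (fun r ψ => ‖smoothSum (fun n => charLambda ψ n) x‖) fun _ _ => norm_nonneg _) ?_
  rw [Finset.sum_const, nsmul_eq_mul]
  refine mul_le_mul_of_nonneg_right ?_ ?_
  · exact_mod_cast card_finset_dirichletCharacter_le hq _
  · have := Real.log_natCast_nonneg q
    have := Real.log_nonneg hx
    positivity

lemma inv_totient_le {n : ℕ} (hn : 0 < n) : 1 / (n.totient : ℝ) ≤ n.divisors.card / n := by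
  have h1 : (0 : ℝ) < n.totient := by exact_mod_cast Nat.totient_pos.2 hn
  have h2 : (0 : ℝ) < n := by exact_mod_cast hn
  rw [div_le_div_iff₀ h1 h2, one_mul]
  have h3 : n ≤ n.divisors.card * n.totient := by
    conv_lhs => rw [← Nat.sum_totient n]
    rw [← smul_eq_mul]
    refine Finset.sum_le_card_nsmul _ _ _ fun d hd => ?_
    exact Nat.le_of_dvd (Nat.totient_pos.2 hn) (Nat.totient_dvd_of_dvd (Nat.dvd_of_mem_divisors hd))
  exact_mod_cast h3

lemma sum_inv_totient_le (Q : ℕ) :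
    ∑ q ∈ Finset.Icc 1 Q, 1 / (q.totient : ℝ) ≤ (1 + Real.log Q) ^ 2 := by
  refine le_trans ?_ (sum_card_divisors_div_le Q)
  refine (Finset.sum_le_sum fun q hq => inv_totient_le (Finset.mem_Icc.1 hq).1).trans ?_
  refine Finset.sum_le_sum_of_subset_of_nonneg (fun q hq => ?_) fun _ _ _ => by positivity
  have := (Finset.mem_Icc.1 hq).2
  exact Finset.mem_range.2 (by omega)

lemma sum_divisors_div_totient_le {f : ℕ → ℝ} (hf : ∀ r, 0 ≤ f r) (Q : ℕ) :
    ∑ q ∈ Finset.Icc 1 Q, (∑ r ∈ q.divisors, f r) / q.totient ≤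
      (∑ r ∈ Finset.Icc 1 Q, f r / r.totient) * (1 + Real.log Q) ^ 2 := by
  have h1 : ∀ q ∈ Finset.Icc 1 Q, (∑ r ∈ q.divisors, f r) / q.totient =
      ∑ r ∈ Finset.Icc 1 Q, if r ∣ q then f r * (1 / q.totient : ℝ) else 0 := by
    intro q hq
    rw [Finset.mem_Icc] at hq
    rw [Finset.sum_div, ← Finset.sum_filter]
    refine Finset.sum_congr ?_ fun r _ => by ring
    ext r
    simp only [Nat.mem_divisors, Finset.mem_filter, Finset.mem_Icc]
    refine ⟨fun h => ⟨⟨Nat.pos_of_dvd_of_pos h.1 hq.1, (Nat.le_of_dvd hq.1 h.1).trans hq.2⟩, h.1⟩,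
      fun h => ⟨h.2, by omega⟩⟩
  rw [Finset.sum_congr rfl h1, Finset.sum_comm, Finset.sum_mul]
  refine Finset.sum_le_sum fun r hr => ?_
  have hr0 := (Finset.mem_Icc.1 hr).1
  rw [← Finset.sum_filter, ← Finset.mul_sum, div_mul_eq_mul_div, mul_div_assoc]
  refine mul_le_mul_of_nonneg_left ?_ (hf r)
  have hsub : (Finset.Icc 1 Q).filter (fun q => r ∣ q) ⊆
      (Finset.Icc 1 Q).image (fun k => r * k) := by
    intro q hq
    obtain ⟨hq, k, rfl⟩ := Finset.mem_filter.1 hq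
    rw [Finset.mem_Icc] at hq
    have hk : 0 < k := Nat.pos_of_mul_pos_left hq.1
    exact Finset.mem_image.2 ⟨k, Finset.mem_Icc.2
      ⟨hk, (Nat.le_mul_of_pos_left k hr0).trans hq.2⟩, rfl⟩
  refine (Finset.sum_le_sum_of_subset_of_nonneg hsub fun _ _ _ => by positivity).trans ?_
  rw [Finset.sum_image fun a _ b _ h => Nat.eq_of_mul_eq_mul_left hr0 h]
  refine le_trans ?_ (div_le_div_of_nonneg_right (sum_inv_totient_le Q) (by positivity))
  rw [Finset.sum_div]
  refine Finset.sum_le_sum fun k hk => ?_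
  have hk0 := (Finset.mem_Icc.1 hk).1
  have h2 : (0 : ℝ) < r.totient := by exact_mod_cast Nat.totient_pos.2 hr0
  have h3 : (0 : ℝ) < k.totient := by exact_mod_cast Nat.totient_pos.2 hk0
  rw [div_div]
  refine one_div_le_one_div_of_le (by positivity) ?_
  rw [mul_comm]
  exact_mod_cast Nat.totient_super_multiplicative r k

/-- The error term for primes in progressions modulo `q`, uniform in the residue class. -/
noncomputable def thetaError (x : ℝ) (q : ℕ) : ℝ :=
  (nontrivialSum x q + Real.log q) / q.totient

theorem exists_sum_thetaError_le (A : ℕ) : ∃ C : ℝ, 0 < C ∧ ∀ x : ℝ, 3 ≤ x → ∀ Q : ℕ,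
    Q * Real.log x ^ (4 * A + 28) ≤ √x →
    ∑ q ∈ Finset.Icc 1 Q, thetaError x q ≤ C * x / Real.log x ^ A := by
  obtain ⟨C, hC, h⟩ := exists_sum_primitiveSum_le (A + 2)
  refine ⟨4 * C + 4, by positivity, fun x hx Q hQ => ?_⟩
  have hx0 : 0 < x := by linarith
  have hL := one_lt_log hx
  have hL0 : 0 < Real.log x := by linarith
  have hsq : √x * √x = x := Real.mul_self_sqrt hx0.le
  have hs1 : 1 ≤ √x := Real.one_le_sqrt.2 (by linarith)
  have hQx : (Q : ℝ) ≤ √x := le_trans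
    (le_mul_of_one_le_right (by positivity) (one_le_pow₀ hL.le)) hQ
  have hlogQ : ∀ q ∈ Finset.Icc 1 Q, Real.log q ≤ Real.log x := by
    intro q hq
    rw [Finset.mem_Icc] at hq
    have h1 : (1 : ℝ) ≤ q := by exact_mod_cast hq.1
    have h2 : (q : ℝ) ≤ Q := by exact_mod_cast hq.2
    refine Real.log_le_log (by linarith) (h2.trans (hQx.trans ?_))
    nlinarith
  have hterm : ∀ q ∈ Finset.Icc 1 Q, thetaError x q ≤
      (∑ r ∈ q.divisors, primitiveSum x r) / q.totient + 4 * √x * Real.log x := by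
    intro q hq
    have hq0 := (Finset.mem_Icc.1 hq).1
    have hφ : (1 : ℝ) ≤ q.totient := by exact_mod_cast Nat.totient_pos.2 hq0
    have h1 := nontrivialSum_le hq0 (x := x) (by linarith)
    have h2 := hlogQ q hq
    have h3 : Real.log q ≤ q.totient * (√x * Real.log x) := by
      have : Real.log x ≤ √x * Real.log x := le_mul_of_one_le_left hL0.le hs1
      have : √x * Real.log x ≤ q.totient * (√x * Real.log x) :=
        le_mul_of_one_le_left (by positivity) hφ
      linarith
    have h4 : (q.totient : ℝ) * Real.log q ≤ q.totient * (√x * Real.log x) := by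
      refine mul_le_mul_of_nonneg_left (h2.trans (le_mul_of_one_le_left hL0.le hs1)) (by positivity)
    rw [thetaError, div_add' _ _ _ (by positivity)]
    refine div_le_div_of_nonneg_right ?_ (by positivity)
    linarith
  refine (Finset.sum_le_sum hterm).trans ?_
  rw [Finset.sum_add_distrib, add_mul, add_div]
  refine add_le_add ?_ ?_
  · refine (sum_divisors_div_totient_le (primitiveSum_nonneg x) Q).trans ?_
    have h1 := h x hx Q (by rwa [show 4 * (A + 2) + 20 = 4 * A + 28 by ring])
    have h2 : (1 + Real.log Q) ^ 2 ≤ (2 * Real.log x) ^ 2 := by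
      refine pow_le_pow_left₀ (by have := Real.log_natCast_nonneg Q; linarith) ?_ 2
      rcases Nat.eq_zero_or_pos Q with rfl | hQ0
      · simp
        linarith
      · have := hlogQ Q (Finset.mem_Icc.2 ⟨hQ0, le_rfl⟩)
        linarith
    refine (mul_le_mul h1 h2 (by positivity) (by positivity)).trans (le_of_eq ?_)
    rw [pow_add]
    field_simp
    ring
  · rw [Finset.sum_const, Nat.card_Icc, Nat.add_sub_cancel, nsmul_eq_mul, le_div_iff₀ (by positivity)]
    calc (Q : ℝ) * (4 * √x * Real.log x) * Real.log x ^ A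
        = 4 * √x * (Q * Real.log x ^ (A + 1)) := by ring
      _ ≤ 4 * √x * √x := by
          refine mul_le_mul_of_nonneg_left (le_trans ?_ hQ) (by positivity)
          exact mul_le_mul_of_nonneg_left (pow_le_pow_right₀ hL.le (by omega)) (by positivity)
      _ = 4 * x := by rw [mul_assoc, hsq]

/-- The weight `log p` on primes `p ≡ a (mod q)`, balanced by its expected mean value. -/
noncomputable def progWeight {q : ℕ} (a : ZMod q) (n : ℕ) : ℝ :=
  primeLog n * ((if (n : ZMod q) = a then 1 else 0) - 1 / q.totient)

/-- The discrepancy `θ(N; q, a) - θ(N) / φ(q)`. -/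
noncomputable def thetaDiscrepancy {q : ℕ} (a : ZMod q) (N : ℕ) : ℝ :=
  ∑ n ∈ Finset.Icc 1 N, progWeight a n

lemma sum_char_primeLog_eq {q : ℕ} [NeZero q] {a : ZMod q} (ha : IsUnit a) (n : ℕ) :
    (q.totient : ℂ) * (progWeight a n : ℂ) =
      ∑ χ : DirichletCharacter ℂ q, χ a⁻¹ * (χ (n : ZMod q) * (primeLog n : ℂ)) -
        (primeLog n : ℂ) := by
  have hφ : (q.totient : ℂ) ≠ 0 := by
    exact_mod_cast (Nat.totient_pos.2 (NeZero.pos q)).ne'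
  have h := DirichletCharacter.sum_char_inv_mul_char_eq ℂ ha (n : ZMod q)
  simp_rw [← mul_assoc]
  rw [← Finset.sum_mul, h, progWeight]
  by_cases hn : a = n
  · simp only [hn, if_true]
    push_cast
    field_simp
  · rw [if_neg hn, if_neg (Ne.symm hn)]
    push_cast
    field_simp
    ring

lemma norm_charTheta_one_sub_le {q : ℕ} (hq : 0 < q) {x : ℝ} (hx : 0 < x) :
    ‖charTheta (1 : DirichletCharacter ℂ q) x - smoothSum (fun n => (primeLog n : ℂ)) x‖ ≤
      Real.log q := by
  refine le_trans ?_ (sum_dvd_primeLog_le hq (Finset.Icc 1 ⌊x⌋₊))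
  rw [Finset.sum_filter]
  refine norm_smoothSum_sub_le hx fun n _ => ?_
  by_cases hc : n.Coprime q
  · rw [MulChar.one_apply ((ZMod.isUnit_iff_coprime n q).2 hc), one_mul, sub_self, norm_zero]
    split_ifs
    · exact primeLog_nonneg n
    · rfl
  · rw [char_natCast_eq_zero _ hc, zero_mul, zero_sub, norm_neg, Complex.norm_real,
      Real.norm_of_nonneg (primeLog_nonneg n)]
    by_cases hp : n.Prime
    · rw [if_pos]
      by_contra hd
      exact hc ((Nat.Prime.coprime_iff_not_dvd hp).2 hd)
    · have : primeLog n = 0 := if_neg hp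
      simp [this]

lemma norm_smoothSum_progWeight_le {q : ℕ} (hq : 0 < q) {a : ZMod q} (ha : IsUnit a) {x : ℝ}
    (hx : 0 < x) : ‖smoothSum (fun n => (progWeight a n : ℂ)) x‖ ≤ thetaError x q := by
  have hφ : (0 : ℝ) < q.totient := by exact_mod_cast Nat.totient_pos.2 hq
  rw [thetaError, nontrivialSum]
  obtain ⟨S, hS⟩ : ∃ S, S = Finset.univ.filter (fun χ : DirichletCharacter ℂ q => χ ≠ 1) :=
    ⟨_, rfl⟩
  have hS1 : (1 : DirichletCharacter ℂ q) ∉ S := by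
    rw [hS]
    simp
  have hS2 : ∀ f : DirichletCharacter ℂ q → ℂ, ∑ χ, f χ = f 1 + ∑ χ ∈ S, f χ := by
    intro f
    have h : insert 1 S = Finset.univ := by
      rw [hS]
      ext χ
      by_cases h : χ = 1 <;> simp [h]
    rw [← h, Finset.sum_insert hS1]
  rw [← hS]
  have : NeZero q := ⟨hq.ne'⟩
  have key : (q.totient : ℂ) * smoothSum (fun n => (progWeight a n : ℂ)) x =
      ∑ χ ∈ S, χ a⁻¹ * charTheta χ x +
        (charTheta (1 : DirichletCharacter ℂ q) x - smoothSum (fun n => (primeLog n : ℂ)) x) := by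
    have h1 : (q.totient : ℂ) * smoothSum (fun n => (progWeight a n : ℂ)) x =
        ∑ χ : DirichletCharacter ℂ q, χ a⁻¹ * charTheta χ x -
          smoothSum (fun n => (primeLog n : ℂ)) x := by
      simp only [smoothSum, charTheta, Finset.mul_sum]
      rw [Finset.sum_comm, ← Finset.sum_sub_distrib]
      refine Finset.sum_congr rfl fun n _ => ?_
      rw [← mul_assoc, sum_char_primeLog_eq ha, sub_mul, Finset.sum_mul]
      simp_rw [mul_assoc]
    have ha' : IsUnit a⁻¹ := by
      obtain ⟨u, rfl⟩ := ha
      rw [ZMod.inv_coe_unit]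
      exact Units.isUnit _
    have h2 : ∑ χ : DirichletCharacter ℂ q, χ a⁻¹ * charTheta χ x =
        charTheta (1 : DirichletCharacter ℂ q) x + ∑ χ ∈ S, χ a⁻¹ * charTheta χ x := by
      rw [hS2, MulChar.one_apply ha', one_mul]
    rw [h1, h2]
    ring
  rw [le_div_iff₀ hφ, mul_comm]
  have h1 : (q.totient : ℝ) * ‖smoothSum (fun n => (progWeight a n : ℂ)) x‖ =
      ‖(q.totient : ℂ) * smoothSum (fun n => (progWeight a n : ℂ)) x‖ := by
    rw [norm_mul, Complex.norm_natCast]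
  rw [h1, key]
  refine (norm_add_le _ _).trans (add_le_add ?_ (norm_charTheta_one_sub_le hq hx))
  refine (norm_sum_le _ _).trans (Finset.sum_le_sum fun χ _ => ?_)
  rw [norm_mul]
  exact mul_le_of_le_one_left (norm_nonneg _) (DirichletCharacter.norm_le_one _ _)

lemma sum_Icc_mul_sub_eq (b : ℕ → ℝ) (m : ℕ) :
    ∑ n ∈ Finset.Icc 1 m, b n * ((m : ℝ) - n) =
      ∑ k ∈ Finset.range m, ∑ n ∈ Finset.Icc 1 k, b n := by
  induction m with
  | zero => simp
  | succ m ih =>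
    rw [Finset.sum_range_succ, ← ih, Finset.sum_Icc_succ_top (by omega), sub_self, mul_zero,
      add_zero, ← Finset.sum_add_distrib]
    refine Finset.sum_congr rfl fun n _ => ?_
    push_cast
    ring

lemma abs_sum_thetaDiscrepancy_le {q : ℕ} (hq : 0 < q) {a : ZMod q} (ha : IsUnit a) {m : ℕ}
    (hm : 0 < m) : |∑ k ∈ Finset.range m, thetaDiscrepancy a k| ≤ m * thetaError m q := by
  have hm' : (0 : ℝ) < m := by exact_mod_cast hm
  refine le_trans (le_of_eq ?_)
    (mul_le_mul_of_nonneg_left (norm_smoothSum_progWeight_le hq ha hm') hm'.le)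
  unfold thetaDiscrepancy
  have h : ∀ z : ℂ, (m : ℝ) * ‖z‖ = ‖(m : ℂ) * z‖ := fun z => by
    rw [norm_mul, Complex.norm_natCast]
  rw [← sum_Icc_mul_sub_eq, h, smoothSum, Nat.floor_natCast, Finset.mul_sum, ← Real.norm_eq_abs,
    ← Complex.norm_real]
  congr 1
  rw [Complex.ofReal_sum]
  refine Finset.sum_congr rfl fun n _ => ?_
  have : (m : ℂ) ≠ 0 := by exact_mod_cast hm.ne'
  push_cast
  field_simp

lemma thetaDiscrepancy_le_add {q : ℕ} (a : ZMod q) {M N : ℕ} (h : M ≤ N) :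
    thetaDiscrepancy a M ≤ thetaDiscrepancy a N + (N - M) * Real.log N / q.totient := by
  have h1 : thetaDiscrepancy a N = thetaDiscrepancy a M +
      ∑ n ∈ Finset.Ioc M N, progWeight a n := by
    unfold thetaDiscrepancy
    rw [← Finset.sum_union]
    · congr 1
      ext n
      simp only [Finset.mem_union, Finset.mem_Icc, Finset.mem_Ioc]
      omega
    · rw [Finset.disjoint_left]
      intro n
      simp only [Finset.mem_Icc, Finset.mem_Ioc]
      omega
  have h2 : ∑ n ∈ Finset.Ioc M N, -(Real.log N / q.totient) ≤
      ∑ n ∈ Finset.Ioc M N, progWeight a n := by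
    refine Finset.sum_le_sum fun n hn => ?_
    rw [Finset.mem_Ioc] at hn
    have h3 : primeLog n ≤ Real.log N := (primeLog_le n).trans
      (Real.log_le_log (by exact_mod_cast (by omega : 0 < n)) (by exact_mod_cast hn.2))
    have h4 : primeLog n / q.totient ≤ Real.log N / q.totient :=
      div_le_div_of_nonneg_right h3 (by positivity)
    have h5 : 0 ≤ primeLog n * (if (n : ZMod q) = a then 1 else 0) := by
      refine mul_nonneg (primeLog_nonneg n) ?_
      split_ifs <;> norm_num
    rw [progWeight, mul_sub, mul_one_div]
    linarith
  rw [Finset.sum_const, Nat.card_Ioc, nsmul_eq_mul, Nat.cast_sub h] at h2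
  rw [h1]
  have : ((N : ℝ) - M) * Real.log N / q.totient =
    -(((N : ℝ) - M) * -(Real.log N / q.totient)) := by ring
  linarith

lemma mul_abs_thetaDiscrepancy_le {q : ℕ} (hq : 0 < q) {a : ZMod q} (ha : IsUnit a) {N h : ℕ}
    (hh : h < N) :
    h * |thetaDiscrepancy a N| ≤ (N + h : ℕ) * thetaError (N + h : ℕ) q +
      N * thetaError N q + (N - h : ℕ) * thetaError (N - h : ℕ) q +
        h * (h * Real.log (N + h : ℕ) / q.totient) := by
  have hD1 := abs_le.1 (abs_sum_thetaDiscrepancy_le hq ha (m := N + h) (by omega))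
  have hD2 := abs_le.1 (abs_sum_thetaDiscrepancy_le hq ha (m := N) (by omega))
  have hD3 := abs_le.1 (abs_sum_thetaDiscrepancy_le hq ha (m := N - h) (by omega))
  have hlog : ∀ k : ℕ, 0 < k → k ≤ N + h → Real.log k ≤ Real.log (N + h : ℕ) := fun k h0 hk =>
    Real.log_le_log (by exact_mod_cast h0) (by exact_mod_cast hk)
  have e1 := Finset.sum_range_add_sum_Ico (fun k => thetaDiscrepancy a k)
    (by omega : N ≤ N + h)
  have e2 := Finset.sum_range_add_sum_Ico (fun k => thetaDiscrepancy a k)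
    (by omega : N - h ≤ N)
  have hstep : ∀ M K : ℕ, M ≤ K → K ≤ N + h → K ≤ M + h → 0 < K → thetaDiscrepancy a M ≤
      thetaDiscrepancy a K + h * Real.log (N + h : ℕ) / q.totient := by
    intro M K h1 h2 h3 h4
    refine (thetaDiscrepancy_le_add a h1).trans (add_le_add le_rfl ?_)
    refine div_le_div_of_nonneg_right (mul_le_mul ?_ (hlog K h4 h2) (Real.log_natCast_nonneg K)
      (by positivity)) (by positivity)
    have : (K : ℝ) ≤ M + h := by exact_mod_cast h3
    linarith
  have hf : ∑ k ∈ Finset.Ico N (N + h), (thetaDiscrepancy a N -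
      h * Real.log (N + h : ℕ) / q.totient) ≤
      ∑ k ∈ Finset.Ico N (N + h), thetaDiscrepancy a k := by
    refine Finset.sum_le_sum fun k hk => ?_
    rw [Finset.mem_Ico] at hk
    have := hstep N k hk.1 hk.2.le (by omega) (by omega)
    linarith
  have hb : ∑ k ∈ Finset.Ico (N - h) N, thetaDiscrepancy a k ≤
      ∑ k ∈ Finset.Ico (N - h) N, (thetaDiscrepancy a N +
        h * Real.log (N + h : ℕ) / q.totient) := by
    refine Finset.sum_le_sum fun k hk => ?_
    rw [Finset.mem_Ico] at hk
    exact hstep k N hk.2.le (by omega) (by omega) (by omega)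
  rw [Finset.sum_const, Nat.card_Ico, Nat.add_sub_cancel_left, nsmul_eq_mul] at hf
  rw [Finset.sum_const, Nat.card_Ico, Nat.sub_sub_self hh.le, nsmul_eq_mul] at hb
  have e0 : (h : ℝ) * |thetaDiscrepancy a N| = |h * thetaDiscrepancy a N| := by
    rw [abs_mul, Nat.abs_cast]
  have n1 : 0 ≤ ((N + h : ℕ) : ℝ) * thetaError (N + h : ℕ) q := (abs_nonneg _).trans
    (abs_sum_thetaDiscrepancy_le hq ha (m := N + h) (by omega))
  have n3 : 0 ≤ ((N - h : ℕ) : ℝ) * thetaError (N - h : ℕ) q := (abs_nonneg _).trans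
    (abs_sum_thetaDiscrepancy_le hq ha (m := N - h) (by omega))
  rw [e0, abs_le]
  constructor <;> linarith [hD1.1, hD1.2, hD2.1, hD2.2, hD3.1, hD3.2]

/-- The maximal discrepancy of `θ` over reduced residue classes modulo `q`. -/
noncomputable def thetaSup (N q : ℕ) : ℝ := ⨆ a : (ZMod q)ˣ, |thetaDiscrepancy (a : ZMod q) N|

lemma abs_thetaDiscrepancy_le_thetaSup {N q : ℕ} (a : (ZMod q)ˣ) :
    |thetaDiscrepancy (a : ZMod q) N| ≤ thetaSup N q := by
  have : Finite (ZMod q)ˣ := by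
    cases q
    · exact inferInstanceAs (Finite ℤˣ)
    · infer_instance
  exact le_ciSup (f := fun a : (ZMod q)ˣ => |thetaDiscrepancy (a : ZMod q) N|)
    (Finite.bddAbove_range _) a

lemma thetaSup_le {N q h : ℕ} (hq : 0 < q) (hh : 0 < h) (hN : h < N) :
    thetaSup N q ≤ (1 / h : ℝ) * ((N + h : ℕ) * thetaError (N + h : ℕ) q +
      N * thetaError N q + (N - h : ℕ) * thetaError (N - h : ℕ) q) +
        h * Real.log (N + h : ℕ) * (1 / q.totient) := by
  have hh' : (0 : ℝ) < h := by exact_mod_cast hh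
  refine ciSup_le fun a => ?_
  have := mul_abs_thetaDiscrepancy_le hq a.isUnit hN
  rw [mul_comm, ← le_div_iff₀ hh'] at this
  refine this.trans (le_of_eq ?_)
  field_simp

lemma two_le_log {x : ℝ} (hx : 8 ≤ x) : 2 ≤ Real.log x := by
  have h1 : Real.log 8 ≤ Real.log x := Real.log_le_log (by norm_num) hx
  have h2 : Real.log 8 = 3 * Real.log 2 := by
    rw [show (8 : ℝ) = 2 ^ 3 by norm_num, Real.log_pow]
    norm_num
  have := Real.log_two_gt_d9
  linarith

lemma sqrt_le_self_of_one_le {x : ℝ} (hx : 1 ≤ x) : √x ≤ x := by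
  rw [Real.sqrt_le_left (by linarith)]
  nlinarith

lemma half_log_le {x y : ℝ} (hx : 0 < x) (h : √x ≤ y) : Real.log x / 2 ≤ Real.log y := by
  rw [← Real.log_sqrt hx.le]
  exact Real.log_le_log (Real.sqrt_pos.2 hx) h

lemma one_add_log_sq_le {x : ℝ} (hx : 8 ≤ x) {Q : ℕ} (hQ : Q ≤ √x) :
    (1 + Real.log Q) ^ 2 ≤ (2 * Real.log x) ^ 2 := by
  have hL := two_le_log hx
  refine pow_le_pow_left₀ (by have := Real.log_natCast_nonneg Q; linarith) ?_ 2
  rcases Nat.eq_zero_or_pos Q with rfl | hQ0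
  · simp
    linarith
  · have h1 : (0 : ℝ) < Q := by exact_mod_cast hQ0
    have h2 : √x ≤ x := sqrt_le_self_of_one_le (by linarith)
    have := Real.log_le_log h1 (hQ.trans h2)
    linarith

lemma exists_sum_thetaSup_le_self (A : ℕ) : ∃ (B : ℕ) (C : ℝ), A ≤ B ∧ 0 < C ∧ ∀ N : ℕ, 8 ≤ N →
    ∀ Q : ℕ, Q * Real.log N ^ B ≤ √N →
    ∑ q ∈ Finset.Icc 1 Q, thetaSup N q ≤ C * N / Real.log N ^ A := by
  obtain ⟨A', hA'⟩ : ∃ A', A' = 2 * A + 3 := ⟨_, rfl⟩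
  obtain ⟨B', hB'⟩ : ∃ B', B' = 4 * A' + 28 := ⟨_, rfl⟩
  obtain ⟨C, hC, hS⟩ := exists_sum_thetaError_le A'
  refine ⟨2 * B' + 1, 12 * 2 ^ A' * C + 16, by omega, by positivity, fun N hN8 Q hQ => ?_⟩
  have hN : (8 : ℝ) ≤ N := by exact_mod_cast hN8
  have hN0 : (0 : ℝ) < N := by linarith
  have hL := two_le_log hN
  obtain ⟨ℓ, hℓ⟩ : ∃ ℓ, ℓ = Real.log N := ⟨_, rfl⟩
  rw [← hℓ] at hL hQ ⊢
  have hℓ0 : 0 < ℓ := by linarith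
  have hℓ1 : 1 ≤ ℓ := by linarith
  rcases Nat.eq_zero_or_pos Q with rfl | hQ0
  · simp only [Finset.Icc_eq_empty_of_lt zero_lt_one, Finset.sum_empty]
    positivity
  have hQ1 : (1 : ℝ) ≤ Q := by exact_mod_cast hQ0
  have hpow : ℓ ^ (2 * B' + 1) ≤ √N :=
    le_trans (le_mul_of_one_le_left (by positivity) hQ1) hQ
  have hsN : √(N : ℝ) ≤ N := sqrt_le_self_of_one_le (by linarith)
  have hQs : (Q : ℝ) ≤ √N := le_trans
    (le_mul_of_one_le_right (by positivity) (one_le_pow₀ hℓ1)) hQ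
  have hA3 : ℓ ^ (A + 3) ≤ N :=
    (pow_le_pow_right₀ hℓ1 (by omega)).trans (hpow.trans hsN)
  have h8 : (8 : ℝ) ≤ ℓ ^ (A + 3) := by
    have h1 : (2 : ℝ) ^ 3 ≤ ℓ ^ 3 := pow_le_pow_left₀ (by norm_num) hL 3
    have h2 : ℓ ^ 3 ≤ ℓ ^ (A + 3) := pow_le_pow_right₀ hℓ1 (by omega)
    linarith
  have hpos : 0 < ℓ ^ (A + 3) := by positivity
  obtain ⟨h, hh⟩ : ∃ h, h = ⌈N / ℓ ^ (A + 3)⌉₊ := ⟨_, rfl⟩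
  have hh1 : N / ℓ ^ (A + 3) ≤ h := hh ▸ Nat.le_ceil _
  have hone : 1 ≤ N / ℓ ^ (A + 3) := (one_le_div hpos).2 hA3
  have hh2 : (h : ℝ) ≤ 2 * (N / ℓ ^ (A + 3)) := by
    have := Nat.ceil_lt_add_one (zero_le_one.trans hone)
    rw [← hh] at this
    linarith
  have hh3 : (h : ℝ) ≤ N / 2 := by
    have h1 : N / ℓ ^ (A + 3) ≤ N / 8 := div_le_div_of_nonneg_left hN0.le (by norm_num) h8
    linarith
  have hh0 : (0 : ℝ) < h := by linarith
  have hhn : 0 < h := by exact_mod_cast hh0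
  have hhN : h < N := by
    have : (h : ℝ) < N := by linarith
    exact_mod_cast this
  have hlog2 : Real.log (2 * N) ≤ 2 * ℓ := by
    rw [Real.log_mul (by norm_num) hN0.ne', ← hℓ]
    have := Real.log_two_lt_d9
    linarith
  have hSm : ∀ m : ℝ, N / 2 ≤ m → m ≤ 2 * N →
      m * ∑ q ∈ Finset.Icc 1 Q, thetaError m q ≤ 4 * 2 ^ A' * C * N ^ 2 / ℓ ^ A' := by
    intro m h1 h2
    have hm0 : 0 < m := by linarith
    have hlm : ℓ / 2 ≤ Real.log m := by
      rw [hℓ]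
      refine half_log_le hN0 (le_trans ?_ h1)
      rw [Real.sqrt_le_left (by positivity)]
      nlinarith
    have hlm2 : Real.log m ≤ 2 * ℓ := (Real.log_le_log hm0 h2).trans hlog2
    have hsm : √N / 2 ≤ √m := by
      refine Real.le_sqrt_of_sq_le ?_
      rw [div_pow, Real.sq_sqrt hN0.le]
      linarith
    have hcond : Q * Real.log m ^ (4 * A' + 28) ≤ √m := by
      rw [← hB']
      have h3 : Real.log m ^ B' ≤ (2 * ℓ) ^ B' := pow_le_pow_left₀ (by linarith) hlm2 _
      have h4 : 2 * (2 * ℓ) ^ B' ≤ ℓ ^ (2 * B' + 1) := by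
        rw [pow_succ', pow_mul, sq]
        exact mul_le_mul hL (pow_le_pow_left₀ (by positivity)
          (mul_le_mul_of_nonneg_right hL hℓ0.le) _) (by positivity) (by positivity)
      have h5 : Q * (2 * Real.log m ^ B') ≤ Q * ℓ ^ (2 * B' + 1) :=
        mul_le_mul_of_nonneg_left (by linarith) (by positivity)
      linarith
    have h3 := hS m (by linarith) Q hcond
    have h4 : C * m / Real.log m ^ A' ≤ C * (2 * N) / (ℓ / 2) ^ A' := by
      refine div_le_div₀ (by positivity) (mul_le_mul_of_nonneg_left h2 hC.le) (by positivity)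
        (pow_le_pow_left₀ (by positivity) hlm _)
    calc m * ∑ q ∈ Finset.Icc 1 Q, thetaError m q
        ≤ (2 * N) * (C * (2 * N) / (ℓ / 2) ^ A') :=
          mul_le_mul_of_nonneg_left (h3.trans h4) hm0.le |>.trans
            (mul_le_mul_of_nonneg_right h2 (by positivity))
      _ = _ := by
          rw [div_pow]
          field_simp
          ring
  have hb1 := hSm (N + h : ℕ) (by push_cast; linarith) (by push_cast; linarith)
  have hb2 := hSm N (by linarith) (by linarith)
  have hb3 := hSm (N - h : ℕ) (by rw [Nat.cast_sub hhN.le]; linarith)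
    (by rw [Nat.cast_sub hhN.le]; linarith)
  refine (Finset.sum_le_sum fun q hq => thetaSup_le (Finset.mem_Icc.1 hq).1 hhn hhN).trans ?_
  rw [Finset.sum_add_distrib, ← Finset.mul_sum, ← Finset.mul_sum, Finset.sum_add_distrib,
    Finset.sum_add_distrib, ← Finset.mul_sum, ← Finset.mul_sum, ← Finset.mul_sum, add_mul, add_div]
  refine add_le_add ?_ ?_
  · have hinv : 1 / (h : ℝ) ≤ ℓ ^ (A + 3) / N := by
      rw [div_le_div_iff₀ hh0 hN0, one_mul]
      rw [div_le_iff₀ hpos] at hh1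
      linarith
    calc _ ≤ (1 / h : ℝ) * (3 * (4 * 2 ^ A' * C * N ^ 2 / ℓ ^ A')) :=
          mul_le_mul_of_nonneg_left (by linarith) (by positivity)
      _ ≤ ℓ ^ (A + 3) / N * (3 * (4 * 2 ^ A' * C * N ^ 2 / ℓ ^ A')) :=
          mul_le_mul_of_nonneg_right hinv (by positivity)
      _ = _ := by
          rw [show ℓ ^ A' = ℓ ^ (A + 3) * ℓ ^ A by rw [← pow_add]; congr 1; omega]
          field_simp
          ring
  · have h1 : Real.log (N + h : ℕ) ≤ 2 * ℓ := by
      refine (Real.log_le_log (by positivity) ?_).trans hlog2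
      push_cast
      linarith
    have h2 := (sum_inv_totient_le Q).trans (one_add_log_sq_le hN hQs)
    rw [← hℓ] at h2
    calc _ ≤ 2 * (N / ℓ ^ (A + 3)) * (2 * ℓ) * (2 * ℓ) ^ 2 := by
          refine mul_le_mul (mul_le_mul hh2 h1 (Real.log_natCast_nonneg _) (by positivity)) h2
            (Finset.sum_nonneg fun _ _ => by positivity) (by positivity)
      _ = _ := by
          rw [pow_add]
          field_simp
          ring

lemma thetaSup_le_of_le {n y q : ℕ} (hn : n ≤ y) :
    thetaSup n q ≤ thetaSup y q + y * Real.log y * (1 / q.totient) := by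
  refine ciSup_le fun a => (le_trans ?_ (add_le_add_left (abs_thetaDiscrepancy_le_thetaSup a) _))
  obtain ⟨T, hT⟩ : ∃ T : ℕ → ℝ, T = fun m => ∑ k ∈ Finset.Icc 1 m,
    primeLog k * (if (k : ZMod q) = a then 1 else 0) := ⟨_, rfl⟩
  obtain ⟨S, hS⟩ : ∃ S : ℕ → ℝ, S = fun m => ∑ k ∈ Finset.Icc 1 m, primeLog k := ⟨_, rfl⟩
  have hΔ : ∀ m, thetaDiscrepancy (a : ZMod q) m = T m - S m * (1 / q.totient) := by
    intro m
    rw [hT, hS]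
    simp only [thetaDiscrepancy, progWeight, mul_sub, Finset.sum_sub_distrib, Finset.sum_mul]
  have hsub : Finset.Icc 1 n ⊆ Finset.Icc 1 y := Finset.Icc_subset_Icc_right hn
  have hTn : ∀ k, 0 ≤ primeLog k * (if (k : ZMod q) = a then 1 else 0) := fun k =>
    mul_nonneg (primeLog_nonneg k) (by split_ifs <;> norm_num)
  have h1 : T n ≤ T y := by
    rw [hT]
    exact Finset.sum_le_sum_of_subset_of_nonneg hsub fun k _ _ => hTn k
  have h2 : S n ≤ S y := by
    rw [hS]
    exact Finset.sum_le_sum_of_subset_of_nonneg hsub fun k _ _ => primeLog_nonneg k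
  have h3 : 0 ≤ T n := by
    rw [hT]
    exact Finset.sum_nonneg fun k _ => hTn k
  have h4 : 0 ≤ S n := by
    rw [hS]
    exact Finset.sum_nonneg fun k _ => primeLog_nonneg k
  have h5 : S y ≤ y * Real.log y := by
    rw [hS]
    refine (Finset.sum_le_card_nsmul _ _ (Real.log y) fun k hk => ?_).trans (le_of_eq ?_)
    · rw [Finset.mem_Icc] at hk
      exact (primeLog_le k).trans (Real.log_le_log (by exact_mod_cast hk.1)
        (by exact_mod_cast hk.2))
    · rw [Nat.card_Icc, Nat.add_sub_cancel, nsmul_eq_mul]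
  have hφ : (0 : ℝ) ≤ 1 / q.totient := by positivity
  have h6 := mul_le_mul_of_nonneg_right h5 hφ
  have h7 := mul_le_mul_of_nonneg_right h2 hφ
  have h8 := mul_nonneg h4 hφ
  have h9 := le_abs_self (thetaDiscrepancy (a : ZMod q) y)
  have h10 := abs_nonneg (thetaDiscrepancy (a : ZMod q) y)
  rw [hΔ y] at h9 h10
  rw [hΔ n, hΔ y, abs_le]
  constructor <;> linarith

theorem exists_sum_thetaSup_le (A : ℕ) : ∃ (B : ℕ) (C : ℝ), 0 < C ∧ ∀ x : ℝ, 64 ≤ x →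
    ∀ Q : ℕ, Q * Real.log x ^ B ≤ √x → ∀ n : ℕ, n ≤ x →
    ∑ q ∈ Finset.Icc 1 Q, thetaSup n q ≤ C * x / Real.log x ^ A := by
  obtain ⟨B, C, -, hC, hS⟩ := exists_sum_thetaSup_le_self A
  obtain ⟨K, hK⟩ : ∃ K, K = A + 3 := ⟨_, rfl⟩
  refine ⟨B + K, 2 ^ A * C + 8, by positivity, fun x hx Q hQ n hn => ?_⟩
  have hx0 : 0 < x := by linarith
  have hL := two_le_log (by linarith : 8 ≤ x)
  obtain ⟨ℓ, hℓ⟩ : ∃ ℓ, ℓ = Real.log x := ⟨_, rfl⟩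
  rw [← hℓ] at hL hQ ⊢
  have hℓ0 : 0 < ℓ := by linarith
  have hℓ1 : 1 ≤ ℓ := by linarith
  rcases Nat.eq_zero_or_pos Q with rfl | hQ0
  · simp only [Finset.Icc_eq_empty_of_lt zero_lt_one, Finset.sum_empty]
    positivity
  have hQ1 : (1 : ℝ) ≤ Q := by exact_mod_cast hQ0
  have hKpos : 0 < ℓ ^ K := by positivity
  have hKs : ℓ ^ K ≤ √x := (pow_le_pow_right₀ hℓ1 (by omega)).trans
    (le_trans (le_mul_of_one_le_left (by positivity) hQ1) hQ)
  have hQs : (Q : ℝ) ≤ √x := le_trans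
    (le_mul_of_one_le_right (by positivity) (one_le_pow₀ hℓ1)) hQ
  have hsq : √x * √x = x := Real.mul_self_sqrt hx0.le
  have hs8 : 8 ≤ √x := Real.le_sqrt_of_sq_le (by linarith)
  have hxK : √x ≤ x / ℓ ^ K := by
    rw [le_div_iff₀ hKpos]
    nlinarith
  have hlarge : ∀ m : ℕ, x / ℓ ^ K ≤ m → m ≤ x →
      ∑ q ∈ Finset.Icc 1 Q, thetaSup m q ≤ 2 ^ A * C * x / ℓ ^ A := by
    intro m h1 h2
    have hm8 : (8 : ℝ) ≤ m := by linarith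
    have hlm : ℓ / 2 ≤ Real.log m := hℓ ▸ half_log_le hx0 (hxK.trans h1)
    have hlm2 : Real.log m ≤ ℓ := hℓ ▸ Real.log_le_log (by linarith) h2
    have hcond : Q * Real.log m ^ B ≤ √m := by
      have h3 : √x / ℓ ^ K ≤ √m := by
        refine Real.le_sqrt_of_sq_le (le_trans ?_ h1)
        rw [div_pow, Real.sq_sqrt hx0.le]
        exact div_le_div_of_nonneg_left hx0.le hKpos (le_self_pow₀ (one_le_pow₀ hℓ1) two_ne_zero)
      refine le_trans ?_ h3
      rw [le_div_iff₀ hKpos, mul_assoc]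
      refine le_trans (mul_le_mul_of_nonneg_left ?_ (by positivity)) hQ
      rw [pow_add]
      exact mul_le_mul_of_nonneg_right (pow_le_pow_left₀ (by linarith) hlm2 _) hKpos.le
    refine (hS m (by exact_mod_cast hm8) Q hcond).trans ?_
    calc C * m / Real.log m ^ A ≤ C * x / (ℓ / 2) ^ A :=
          div_le_div₀ (by positivity) (mul_le_mul_of_nonneg_left h2 hC.le) (by positivity)
            (pow_le_pow_left₀ (by positivity) hlm _)
      _ = _ := by
          rw [div_pow]
          field_simp
  rw [add_mul, add_div]
  by_cases hny : x / ℓ ^ K ≤ n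
  · exact (hlarge n hny hn).trans (le_add_of_nonneg_right (by positivity))
  obtain ⟨y, hy⟩ : ∃ y, y = ⌈x / ℓ ^ K⌉₊ := ⟨_, rfl⟩
  have hy1 : x / ℓ ^ K ≤ y := hy ▸ Nat.le_ceil _
  have hy2 : (y : ℝ) ≤ 2 * (x / ℓ ^ K) := by
    have := Nat.ceil_lt_add_one (a := x / ℓ ^ K) (by positivity)
    rw [← hy] at this
    linarith
  have hK2 : 2 ≤ ℓ ^ K := hL.trans (le_self_pow₀ hℓ1 (by omega))
  have hyx : (y : ℝ) ≤ x := by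
    refine hy2.trans ?_
    rw [← mul_div_assoc, div_le_iff₀ hKpos]
    nlinarith
  have hny' : n ≤ y := by
    have : (n : ℝ) ≤ y := (not_le.1 hny).le.trans hy1
    exact_mod_cast this
  refine (Finset.sum_le_sum fun q _ => thetaSup_le_of_le hny').trans ?_
  rw [Finset.sum_add_distrib, ← Finset.mul_sum]
  refine add_le_add (hlarge y hy1 hyx) ?_
  have h1 : Real.log y ≤ ℓ := hℓ ▸ Real.log_le_log (by linarith) hyx
  have h2 := (sum_inv_totient_le Q).trans (one_add_log_sq_le (by linarith) hQs)
  rw [← hℓ] at h2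
  calc _ ≤ 2 * (x / ℓ ^ K) * ℓ * (2 * ℓ) ^ 2 := by
        refine mul_le_mul (mul_le_mul hy2 h1 (Real.log_natCast_nonneg _) (by positivity)) h2
          (Finset.sum_nonneg fun _ _ => by positivity) (by positivity)
    _ = _ := by
        rw [hK, pow_add]
        field_simp
        ring

lemma sum_Icc_mul_eq_abel {b g : ℕ → ℝ} (hb : b 1 = 0) {N : ℕ} (hN : 2 ≤ N) :
    ∑ n ∈ Finset.Icc 1 N, b n * g n = g N * ∑ k ∈ Finset.Icc 1 N, b k +
      ∑ n ∈ Finset.Ico 2 N, (g n - g (n + 1)) * ∑ k ∈ Finset.Icc 1 n, b k := by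
  induction N, hN using Nat.le_induction with
  | base =>
    simp [Finset.sum_Icc_succ_top, hb]
    ring
  | succ N hN ih =>
    rw [Finset.sum_Icc_succ_top (by omega), ih, Finset.sum_Icc_succ_top (by omega),
      Finset.sum_Ico_succ_top hN]
    ring

lemma add_sum_Ico_sub_eq (g : ℕ → ℝ) {N : ℕ} (hN : 2 ≤ N) :
    g N + ∑ n ∈ Finset.Ico 2 N, (g n - g (n + 1)) = g 2 := by
  induction N, hN using Nat.le_induction with
  | base => simp
  | succ N hN ih =>
    rw [Finset.sum_Ico_succ_top hN]
    linarith

lemma inv_log_sub_nonneg {n : ℕ} (hn : 2 ≤ n) :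
    0 ≤ 1 / Real.log n - 1 / Real.log (n + 1 : ℕ) := by
  have h1 : (1 : ℝ) < n := by exact_mod_cast hn
  rw [sub_nonneg]
  refine one_div_le_one_div_of_le (Real.log_pos h1) (Real.log_le_log (by linarith) ?_)
  push_cast
  linarith

lemma primesBelowInAP_sub_eq {q : ℕ} (a : ZMod q) (x : ℝ) :
    (primesBelowInAP x q a : ℝ) - (Nat.primeCounting ⌊x⌋₊ : ℝ) / (Nat.totient q : ℝ) =
      ∑ n ∈ Finset.Icc 1 ⌊x⌋₊, progWeight a n * (1 / Real.log n) := by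
  have hsum : ∀ f : ℕ → ℝ, f 0 = 0 → ∑ n ∈ Finset.range (⌊x⌋₊ + 1), f n =
      ∑ n ∈ Finset.Icc 1 ⌊x⌋₊, f n := by
    intro f hf
    rw [Finset.range_eq_Ico, Finset.sum_eq_sum_Ico_succ_bot (by omega), hf, zero_add]
    rfl
  rw [primesBelowInAP, Nat.primeCounting, Nat.primeCounting', Nat.count_eq_card_filter_range,
    Finset.card_filter, Finset.card_filter, ← hsum _ (by simp)]
  push_cast
  rw [Finset.sum_div, ← Finset.sum_sub_distrib]
  refine Finset.sum_congr rfl fun n _ => ?_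
  rw [progWeight, primeLog]
  by_cases hp : n.Prime
  · have : Real.log n ≠ 0 := (Real.log_pos (by exact_mod_cast hp.one_lt)).ne'
    simp only [hp, true_and, if_true]
    field_simp
  · simp [hp]

/-- The maximal discrepancy of `π` over reduced residue classes modulo `q`. -/
noncomputable def primeSup (x : ℝ) (q : ℕ) : ℝ :=
  ⨆ a : (ZMod q)ˣ, |(primesBelowInAP x q (a : ZMod q) : ℝ) -
    (Nat.primeCounting ⌊x⌋₊ : ℝ) / (Nat.totient q : ℝ)|

lemma primeSup_le {x : ℝ} (hx : 2 ≤ x) (q : ℕ) :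
    primeSup x q ≤ 1 / Real.log ⌊x⌋₊ * thetaSup ⌊x⌋₊ q + ∑ n ∈ Finset.Ico 2 ⌊x⌋₊,
      (1 / Real.log n - 1 / Real.log (n + 1 : ℕ)) * thetaSup n q := by
  refine ciSup_le fun a => ?_
  have h1 : progWeight (a : ZMod q) 1 = 0 := by simp [progWeight, primeLog, Nat.not_prime_one]
  rw [primesBelowInAP_sub_eq, sum_Icc_mul_eq_abel (g := fun n => 1 / Real.log n) h1
    (Nat.le_floor (by exact_mod_cast hx))]
  refine (abs_add_le _ _).trans (add_le_add ?_ ?_)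
  · have h0 : 0 ≤ 1 / Real.log ⌊x⌋₊ := one_div_nonneg.2 (Real.log_natCast_nonneg _)
    rw [abs_mul, abs_of_nonneg h0]
    exact mul_le_mul_of_nonneg_left (abs_thetaDiscrepancy_le_thetaSup a) h0
  · refine (Finset.abs_sum_le_sum_abs _ _).trans (Finset.sum_le_sum fun n hn => ?_)
    have h0 := inv_log_sub_nonneg (Finset.mem_Ico.1 hn).1
    rw [abs_mul, abs_of_nonneg h0]
    exact mul_le_mul_of_nonneg_left (abs_thetaDiscrepancy_le_thetaSup a) h0

lemma sum_primeSup_le {x : ℝ} (hx : 2 ≤ x) {Q : ℕ} {M : ℝ}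
    (h : ∀ n : ℕ, n ≤ x → ∑ q ∈ Finset.Icc 1 Q, thetaSup n q ≤ M) :
    ∑ q ∈ Finset.Icc 1 Q, primeSup x q ≤ 1 / Real.log 2 * M := by
  refine (Finset.sum_le_sum fun q _ => primeSup_le hx q).trans ?_
  rw [Finset.sum_add_distrib, Finset.sum_comm, ← Finset.mul_sum]
  simp_rw [← Finset.mul_sum]
  have hfl : (⌊x⌋₊ : ℝ) ≤ x := Nat.floor_le (by linarith)
  have e := add_sum_Ico_sub_eq (fun n => 1 / Real.log n) (N := ⌊x⌋₊)
    (Nat.le_floor (by exact_mod_cast hx))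
  rw [Nat.cast_ofNat] at e
  rw [← e, add_mul, Finset.sum_mul]
  refine add_le_add (mul_le_mul_of_nonneg_left (h _ hfl)
    (one_div_nonneg.2 (Real.log_natCast_nonneg _))) (Finset.sum_le_sum fun n hn => ?_)
  rw [Finset.mem_Ico] at hn
  refine mul_le_mul_of_nonneg_left (h _ (le_trans ?_ hfl)) (inv_log_sub_nonneg hn.1)
  exact_mod_cast hn.2.le

lemma primeSup_le_of_le {x : ℝ} (hx : 0 ≤ x) {q : ℕ} (hq : 0 < q) :
    primeSup x q ≤ x + 1 := by
  have hfl : (⌊x⌋₊ : ℝ) ≤ x := Nat.floor_le hx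
  refine ciSup_le fun a => abs_sub_le_of_nonneg_of_le (by positivity) ?_ (by positivity) ?_
  · have : primesBelowInAP x q a ≤ ⌊x⌋₊ + 1 :=
      (Finset.card_filter_le _ _).trans (Finset.card_range _).le
    have : (primesBelowInAP x q a : ℝ) ≤ ⌊x⌋₊ + 1 := by exact_mod_cast this
    linarith
  · have h1 : (1 : ℝ) ≤ q.totient := by exact_mod_cast Nat.totient_pos.2 hq
    have h2 : Nat.primeCounting ⌊x⌋₊ ≤ ⌊x⌋₊ + 1 := Nat.count_le _
    have h3 : (Nat.primeCounting ⌊x⌋₊ : ℝ) ≤ ⌊x⌋₊ + 1 := by exact_mod_cast h2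
    refine (div_le_self (by positivity) h1).trans ?_
    linarith

end BombieriVinogradov

open BombieriVinogradov

/-- The Bombieri–Vinogradov theorem: for every `A > 0` there are `B, C > 0` such that
for all `x ≥ 2`,
`∑_{q ≤ √x (log x)^{-B}} max_{(a,q)=1} |π(x;q,a) − π(x)/φ(q)| ≤ C x (log x)^{-A}`. -/
theorem bombieri_vinogradov :
    ∀ A : ℝ, 0 < A → ∃ B C : ℝ, 0 < B ∧ 0 < C ∧ ∀ x : ℝ, 2 ≤ x →
      ∑ q ∈ Finset.Icc 1 ⌊Real.sqrt x * Real.log x ^ (-B)⌋₊,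
        ⨆ a : (ZMod q)ˣ,
          |(primesBelowInAP x q (a : ZMod q) : ℝ) -
            (Nat.primeCounting ⌊x⌋₊ : ℝ) / (Nat.totient q : ℝ)|
      ≤ C * x * Real.log x ^ (-A) := by
  intro A hA
  obtain ⟨B, C, hC, h⟩ := exists_sum_thetaSup_le ⌈A⌉₊
  have hlog2 := Real.log_pos one_lt_two
  obtain ⟨D, hD⟩ : ∃ D : ℝ, D = 8 * Real.log 2 ^ (-((B : ℝ) + 1)) * 65 := ⟨_, rfl⟩
  have hD0 : 0 ≤ D := by
    rw [hD]
    positivity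
  refine ⟨(B : ℝ) + 1, 1 / Real.log 2 * C + D * Real.log 64 ^ A, by positivity, by positivity,
    fun x hx => ?_⟩
  change ∑ q ∈ Finset.Icc 1 ⌊√x * Real.log x ^ (-((B : ℝ) + 1))⌋₊, primeSup x q ≤ _
  have hx0 : 0 < x := by linarith
  have hL : 0 < Real.log x := Real.log_pos (by linarith)
  rw [add_mul, add_mul]
  rcases le_or_gt 64 x with hx64 | hx64
  · have hL1 : 1 ≤ Real.log x := by
      have := two_le_log (by linarith : 8 ≤ x)
      linarith
    refine le_trans ?_ (le_add_of_nonneg_right (by positivity))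
    have hQ : (⌊√x * Real.log x ^ (-((B : ℝ) + 1))⌋₊ : ℝ) * Real.log x ^ B ≤ √x := by
      refine (mul_le_mul_of_nonneg_right (Nat.floor_le (by positivity)) (by positivity)).trans ?_
      rw [mul_assoc, ← Real.rpow_natCast, ← Real.rpow_add hL]
      exact mul_le_of_le_one_right (by positivity)
        (Real.rpow_le_one_of_one_le_of_nonpos hL1 (by linarith))
    refine (sum_primeSup_le hx (h x hx64 _ hQ)).trans ?_
    have h1 : Real.log x ^ A ≤ Real.log x ^ ⌈A⌉₊ := by
      rw [← Real.rpow_natCast]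
      exact Real.rpow_le_rpow_of_exponent_le hL1 (Nat.le_ceil A)
    refine (mul_le_mul_of_nonneg_left (div_le_div_of_nonneg_left (by positivity : (0 : ℝ) ≤ C * x)
      (by positivity : 0 < Real.log x ^ A) h1)
      (by positivity : 0 ≤ 1 / Real.log 2)).trans (le_of_eq ?_)
    rw [Real.rpow_neg hL.le]
    ring
  · refine le_trans ?_ (le_add_of_nonneg_left (by positivity))
    have hB : 0 ≤ (B : ℝ) + 1 := by positivity
    refine (Finset.sum_le_card_nsmul _ _ (65 : ℝ) fun q hq => ?_).trans ?_
    · refine (primeSup_le_of_le hx0.le (Finset.mem_Icc.1 hq).1).trans ?_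
      linarith
    rw [Nat.card_Icc, Nat.add_sub_cancel, nsmul_eq_mul]
    have h1 : √x ≤ 8 := Real.sqrt_le_left (by norm_num) |>.2 (by linarith)
    have h2 : Real.log x ^ (-((B : ℝ) + 1)) ≤ Real.log 2 ^ (-((B : ℝ) + 1)) :=
      Real.rpow_le_rpow_of_nonpos hlog2 (Real.log_le_log (by norm_num) hx) (by linarith)
    have h3 : (⌊√x * Real.log x ^ (-((B : ℝ) + 1))⌋₊ : ℝ) * 65 ≤ D := by
      rw [hD]
      refine mul_le_mul_of_nonneg_right ((Nat.floor_le (by positivity)).trans ?_) (by norm_num)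
      exact mul_le_mul h1 h2 (by positivity) (by norm_num)
    refine h3.trans ?_
    have h4 : Real.log x ^ A ≤ Real.log 64 ^ A :=
      Real.rpow_le_rpow hL.le (Real.log_le_log hx0 hx64.le) hA.le
    rw [Real.rpow_neg hL.le, ← div_eq_mul_inv, le_div_iff₀ (by positivity), mul_assoc]
    refine mul_le_mul_of_nonneg_left (h4.trans ?_) hD0
    exact le_mul_of_one_le_right (by positivity) (by linarith)
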